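/- arXiv:2104.10005 — 9 statements merged into one kernel-verified Lean document; each statement's English description precedes it below -/
import Mathlib

section
/- Let a_1, ..., a_n be real numbers with a_1^2 + ... + a_n^2 = 1, and let X = a_1 ε_1 + ... + a_n ε_n be the corresponding Rademacher sum. Then Pr[X > 0.35] ≥ 1/4. -/
open Finset

namespace Rademacher

/-- The Rademacher sum `∑ i, a i * ε i` evaluated at the sign vector `ε`. -/
noncomputable def signedSum {n : ℕ} (a : Fin n → ℝ) (ε : Fin n → Bool) : ℝ :=
  ∑ i, a i * (if ε i then (1 : ℝ) else -1)

/-- The sign vectors at which the Rademacher sum lies in `[-0.35, 0.35]`. -/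
noncomputable def middle {n : ℕ} (a : Fin n → ℝ) : Finset (Fin n → Bool) :=
  univ.filter fun ε => |signedSum a ε| ≤ 0.35

/-- The sign vector `ε` with the coordinates satisfying `b` flipped. -/
def flipSigns {n : ℕ} (b ε : Fin n → Bool) : Fin n → Bool := fun i => xor (ε i) (b i)

lemma flipSigns_involutive {n : ℕ} (b : Fin n → Bool) : Function.Involutive (flipSigns b) := by
  intro ε
  funext i
  simp [flipSigns]

lemma signedSum_flipSigns_true {n : ℕ} (a : Fin n → ℝ) (ε : Fin n → Bool) :
    signedSum a (flipSigns (fun _ => true) ε) = -signedSum a ε := by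
  unfold signedSum
  rw [← Finset.sum_neg_distrib]
  refine Finset.sum_congr rfl fun i _ => ?_
  cases h : ε i <;> simp [flipSigns, h]

lemma two_mul_card_gt_add_card_middle {n : ℕ} (a : Fin n → ℝ) :
    2 * (univ.filter fun ε : Fin n → Bool => (0.35 : ℝ) < signedSum a ε).card +
      (middle a).card = 2 ^ n := by
  have hneg : (univ.filter fun ε : Fin n → Bool => signedSum a ε < -0.35).card =
      (univ.filter fun ε : Fin n → Bool => (0.35 : ℝ) < signedSum a ε).card := by
    refine Finset.card_bij (fun ε _ => flipSigns (fun _ => true) ε) ?_ ?_ ?_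
    · intro ε h
      simp only [mem_filter, mem_univ, true_and] at h ⊢
      rw [signedSum_flipSigns_true]
      linarith
    · intro x _ y _ h
      exact (flipSigns_involutive _).injective h
    · intro ε h
      refine ⟨flipSigns (fun _ => true) ε, ?_, flipSigns_involutive _ ε⟩
      simp only [mem_filter, mem_univ, true_and] at h ⊢
      rw [signedSum_flipSigns_true]
      linarith
  have hout : (univ.filter fun ε : Fin n → Bool => ¬ |signedSum a ε| ≤ 0.35) =
      (univ.filter fun ε : Fin n → Bool => (0.35 : ℝ) < signedSum a ε) ∪
        (univ.filter fun ε : Fin n → Bool => signedSum a ε < -0.35) := by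
    ext ε
    simp only [mem_filter, mem_univ, true_and, mem_union, not_le, lt_abs]
    constructor <;> rintro (h | h)
    · exact Or.inl h
    · exact Or.inr (by linarith)
    · exact Or.inl h
    · exact Or.inr (by linarith)
  have hdisj : Disjoint (univ.filter fun ε : Fin n → Bool => (0.35 : ℝ) < signedSum a ε)
      (univ.filter fun ε : Fin n → Bool => signedSum a ε < -0.35) := by
    refine Finset.disjoint_filter.2 fun ε _ h1 h2 => ?_
    linarith
  have htot := Finset.card_filter_add_card_filter_not (s := (univ : Finset (Fin n → Bool)))
    (fun ε => |signedSum a ε| ≤ 0.35)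
  rw [hout, Finset.card_union_of_disjoint hdisj, hneg] at htot
  simp only [card_univ, Fintype.card_pi, Fintype.card_bool, prod_const, Fintype.card_fin] at htot
  unfold middle
  omega

/-- A coefficient larger than `0.35` already splits the sign vectors in pairs, at most one of each
being in the middle. -/
lemma two_mul_card_middle_le_of_large {n : ℕ} (a : Fin n → ℝ) (j : Fin n) (hj : 0.35 < |a j|) :
    2 * (middle a).card ≤ 2 ^ n := by
  have hsub : (middle a).image (flipSigns fun i => decide (i = j)) ⊆ (middle a)ᶜ := by
    intro x hx
    obtain ⟨ε, hε, rfl⟩ := Finset.mem_image.1 hx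
    simp only [middle, mem_compl, mem_filter, mem_univ, true_and] at hε ⊢
    intro h
    have hdiff : signedSum a (flipSigns (fun i => decide (i = j)) ε) - signedSum a ε =
        -2 * (a j * (if ε j then (1 : ℝ) else -1)) := by
      unfold signedSum
      rw [← Finset.sum_sub_distrib, Finset.sum_eq_single j]
      · cases h : ε j <;> simp [flipSigns, h] <;> ring
      · intro i _ hi
        simp [flipSigns, hi]
      · simp
    rw [abs_le] at hε h
    rcases lt_abs.1 hj with hj | hj <;> cases h' : ε j <;> simp [h'] at hdiff <;> linarith
  have hcard := Finset.card_le_card hsub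
  rw [Finset.card_image_of_injective _ (flipSigns_involutive _).injective,
    Finset.card_compl] at hcard
  have hle := Finset.card_le_univ (middle a)
  simp only [Fintype.card_pi, Fintype.card_bool, prod_const, card_univ, Fintype.card_fin]
    at hcard hle
  omega

/-- A family of subsets of an eight-element set without a chain of length three has at most
`C(8,3) + C(8,4)` members. -/
lemma card_le_of_no_three_chain (F : Finset (Finset (Fin 8)))
    (hF : ∀ A ∈ F, ∀ B ∈ F, ∀ C ∈ F, A ⊂ B → ¬ B ⊂ C) : F.card ≤ 126 := by
  classical
  set M := F.filter fun A => ∀ B ∈ F, ¬ B ⊂ A with hM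
  set N := F.filter fun A => ¬ ∀ B ∈ F, ¬ B ⊂ A with hN
  have hMa : IsAntichain (· ⊆ ·) (M : Set (Finset (Fin 8))) := by
    intro A hA B hB hne hAB
    simp only [hM, coe_filter, Set.mem_ofPred_eq] at hA hB
    exact hB.2 A hA.1 (hAB.ssubset_of_ne hne)
  have hNa : IsAntichain (· ⊆ ·) (N : Set (Finset (Fin 8))) := by
    intro A hA B hB hne hAB
    simp only [hN, coe_filter, Set.mem_ofPred_eq] at hA hB
    obtain ⟨hA, hA'⟩ := hA
    push Not at hA'
    obtain ⟨C, hC, hCA⟩ := hA'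
    exact hF C hC A hA B hB.1 hCA (hAB.ssubset_of_ne hne)
  have h1 := Finset.lubell_yamamoto_meshalkin_inequality_sum_inv_choose (𝕜 := ℚ) hMa
  have h2 := Finset.lubell_yamamoto_meshalkin_inequality_sum_inv_choose (𝕜 := ℚ) hNa
  have hsum := Finset.sum_filter_add_sum_filter_not F (fun A => ∀ B ∈ F, ¬ B ⊂ A)
    (fun A => (((Fintype.card (Fin 8)).choose A.card : ℚ))⁻¹)
  have hfour : (F.filter fun A => A.card = 4).card ≤ 70 := by
    calc (F.filter fun A => A.card = 4).card ≤ (powersetCard 4 (univ : Finset (Fin 8))).card := by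
          refine Finset.card_le_card fun A hA => ?_
          simp only [mem_filter] at hA
          simp [mem_powersetCard, hA.2]
      _ = 70 := by simp [card_powersetCard]; decide
  have hpt : ∀ A ∈ F, (1 : ℚ) ≤
      56 * (((Fintype.card (Fin 8)).choose A.card : ℚ))⁻¹ + if A.card = 4 then 1 / 5 else 0 := by
    intro A _
    have hA : A.card ≤ 8 := by simpa using Finset.card_le_univ A
    rw [Fintype.card_fin]
    interval_cases A.card <;> norm_num [Nat.choose]
  have htot := Finset.sum_le_sum hpt
  rw [Finset.sum_add_distrib, ← Finset.mul_sum, ← Finset.sum_filter] at htot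
  simp only [sum_const, nsmul_eq_mul, mul_one] at htot
  have hfour' : ((F.filter fun A => A.card = 4).card : ℚ) ≤ 70 := by exact_mod_cast hfour
  have hfin : (F.card : ℚ) ≤ 126 := by linarith
  exact_mod_cast hfin

/-- The sign vector `ε` with the coordinates in the image of `T` under `e` flipped. -/
def flipOn {n : ℕ} (e : Fin 8 ↪ Fin n) (T : Finset (Fin 8)) : (Fin n → Bool) → (Fin n → Bool) :=
  flipSigns fun i => decide (i ∈ T.map e)

/-- The positions at which the term of the Rademacher sum is positive. -/
noncomputable def aligned {n : ℕ} (a : Fin n → ℝ) (e : Fin 8 ↪ Fin n) (ε : Fin n → Bool) :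
    Finset (Fin 8) :=
  univ.filter fun k => (xor (ε (e k)) (decide (a (e k) < 0))) = true

lemma signedSum_flipOn_lt {n : ℕ} (a : Fin n → ℝ) (e : Fin 8 ↪ Fin n)
    (he : ∀ k, 0.175 < |a (e k)|) (ε : Fin n → Bool) {A B : Finset (Fin 8)}
    (hAB : symmDiff A (aligned a e ε) ⊂ symmDiff B (aligned a e ε)) :
    signedSum a (flipOn e A ε) + 0.35 < signedSum a (flipOn e B ε) := by
  obtain ⟨k, hkB, hkA⟩ := Finset.exists_of_ssubset hAB
  have hval : ∀ (T : Finset (Fin 8)) (k : Fin 8),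
      a (e k) * (if flipOn e T ε (e k) then (1 : ℝ) else -1) =
        if k ∈ symmDiff T (aligned a e ε) then |a (e k)| else -|a (e k)| := by
    intro T k
    rcases lt_or_ge (a (e k)) 0 with h | h <;> by_cases hT : k ∈ T <;> cases hε : ε (e k) <;>
      simp [flipOn, flipSigns, aligned, Finset.mem_symmDiff, h, hT, hε, abs_of_neg, abs_of_nonneg,
        not_lt.2]
  have hmono : ∀ i, a i * (if flipOn e A ε i then (1 : ℝ) else -1) ≤
      a i * (if flipOn e B ε i then (1 : ℝ) else -1) := by
    intro i
    by_cases hi : ∃ k, e k = i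
    · obtain ⟨k, rfl⟩ := hi
      rw [hval, hval]
      have hk (h : k ∈ symmDiff A (aligned a e ε)) := hAB.subset h
      have hnn := abs_nonneg (a (e k))
      split_ifs with h1 h2 <;> first | linarith | exact absurd (hk h1) h2
    · have hT : ∀ T : Finset (Fin 8), i ∉ T.map e := fun T h => by
        obtain ⟨k, -, hk⟩ := Finset.mem_map.1 h
        exact hi ⟨k, hk⟩
      simp only [flipOn, flipSigns, hT, decide_false, Bool.xor_false, le_refl]
  have hstep := Finset.single_le_sum (f := fun i =>
    a i * (if flipOn e B ε i then (1 : ℝ) else -1) - a i * (if flipOn e A ε i then (1 : ℝ) else -1))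
    (fun i _ => sub_nonneg.2 (hmono i)) (mem_univ (e k))
  simp only [hval, if_pos hkB, if_neg hkA, Finset.sum_sub_distrib] at hstep
  unfold signedSum
  linarith [he k]

lemma two_mul_card_middle_le_of_eight {n : ℕ} (a : Fin n → ℝ) (e : Fin 8 ↪ Fin n)
    (he : ∀ k, 0.175 < |a (e k)|) : 2 * (middle a).card ≤ 2 ^ n := by
  classical
  have hfiber : ∀ ε : Fin n → Bool,
      (univ.filter fun T : Finset (Fin 8) => flipOn e T ε ∈ middle a).card ≤ 126 := by
    intro ε
    rw [← Finset.card_image_of_injective _ (symmDiff_left_injective (aligned a e ε))]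
    refine card_le_of_no_three_chain _ fun A hA B hB C hC hAB hBC => ?_
    obtain ⟨A, hAF, rfl⟩ := Finset.mem_image.1 hA
    obtain ⟨B, -, rfl⟩ := Finset.mem_image.1 hB
    obtain ⟨C, hCF, rfl⟩ := Finset.mem_image.1 hC
    have h1 := signedSum_flipOn_lt a e he ε hAB
    have h2 := signedSum_flipOn_lt a e he ε hBC
    have hA' := abs_le.1 (mem_filter.1 (mem_filter.1 hAF).2).2
    have hC' := abs_le.1 (mem_filter.1 (mem_filter.1 hCF).2).2
    linarith [hA'.1, hC'.2]
  have hT : ∀ T : Finset (Fin 8),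
      (univ.filter fun ε : Fin n → Bool => flipOn e T ε ∈ middle a).card = (middle a).card := by
    intro T
    have hinj : Function.Involutive (flipOn e T) := flipSigns_involutive _
    refine Finset.card_bij (fun ε _ => flipOn e T ε) ?_ ?_ ?_
    · intro ε h
      simpa using h
    · intro x _ y _ h
      exact hinj.injective h
    · intro ε h
      exact ⟨flipOn e T ε, by simpa [hinj ε] using h, hinj ε⟩
  have hdouble : ∑ T : Finset (Fin 8),
      (univ.filter fun ε : Fin n → Bool => flipOn e T ε ∈ middle a).card =
      ∑ ε : Fin n → Bool,
        (univ.filter fun T : Finset (Fin 8) => flipOn e T ε ∈ middle a).card := by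
    simp only [Finset.card_filter]
    exact Finset.sum_comm
  have hle := Finset.sum_le_sum fun (ε : Fin n → Bool) (_ : ε ∈ univ) => hfiber ε
  rw [← hdouble, Finset.sum_congr rfl fun T _ => hT T] at hle
  simp only [sum_const, card_univ, Fintype.card_finset, Fintype.card_fin, Fintype.card_pi,
    Fintype.card_bool, prod_const, smul_eq_mul] at hle
  omega

lemma cos_le_exp_neg_sq_div_two {x : ℝ} (hx : |x| ≤ Real.pi / 2) :
    |Real.cos x| ≤ Real.exp (-x ^ 2 / 2) := by
  have key : ∀ y ∈ Set.Icc (0 : ℝ) (Real.pi / 2), Real.cos y * Real.exp (y ^ 2 / 2) ≤ 1 := by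
    have hanti : AntitoneOn (fun y => Real.cos y * Real.exp (y ^ 2 / 2))
        (Set.Icc (0 : ℝ) (Real.pi / 2)) := by
      refine antitoneOn_of_hasDerivWithinAt_nonpos (convex_Icc _ _) (by fun_prop)
        (f' := fun y => -Real.sin y * Real.exp (y ^ 2 / 2) +
          Real.cos y * (Real.exp (y ^ 2 / 2) * y)) ?_ ?_
      · intro y _
        refine HasDerivAt.hasDerivWithinAt ?_
        refine (Real.hasDerivAt_cos y).mul (HasDerivAt.exp ?_)
        simpa using (hasDerivAt_pow 2 y).div_const 2
      · intro y hy
        rw [interior_Icc] at hy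
        have hc : 0 < Real.cos y :=
          Real.cos_pos_of_mem_Ioo ⟨by linarith [hy.1, Real.pi_pos], hy.2⟩
        have ht := Real.le_tan hy.1.le hy.2
        rw [Real.tan_eq_sin_div_cos, le_div_iff₀ hc] at ht
        nlinarith [Real.exp_pos (y ^ 2 / 2)]
    intro y hy
    simpa using hanti (Set.left_mem_Icc.2 (by positivity)) hy hy.1
  have h := key |x| ⟨abs_nonneg x, hx⟩
  rw [Real.cos_abs, sq_abs] at h
  have hpos : 0 ≤ Real.cos x := Real.cos_nonneg_of_mem_Icc (abs_le.1 hx)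
  rw [abs_of_nonneg hpos, neg_div, Real.exp_neg, ← one_div, le_div_iff₀ (Real.exp_pos _)]
  exact h

lemma abs_prod_cos_le {n : ℕ} (a : Fin n → ℝ) (v : ℝ) (S : Finset (Fin n))
    (hS : ∀ i ∈ S, |v * a i| ≤ Real.pi / 2) :
    |∏ i, Real.cos (v * a i)| ≤ Real.exp (-(v ^ 2 * ∑ i ∈ S, a i ^ 2) / 2) := by
  rw [Finset.abs_prod]
  calc ∏ i, |Real.cos (v * a i)| ≤ ∏ i ∈ S, |Real.cos (v * a i)| :=
        Finset.prod_le_prod_of_subset_of_le_one (subset_univ S) (fun _ _ => abs_nonneg _)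
          fun i _ _ => Real.abs_cos_le_one _
    _ ≤ ∏ i ∈ S, Real.exp (-(v * a i) ^ 2 / 2) :=
        Finset.prod_le_prod (fun _ _ => abs_nonneg _) fun i hi => cos_le_exp_neg_sq_div_two (hS i hi)
    _ = Real.exp (-(v ^ 2 * ∑ i ∈ S, a i ^ 2) / 2) := by
        rw [← Real.exp_sum, Finset.mul_sum, ← Finset.sum_neg_distrib, Finset.sum_div]
        refine congrArg _ (Finset.sum_congr rfl fun i _ => by ring)

lemma sum_cos_mul_signedSum {n : ℕ} (a : Fin n → ℝ) (v : ℝ) :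
    ∑ ε, Real.cos (v * signedSum a ε) = 2 ^ n * ∏ i, Real.cos (v * a i) := by
  have hprod := Finset.prod_univ_sum (fun _ : Fin n => (univ : Finset Bool))
    (fun i b => Complex.exp (((v * (a i * if b then (1 : ℝ) else -1) : ℝ) : ℂ) * Complex.I))
  have hfac : ∀ i, ∑ b : Bool,
      Complex.exp (((v * (a i * if b then (1 : ℝ) else -1) : ℝ) : ℂ) * Complex.I) =
      ((2 * Real.cos (v * a i) : ℝ) : ℂ) := by
    intro i
    rw [Fintype.sum_bool]
    push_cast
    rw [Complex.two_cos]
    simp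
  rw [Finset.prod_congr rfl fun i _ => hfac i, Fintype.piFinset_univ, ← Complex.ofReal_prod,
    Finset.prod_mul_distrib] at hprod
  have hterm : ∀ ε : Fin n → Bool, ∏ i,
      Complex.exp (((v * (a i * if ε i then (1 : ℝ) else -1) : ℝ) : ℂ) * Complex.I) =
      Complex.exp (((v * signedSum a ε : ℝ) : ℂ) * Complex.I) := by
    intro ε
    rw [← Complex.exp_sum, ← Finset.sum_mul, signedSum, Finset.mul_sum, Complex.ofReal_sum]
  rw [Finset.sum_congr rfl fun ε _ => hterm ε] at hprod
  have hre := congrArg Complex.re hprod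
  simp only [Complex.ofReal_re, Complex.re_sum, Complex.exp_ofReal_mul_I_re, prod_const, card_univ,
    Fintype.card_fin] at hre
  exact hre.symm

/-- With `y = cos (2.2 x)`, the quartic is a nonnegative majorant of the indicator of `[-0.35, 0.35]`. -/
lemma one_le_quartic {y : ℝ} (h1 : 0.7035 ≤ y) (h2 : y ≤ 1) :
    1 ≤ (1 + y) * (y + 1 / 3) ^ 2 * (1.18125 - 0.9 * y) := by
  nlinarith [mul_nonneg (sub_nonneg.2 h1) (sub_nonneg.2 h2)]

lemma quartic_cos (θ : ℝ) :
    (1 + Real.cos θ) * (Real.cos θ + 1 / 3) ^ 2 * (1.18125 - 0.9 * Real.cos θ) =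
      0.428125 + 0.5796875 * Real.cos θ + 0.184375 * Real.cos (2 * θ)
        - 0.0796875 * Real.cos (3 * θ) - 0.1125 * Real.cos (4 * θ) := by
  have h4 : Real.cos (4 * θ) = 2 * (2 * Real.cos θ ^ 2 - 1) ^ 2 - 1 := by
    rw [show 4 * θ = 2 * (2 * θ) by ring, Real.cos_two_mul, Real.cos_two_mul]
  rw [h4, Real.cos_three_mul, Real.cos_two_mul]
  ring

lemma exp_neg_le_tenth : Real.exp (-2.42) ≤ 1 / 10 := by
  have h1 := Real.exp_one_gt_d9
  have h2 : (1.42 : ℝ) ≤ Real.exp 0.42 := by linarith [Real.add_one_le_exp (0.42 : ℝ)]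
  have h3 : Real.exp 2.42 = Real.exp 1 * Real.exp 1 * Real.exp 0.42 := by
    rw [← Real.exp_add, ← Real.exp_add]
    norm_num
  have h4 : (10 : ℝ) ≤ Real.exp 2.42 := by
    rw [h3]
    have h5 : (7.3 : ℝ) ≤ Real.exp 1 * Real.exp 1 := by nlinarith
    nlinarith
  rw [Real.exp_neg, ← one_div]
  exact one_div_le_one_div_of_le (by norm_num) h4

lemma two_mul_card_middle_le_of_few {n : ℕ} (a : Fin n → ℝ) (ha : ∑ i, a i ^ 2 = 1)
    (hmax : ∀ i, |a i| ≤ 0.35) (hfew : (univ.filter fun i => 0.175 < |a i|).card ≤ 7) :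
    2 * (middle a).card ≤ 2 ^ n := by
  have hpi := Real.pi_gt_d2
  set S := univ.filter fun i => ¬ 0.175 < |a i| with hS
  have hsmall : 0.1425 ≤ ∑ i ∈ S, a i ^ 2 := by
    have hsplit := Finset.sum_filter_add_sum_filter_not univ (fun i => 0.175 < |a i|)
      (fun i => a i ^ 2)
    have hbig : ∑ i ∈ univ.filter (fun i => 0.175 < |a i|), a i ^ 2 ≤
        (univ.filter fun i => 0.175 < |a i|).card • (0.1225 : ℝ) := by
      refine Finset.sum_le_card_nsmul _ _ _ fun i _ => ?_
      rw [← sq_abs]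
      nlinarith [hmax i, abs_nonneg (a i)]
    have hfew' : ((univ.filter fun i => 0.175 < |a i|).card : ℝ) ≤ 7 := by exact_mod_cast hfew
    rw [nsmul_eq_mul] at hbig
    rw [ha, ← hS] at hsplit
    linarith
  have harg : ∀ v : ℝ, 0 ≤ v → ∀ b : ℝ, v * b ≤ 1.54 → ∀ i, |a i| ≤ b →
      |v * a i| ≤ Real.pi / 2 := by
    intro v hv b hb i hi
    rw [abs_mul, abs_of_nonneg hv]
    nlinarith
  have hmemS : ∀ i ∈ S, |a i| ≤ 0.175 := by
    intro i hi
    simpa [hS] using hi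
  have hexp := exp_neg_le_tenth
  have hpow : ∀ x : ℝ, ∀ k : ℕ, x ≤ k * (-2.42) → Real.exp x ≤ (1 / 10) ^ k := by
    intro x k hx
    calc Real.exp x ≤ Real.exp (k * (-2.42)) := Real.exp_le_exp.2 hx
      _ = Real.exp (-2.42) ^ k := Real.exp_nat_mul _ _
      _ ≤ (1 / 10) ^ k := by gcongr
  have hφ1 := (abs_prod_cos_le a 2.2 univ fun i _ =>
    harg 2.2 (by norm_num) 0.35 (by norm_num) i (hmax i)).trans
      (hpow _ 1 (by rw [ha]; norm_num))
  have hφ2 := (abs_prod_cos_le a 4.4 univ fun i _ =>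
    harg 4.4 (by norm_num) 0.35 (by norm_num) i (hmax i)).trans
      (hpow _ 4 (by rw [ha]; norm_num))
  have hφ3 := (abs_prod_cos_le a 6.6 S fun i hi =>
    harg 6.6 (by norm_num) 0.175 (by norm_num) i (hmemS i hi)).trans
      (hpow _ 1 (by norm_num at hsmall ⊢; linarith))
  have hφ4 := (abs_prod_cos_le a 8.8 S fun i hi =>
    harg 8.8 (by norm_num) 0.175 (by norm_num) i (hmemS i hi)).trans
      (hpow _ 2 (by norm_num at hsmall ⊢; linarith))
  have hpt : ∀ ε : Fin n → Bool, (if ε ∈ middle a then (1 : ℝ) else 0) ≤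
      0.428125 + 0.5796875 * Real.cos (2.2 * signedSum a ε)
        + 0.184375 * Real.cos (4.4 * signedSum a ε)
        - 0.0796875 * Real.cos (6.6 * signedSum a ε)
        - 0.1125 * Real.cos (8.8 * signedSum a ε) := by
    intro ε
    have hq := quartic_cos (2.2 * signedSum a ε)
    rw [← mul_assoc, ← mul_assoc, ← mul_assoc] at hq
    norm_num only at hq ⊢
    rw [← hq]
    have hc1 := Real.cos_le_one (11 / 5 * signedSum a ε)
    have hc2 := Real.neg_one_le_cos (11 / 5 * signedSum a ε)
    split_ifs with h
    · have hc3 := Real.one_sub_sq_div_two_le_cos (x := 11 / 5 * signedSum a ε)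
      simp only [middle, mem_filter, mem_univ, true_and] at h
      have hsq : signedSum a ε ^ 2 ≤ 0.1225 := by
        rw [← sq_abs]
        nlinarith [abs_nonneg (signedSum a ε)]
      have := one_le_quartic (y := Real.cos (11 / 5 * signedSum a ε))
        (by norm_num at hsq ⊢; nlinarith) hc1
      norm_num at this ⊢
      exact this
    · have h1 : 0 ≤ 1 + Real.cos (11 / 5 * signedSum a ε) := by linarith
      have h2 : (0 : ℝ) ≤ 189 / 160 - 9 / 10 * Real.cos (11 / 5 * signedSum a ε) := by linarith
      positivity
  have hsum := Finset.sum_le_sum fun ε (_ : ε ∈ (univ : Finset (Fin n → Bool))) => hpt ε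
  simp only [Finset.sum_sub_distrib, Finset.sum_add_distrib, ← Finset.mul_sum,
    sum_cos_mul_signedSum] at hsum
  simp only [sum_ite_mem, univ_inter, sum_const, card_univ, Fintype.card_pi, Fintype.card_bool,
    prod_const, Fintype.card_fin, nsmul_eq_mul, mul_one, Nat.cast_pow, Nat.cast_ofNat] at hsum
  rw [abs_le] at hφ1 hφ2 hφ3 hφ4
  have hbound : (0.428125 : ℝ) + 0.5796875 * ∏ i, Real.cos (2.2 * a i)
        + 0.184375 * ∏ i, Real.cos (4.4 * a i)
        - 0.0796875 * ∏ i, Real.cos (6.6 * a i)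
        - 0.1125 * ∏ i, Real.cos (8.8 * a i) ≤ 1 / 2 := by
    linarith [hφ1.2, hφ2.2, hφ3.1, hφ4.1]
  have htwo : (0 : ℝ) < 2 ^ n := by positivity
  have hfin : (2 : ℝ) * (middle a).card ≤ 2 ^ n := by nlinarith
  exact_mod_cast hfin

lemma two_mul_card_middle_le {n : ℕ} (a : Fin n → ℝ) (ha : ∑ i, a i ^ 2 = 1) :
    2 * (middle a).card ≤ 2 ^ n := by
  by_cases hmax : ∀ i, |a i| ≤ 0.35
  · by_cases hfew : (univ.filter fun i => 0.175 < |a i|).card ≤ 7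
    · exact two_mul_card_middle_le_of_few a ha hmax hfew
    · obtain ⟨S, hS, hcard⟩ := Finset.exists_subset_card_eq (Nat.succ_le_of_lt (not_le.1 hfew))
      refine two_mul_card_middle_le_of_eight a (S.orderEmbOfFin hcard).toEmbedding fun k => ?_
      have hk := hS (S.orderEmbOfFin_mem hcard k)
      simpa using hk
  · push Not at hmax
    obtain ⟨j, hj⟩ := hmax
    exact two_mul_card_middle_le_of_large a j hj

end Rademacher

/-- **Theorem (Pr[X > 0.35] ≥ 1/4).**
Let `a_1, ..., a_n` be real numbers with `a_1^2 + ... + a_n^2 = 1`, and let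
`X = a_1 ε_1 + ... + a_n ε_n` be the corresponding Rademacher sum (uniform measure on
sign vectors `Fin n → Bool`). Then `Pr[X > 0.35] ≥ 1/4`. -/
theorem rademacher_gt_p35_prob_ge_quarter
    (n : ℕ) (a : Fin n → ℝ) (ha : ∑ i, a i ^ 2 = 1) :
    (1 : ℝ) / 4 ≤
      ((Finset.univ.filter (fun ε : Fin n → Bool =>
          (0.35 : ℝ) < ∑ i, a i * (if ε i then (1 : ℝ) else -1))).card : ℝ) / 2 ^ n := by
  have h1 := Rademacher.two_mul_card_gt_add_card_middle a
  have h2 := Rademacher.two_mul_card_middle_le a ha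
  have h3 : 2 ^ n ≤ 4 * (Finset.univ.filter (fun ε : Fin n → Bool =>
      (0.35 : ℝ) < Rademacher.signedSum a ε)).card := by omega
  have h4 : (2 : ℝ) ^ n ≤ 4 * ((Finset.univ.filter (fun ε : Fin n → Bool =>
      (0.35 : ℝ) < Rademacher.signedSum a ε)).card : ℝ) := by exact_mod_cast h3
  simp only [Rademacher.signedSum] at h4
  rw [le_div_iff₀ (by positivity)]
  linarith
end

section
/- Let d ≥ 1 and let v_1, ..., v_n ∈ ℝ^d be vectors with Σ_{i=1}^n ‖v_i‖_2^2 = 1. Let X = Σ_{i=1}^n v_i ε_i, where ε_1, ..., ε_n are independent random signs, each uniformly distributed on {-1, +1}. Then Pr[‖X‖_2 ≥ 1] ≥ (1 - √(1 - 1/e^2))/2. -/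
open Finset

/-- The mean of `f` over a uniformly random vector of signs. -/
noncomputable def signMean (n : ℕ) (f : (Fin n → ℝ) → ℝ) : ℝ :=
  (∑ ε : Fin n → Bool, f (fun i => if ε i then 1 else -1)) / 2 ^ n

/-- The linear form with coefficients `a`. -/
noncomputable def linForm {n : ℕ} (a x : Fin n → ℝ) : ℝ := ∑ i, a i * x i

/-- Half the quadratic form of the matrix `A`. -/
noncomputable def quadForm {n : ℕ} (A : Fin n → Fin n → ℝ) (x : Fin n → ℝ) : ℝ :=
  (∑ i, ∑ j, A i j * x i * x j) / 2

theorem signMean_add {n : ℕ} (f g : (Fin n → ℝ) → ℝ) :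
    signMean n (fun x => f x + g x) = signMean n f + signMean n g := by
  simp only [signMean, sum_add_distrib, add_div]

theorem signMean_const_mul {n : ℕ} (c : ℝ) (f : (Fin n → ℝ) → ℝ) :
    signMean n (fun x => c * f x) = c * signMean n f := by
  simp only [signMean, ← mul_sum, mul_div_assoc]

theorem signMean_const {n : ℕ} (c : ℝ) : signMean n (fun _ => c) = c := by
  simp [signMean]

theorem signMean_mono {n : ℕ} {f g : (Fin n → ℝ) → ℝ} (h : ∀ x, f x ≤ g x) :
    signMean n f ≤ signMean n g := by
  unfold signMean
  gcongr
  exact h _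

theorem signMean_succ {n : ℕ} (f : (Fin (n + 1) → ℝ) → ℝ) :
    signMean (n + 1) f =
      signMean n (fun x => (f (Fin.cons 1 x) + f (Fin.cons (-1) x)) / 2) := by
  have key : ∀ (b : Bool) (ε : Fin n → Bool),
      (fun i => if (Fin.cons b ε : Fin (n + 1) → Bool) i then (1 : ℝ) else -1) =
        Fin.cons (if b then 1 else -1) (fun i => if ε i then 1 else -1) := by
    intro b ε
    ext i
    refine Fin.cases ?_ (fun j => ?_) i <;> simp
  unfold signMean
  rw [← (Fin.consEquiv (fun _ : Fin (n + 1) => Bool)).sum_comp, Fintype.sum_prod_type]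
  simp only [Fin.consEquiv_apply, key, Fintype.sum_bool, ← sum_div, sum_add_distrib]
  simp only [if_true, Bool.false_eq_true, if_false]
  rw [pow_succ]
  field_simp

theorem linForm_cons {n : ℕ} (a : Fin (n + 1) → ℝ) (s : ℝ) (x : Fin n → ℝ) :
    linForm a (Fin.cons s x) = s * a 0 + linForm (fun i => a i.succ) x := by
  simp [linForm, Fin.sum_univ_succ, mul_comm]

theorem quadForm_cons {n : ℕ} {A : Fin (n + 1) → Fin (n + 1) → ℝ}
    (hs : ∀ i j, A i j = A j i) (h0 : ∀ i, A i i = 0) (s : ℝ) (x : Fin n → ℝ) :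
    quadForm A (Fin.cons s x) =
      quadForm (fun i j => A i.succ j.succ) x + s * linForm (fun i => A 0 i.succ) x := by
  simp only [quadForm, linForm, Fin.sum_univ_succ, Fin.cons_zero, Fin.cons_succ, h0,
    sum_add_distrib, hs _ 0, mul_sum]
  have : ∀ i : Fin n, A 0 i.succ * x i * s = s * (A 0 i.succ * x i) := fun i => by ring
  have h' : ∀ i : Fin n, A 0 i.succ * s * x i = s * (A 0 i.succ * x i) := fun i => by ring
  simp only [this, h']
  ring

theorem signMean_linForm_mul {n : ℕ} (a b : Fin n → ℝ) :
    signMean n (fun x => linForm a x * linForm b x) = ∑ i, a i * b i := by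
  induction n with
  | zero => simp [signMean, linForm]
  | succ n ih =>
    rw [signMean_succ, Fin.sum_univ_succ, ← ih, ← signMean_const (n := n) (a 0 * b 0),
      ← signMean_add]
    congr 1
    ext x
    simp only [linForm_cons]
    ring

theorem signMean_linForm_sq {n : ℕ} (a : Fin n → ℝ) :
    signMean n (fun x => linForm a x ^ 2) = ∑ i, a i ^ 2 := by
  simp only [pow_two, signMean_linForm_mul]

theorem signMean_linForm_sq_mul_sq_le {n : ℕ} (a b : Fin n → ℝ) :
    signMean n (fun x => linForm a x ^ 2 * linForm b x ^ 2) ≤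
      (∑ i, a i ^ 2) * (∑ i, b i ^ 2) + 2 * (∑ i, a i * b i) ^ 2 := by
  induction n with
  | zero => simp [signMean, linForm]
  | succ n ih =>
    rw [signMean_succ]
    simp only [Fin.sum_univ_succ]
    set a' := fun i : Fin n => a i.succ
    set b' := fun i : Fin n => b i.succ
    have e : (fun x : Fin n → ℝ => (linForm a (Fin.cons 1 x) ^ 2 * linForm b (Fin.cons 1 x) ^ 2 +
        linForm a (Fin.cons (-1) x) ^ 2 * linForm b (Fin.cons (-1) x) ^ 2) / 2) =
        fun x => linForm a' x ^ 2 * linForm b' x ^ 2 + a 0 ^ 2 * linForm b' x ^ 2 +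
          b 0 ^ 2 * linForm a' x ^ 2 + a 0 ^ 2 * b 0 ^ 2 +
          4 * a 0 * b 0 * (linForm a' x * linForm b' x) := by
      ext x
      simp only [linForm_cons]
      ring
    rw [e]
    simp only [signMean_add, signMean_const_mul, signMean_const, signMean_linForm_sq,
      signMean_linForm_mul]
    nlinarith [ih a' b', sq_nonneg (a 0 * b 0)]

theorem signMean_quadForm {n : ℕ} {A : Fin n → Fin n → ℝ}
    (hs : ∀ i j, A i j = A j i) (h0 : ∀ i, A i i = 0) :
    signMean n (fun x => quadForm A x) = 0 := by
  induction n with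
  | zero => simp [signMean, quadForm]
  | succ n ih =>
    rw [signMean_succ, ← ih (A := fun i j => A i.succ j.succ) (fun i j => hs _ _) (fun i => h0 _)]
    congr 1
    ext x
    simp only [quadForm_cons hs h0]
    ring

theorem signMean_quadForm_sq {n : ℕ} {A : Fin n → Fin n → ℝ}
    (hs : ∀ i j, A i j = A j i) (h0 : ∀ i, A i i = 0) :
    signMean n (fun x => quadForm A x ^ 2) = (∑ i, ∑ j, A i j ^ 2) / 2 := by
  induction n with
  | zero => simp [signMean, quadForm]
  | succ n ih =>
    have e : (fun x : Fin n → ℝ => (quadForm A (Fin.cons 1 x) ^ 2 +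
        quadForm A (Fin.cons (-1) x) ^ 2) / 2) =
        fun x => quadForm (fun i j => A i.succ j.succ) x ^ 2 +
          linForm (fun i => A 0 i.succ) x ^ 2 := by
      ext x
      simp only [quadForm_cons hs h0]
      ring
    rw [signMean_succ, e, signMean_add, signMean_linForm_sq,
      ih (A := fun i j => A i.succ j.succ) (fun i j => hs _ _) (fun i => h0 _)]
    simp only [Fin.sum_univ_succ, h0, sum_add_distrib, hs _ 0]
    ring

theorem signMean_quadForm_mul_linForm_mul {n : ℕ} {A : Fin n → Fin n → ℝ}
    (hs : ∀ i j, A i j = A j i) (h0 : ∀ i, A i i = 0) (a b : Fin n → ℝ) :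
    signMean n (fun x => quadForm A x * (linForm a x * linForm b x)) =
      ∑ i, a i * ∑ j, A i j * b j := by
  induction n with
  | zero => simp [signMean, quadForm]
  | succ n ih =>
    set A' := fun i j : Fin n => A i.succ j.succ
    set c := fun i : Fin n => A 0 i.succ with hc
    set a' := fun i : Fin n => a i.succ
    set b' := fun i : Fin n => b i.succ
    have hs' : ∀ i j, A' i j = A' j i := fun i j => hs _ _
    have h0' : ∀ i, A' i i = 0 := fun i => h0 _
    have e : (fun x : Fin n → ℝ =>
        (quadForm A (Fin.cons 1 x) * (linForm a (Fin.cons 1 x) * linForm b (Fin.cons 1 x)) +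
        quadForm A (Fin.cons (-1) x) *
          (linForm a (Fin.cons (-1) x) * linForm b (Fin.cons (-1) x))) / 2) =
        fun x => quadForm A' x * (linForm a' x * linForm b' x) + a 0 * b 0 * quadForm A' x +
          b 0 * (linForm c x * linForm a' x) + a 0 * (linForm c x * linForm b' x) := by
      ext x
      simp only [quadForm_cons hs h0, linForm_cons]
      ring
    rw [signMean_succ, e]
    simp only [signMean_add, signMean_const_mul, signMean_linForm_mul, ih hs' h0',
      signMean_quadForm hs' h0']
    simp only [Fin.sum_univ_succ, h0, hs _ 0, mul_add, sum_add_distrib]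
    have : ∀ i : Fin n, a i.succ * (A 0 i.succ * b 0) = b 0 * (c i * a' i) := fun i => by
      simp only [hc, a']; ring
    simp only [this, ← mul_sum]
    simp only [A', a', b', c]
    ring

theorem signMean_quadForm_cube {n : ℕ} {A : Fin n → Fin n → ℝ}
    (hs : ∀ i j, A i j = A j i) (h0 : ∀ i, A i i = 0) :
    signMean n (fun x => quadForm A x ^ 3) = ∑ i, ∑ j, (∑ k, A i k * A k j) * A j i := by
  induction n with
  | zero => simp [signMean, quadForm]
  | succ n ih =>
    set A' := fun i j : Fin n => A i.succ j.succ
    set c := fun i : Fin n => A 0 i.succ with hc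
    have hs' : ∀ i j, A' i j = A' j i := fun i j => hs _ _
    have h0' : ∀ i, A' i i = 0 := fun i => h0 _
    have e : (fun x : Fin n → ℝ =>
        (quadForm A (Fin.cons 1 x) ^ 3 + quadForm A (Fin.cons (-1) x) ^ 3) / 2) =
        fun x => quadForm A' x ^ 3 + 3 * (quadForm A' x * (linForm c x * linForm c x)) := by
      ext x
      simp only [quadForm_cons hs h0]
      ring
    rw [signMean_succ, e]
    simp only [signMean_add, signMean_const_mul, ih hs' h0',
      signMean_quadForm_mul_linForm_mul hs' h0']
    have h1 : ∀ i j : Fin n, A i.succ j.succ = A' i j := fun _ _ => rfl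
    have h2 : ∀ i : Fin n, A 0 i.succ = c i := fun _ => rfl
    simp only [Fin.sum_univ_succ, h0, hs _ 0, sum_add_distrib, h1, h2, add_mul, mul_zero, zero_mul,
      zero_add, sum_const_zero]
    have e1 : ∑ i, (∑ k, c k * A' k i) * c i = ∑ i, c i * ∑ j, A' i j * c j := by
      refine sum_congr rfl fun i _ => ?_
      rw [mul_comm]
      congr 1
      exact sum_congr rfl fun j _ => by rw [hs' j i, mul_comm]
    have e2 : ∑ i, (∑ k, A' i k * c k) * c i = ∑ i, c i * ∑ j, A' i j * c j :=
      sum_congr rfl fun i _ => mul_comm _ _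
    have e3 : ∑ i, ∑ j, c i * c j * A' j i = ∑ i, c i * ∑ j, A' i j * c j := by
      simp only [mul_sum]
      exact sum_congr rfl fun i _ => sum_congr rfl fun j _ => by rw [hs' j i]; ring
    rw [e1, e2, e3]
    ring

theorem signMean_quadForm_sq_mul_linForm_sq_le {n : ℕ} {A : Fin n → Fin n → ℝ}
    (hs : ∀ i j, A i j = A j i) (h0 : ∀ i, A i i = 0) (a : Fin n → ℝ) :
    signMean n (fun x => quadForm A x ^ 2 * linForm a x ^ 2) ≤
      (∑ i, ∑ j, A i j ^ 2) / 2 * (∑ i, a i ^ 2) + 2 * ∑ i, (∑ j, A i j * a j) ^ 2 := by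
  induction n with
  | zero => simp [signMean, quadForm]
  | succ n ih =>
    set A' := fun i j : Fin n => A i.succ j.succ
    set c := fun i : Fin n => A 0 i.succ with hc
    set a' := fun i : Fin n => a i.succ
    have hs' : ∀ i j, A' i j = A' j i := fun i j => hs _ _
    have h0' : ∀ i, A' i i = 0 := fun i => h0 _
    have e : (fun x : Fin n → ℝ =>
        (quadForm A (Fin.cons 1 x) ^ 2 * linForm a (Fin.cons 1 x) ^ 2 +
          quadForm A (Fin.cons (-1) x) ^ 2 * linForm a (Fin.cons (-1) x) ^ 2) / 2) =
        fun x => quadForm A' x ^ 2 * linForm a' x ^ 2 + a 0 ^ 2 * quadForm A' x ^ 2 +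
          linForm c x ^ 2 * linForm a' x ^ 2 + a 0 ^ 2 * linForm c x ^ 2 +
          4 * a 0 * (quadForm A' x * (linForm c x * linForm a' x)) := by
      ext x
      simp only [quadForm_cons hs h0, linForm_cons]
      ring
    rw [signMean_succ, e]
    simp only [signMean_add, signMean_const_mul, signMean_linForm_sq, signMean_quadForm_sq hs' h0',
      signMean_quadForm_mul_linForm_mul hs' h0']
    have i1 := ih hs' h0' a'
    have i2 := signMean_linForm_sq_mul_sq_le c a'
    have h1 : ∀ i j : Fin n, A i.succ j.succ = A' i j := fun _ _ => rfl
    have h2 : ∀ i : Fin n, A 0 i.succ = c i := fun _ => rfl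
    have h3 : ∀ i : Fin n, a i.succ = a' i := fun _ => rfl
    have e1 : ∑ i, (c i * a 0 + ∑ j, A' i j * a' j) ^ 2 =
        a 0 ^ 2 * ∑ i, c i ^ 2 + 2 * a 0 * (∑ i, c i * ∑ j, A' i j * a' j) +
          ∑ i, (∑ j, A' i j * a' j) ^ 2 := by
      simp only [mul_sum _ _ (a 0 ^ 2), mul_sum _ _ (2 * a 0),
        ← sum_add_distrib]
      exact sum_congr rfl fun i _ => by ring
    simp only [Fin.sum_univ_succ, h0, hs _ 0, sum_add_distrib, h1, h2, h3, zero_mul, zero_add, e1]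
    nlinarith [mul_nonneg (sq_nonneg (a 0)) (sum_nonneg fun i (_ : i ∈ univ) => sq_nonneg (c i))]

theorem signMean_quadForm_pow_four_le {n : ℕ} {A : Fin n → Fin n → ℝ}
    (hs : ∀ i j, A i j = A j i) (h0 : ∀ i, A i i = 0) :
    signMean n (fun x => quadForm A x ^ 4) ≤
      3 * ((∑ i, ∑ j, A i j ^ 2) / 2) ^ 2 + 3 * ∑ i, ∑ j, (∑ k, A i k * A k j) ^ 2 := by
  induction n with
  | zero => simp [signMean, quadForm]
  | succ n ih =>
    set A' := fun i j : Fin n => A i.succ j.succ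
    set c := fun i : Fin n => A 0 i.succ with hc
    have hs' : ∀ i j, A' i j = A' j i := fun i j => hs _ _
    have h0' : ∀ i, A' i i = 0 := fun i => h0 _
    have e : (fun x : Fin n → ℝ =>
        (quadForm A (Fin.cons 1 x) ^ 4 + quadForm A (Fin.cons (-1) x) ^ 4) / 2) =
        fun x => quadForm A' x ^ 4 + 6 * (quadForm A' x ^ 2 * linForm c x ^ 2) +
          linForm c x ^ 2 * linForm c x ^ 2 := by
      ext x
      simp only [quadForm_cons hs h0]
      ring
    rw [signMean_succ, e]
    simp only [signMean_add, signMean_const_mul]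
    have i1 := ih hs' h0'
    have i2 := signMean_linForm_sq_mul_sq_le c c
    have i3 := signMean_quadForm_sq_mul_linForm_sq_le hs' h0' c
    have h1 : ∀ i j : Fin n, A i.succ j.succ = A' i j := fun _ _ => rfl
    have h2 : ∀ i : Fin n, A 0 i.succ = c i := fun _ => rfl
    have e1 : ∀ j, ∑ k, c k * A' k j = ∑ k, A' j k * c k :=
      fun j => sum_congr rfl fun k _ => by rw [hs' k j, mul_comm]
    have e2 : ∑ i, ∑ j, (c i * c j + ∑ k, A' i k * A' k j) ^ 2 =
        (∑ i, c i ^ 2) ^ 2 + 2 * ∑ i, (∑ j, A' i j * c j) ^ 2 +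
          ∑ i, ∑ j, (∑ k, A' i k * A' k j) ^ 2 := by
      have f1 : ∑ i, ∑ j, c i ^ 2 * c j ^ 2 = (∑ i, c i ^ 2) ^ 2 := by
        rw [pow_two, sum_mul_sum]
      have f2 : ∑ i, ∑ j, c i * c j * ∑ k, A' i k * A' k j = ∑ i, (∑ j, A' i j * c j) ^ 2 := by
        simp only [pow_two, sum_mul_sum]
        simp only [mul_sum]
        rw [sum_comm_cycle]
        exact sum_congr rfl fun k _ => sum_congr rfl fun i _ => sum_congr rfl fun j _ => by
          rw [hs' i k]; ring
      rw [← f1, ← f2]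
      simp only [mul_sum _ _ (2 : ℝ), ← sum_add_distrib]
      exact sum_congr rfl fun i _ => sum_congr rfl fun j _ => by ring
    simp only [Fin.sum_univ_succ, h0, hs _ 0, sum_add_distrib, h1, h2, zero_mul, mul_zero, zero_add,
      e1, e2]
    simp only [← pow_two] at i2 ⊢
    nlinarith [sq_nonneg (∑ i, c i ^ 2)]

theorem Matrix.IsHermitian.trace_pow_eq_sum_eigenvalues_pow {n : Type*} [Fintype n] [DecidableEq n]
    {A : Matrix n n ℝ} (hA : A.IsHermitian) (k : ℕ) :
    (A ^ k).trace = ∑ i, hA.eigenvalues i ^ k := by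
  conv_lhs => rw [hA.spectral_theorem, ← map_pow, Matrix.diagonal_pow]
  rw [Unitary.conjStarAlgAut_apply, Matrix.trace_mul_cycle]
  simp [Matrix.trace]

/-- The power sums of the spectrum of a symmetric matrix, in terms of its entries. -/
theorem exists_spectrum_power_sums {n : ℕ} {A : Fin n → Fin n → ℝ} (hs : ∀ i j, A i j = A j i) :
    ∃ l : Fin n → ℝ, ∑ i, l i ^ 2 = ∑ i, ∑ j, A i j ^ 2 ∧
      ∑ i, l i ^ 3 = ∑ i, ∑ j, (∑ k, A i k * A k j) * A j i ∧
      ∑ i, l i ^ 4 = ∑ i, ∑ j, (∑ k, A i k * A k j) ^ 2 := by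
  have hA : (Matrix.of A).IsHermitian := by
    ext i j
    simp [hs i j]
  refine ⟨hA.eigenvalues, ?_, ?_, ?_⟩ <;> rw [← hA.trace_pow_eq_sum_eigenvalues_pow]
  · simp only [pow_two, Matrix.trace, Matrix.diag, Matrix.mul_apply, Matrix.of_apply]
    exact sum_congr rfl fun i _ => sum_congr rfl fun j _ => by rw [hs j i]
  · simp only [pow_succ, pow_zero, one_mul, Matrix.trace, Matrix.diag, Matrix.mul_apply,
      Matrix.of_apply]
  · rw [show 4 = 2 + 2 from rfl, pow_add]
    simp only [pow_two, Matrix.trace, Matrix.diag, Matrix.mul_apply, Matrix.of_apply]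
    refine sum_congr rfl fun i _ => sum_congr rfl fun j _ => ?_
    congr 1
    exact sum_congr rfl fun k _ => by rw [hs j k, hs k i, mul_comm]

/-- Either the fourth power sum is small, or one entry dominates. -/
theorem power_sums_dichotomy {n : ℕ} (l : Fin n → ℝ) (h2 : ∑ i, l i ^ 2 = 2) :
    ∑ i, l i ^ 4 ≤ 3.2 ∨ ∃ t : ℝ, 1.6 ≤ t ^ 2 ∧ t ^ 2 ≤ 2 ∧ 0 ≤ t ∧ ∑ i, l i ^ 4 ≤ 2 * t ^ 2 ∧
      t ^ 3 - 0.64 * (2 - t ^ 2) ≤ |∑ i, l i ^ 3| := by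
  have hne : (univ : Finset (Fin n)).Nonempty := by
    by_contra h
    rw [not_nonempty_iff_eq_empty] at h
    simp [h] at h2
  obtain ⟨m, -, hm⟩ := exists_max_image univ (fun i => l i ^ 2) hne
  have h4 : ∑ i, l i ^ 4 ≤ 2 * l m ^ 2 := by
    rw [← h2, sum_mul]
    refine sum_le_sum fun i hi => ?_
    nlinarith [hm i hi, sq_nonneg (l i)]
  by_cases hb : l m ^ 2 ≤ 1.6
  · left; linarith
  right
  push Not at hb
  have hrest : ∑ i ∈ univ.erase m, l i ^ 2 = 2 - l m ^ 2 := by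
    rw [← h2, ← add_sum_erase univ _ (mem_univ m)]; ring
  have hle : ∀ i ∈ univ.erase m, l i ^ 2 ≤ 2 - l m ^ 2 := fun i hi => by
    rw [← hrest]
    exact single_le_sum (f := fun i => l i ^ 2) (fun j _ => sq_nonneg _) hi
  have hm2 : 0 ≤ 2 - l m ^ 2 := hrest ▸ sum_nonneg fun i _ => sq_nonneg _
  have hcube : |∑ i ∈ univ.erase m, l i ^ 3| ≤ 0.64 * (2 - l m ^ 2) := by
    rw [← hrest, mul_sum]
    refine (abs_sum_le_sum_abs _ _).trans (sum_le_sum fun i hi => ?_)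
    have h1 : |l i| ≤ 0.64 := abs_le_of_sq_le_sq (by nlinarith [hle i hi]) (by norm_num)
    rw [abs_pow, ← sq_abs (l i)]
    nlinarith [sq_nonneg |l i|]
  refine ⟨|l m|, by rw [sq_abs]; exact hb.le, by rw [sq_abs]; linarith, abs_nonneg _,
    by rwa [sq_abs], ?_⟩
  rw [← add_sum_erase univ _ (mem_univ m), sq_abs, ← abs_pow]
  have := abs_sub_abs_le_abs_sub (l m ^ 3) (-∑ i ∈ univ.erase m, l i ^ 3)
  rw [abs_neg, sub_neg_eq_add] at this
  linarith

/-- Quartic minorants of the indicator of `[0, ∞)`. -/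
theorem quartic_le_indicator (x : ℝ) :
    -x ^ 4 + 27 * x ^ 2 + 54 * x ≤ 393 * (if 0 ≤ x then 1 else 0) ∧
    -x ^ 4 + 1.68 * x ^ 3 + 25.344 * x ^ 2 + 37.3248 * x ≤ 424.5 * (if 0 ≤ x then 1 else 0) ∧
    -x ^ 4 - 5 * x ^ 3 + 25 * x ^ 2 + 125 * x ≤ 388 * (if 0 ≤ x then 1 else 0) := by
  split_ifs with h
  · refine ⟨?_, ?_, ?_⟩
    · nlinarith [sq_nonneg (x ^ 2 - 16.8), sq_nonneg (x - 4.1)]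
    · nlinarith [sq_nonneg (x ^ 2 - 0.84 * x - 16.55), sq_nonneg (x - 4.62)]
    · nlinarith [sq_nonneg (x ^ 2 + 2.5 * x - 18), sq_nonneg (x - 3.2)]
  · push Not at h
    have e : ∀ a b : ℝ, 0 ≤ b → x * (x + a) ^ 2 * (b - x) ≤ 0 := fun a b hb =>
      mul_nonpos_of_nonpos_of_nonneg (mul_nonpos_of_nonpos_of_nonneg h.le (sq_nonneg _))
        (by linarith)
    exact ⟨by linarith [e 3 6 (by norm_num)], by linarith [e 2.4 6.48 (by norm_num)],
      by linarith [e 5 5 (by norm_num)]⟩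

theorem one_sub_sqrt_exp_le : (1 - Real.sqrt (1 - 1 / Real.exp 1 ^ 2)) / 2 ≤ 0.0351 := by
  have h := Real.exp_one_gt_d9
  have h1 : 1 / Real.exp 1 ^ 2 ≤ 0.1354 := by
    rw [div_le_iff₀ (by positivity)]
    nlinarith
  have : (0.9298 : ℝ) ≤ Real.sqrt (1 - 1 / Real.exp 1 ^ 2) :=
    Real.le_sqrt_of_sq_le (by norm_num at h1 ⊢; linarith)
  linarith

theorem le_signMean_quadForm_nonneg_of_normalized {n : ℕ} {A : Fin n → Fin n → ℝ}
    (hs : ∀ i j, A i j = A j i) (h0 : ∀ i, A i i = 0) (h2 : ∑ i, ∑ j, A i j ^ 2 = 2) :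
    0.0351 ≤ signMean n (fun x => if 0 ≤ quadForm A x then 1 else 0) := by
  obtain ⟨l, l2, l3, l4⟩ := exists_spectrum_power_sums hs
  have m4 := signMean_quadForm_pow_four_le hs h0
  have m3 := signMean_quadForm_cube hs h0
  have m2 := signMean_quadForm_sq hs h0
  have m1 := signMean_quadForm hs h0
  rw [← l4, h2] at m4
  rw [← l3] at m3
  rw [h2] at m2
  have key : ∀ b c d M : ℝ, (∀ y : ℝ, -y ^ 4 + b * y ^ 3 + c * y ^ 2 + d * y ≤
      M * (if 0 ≤ y then 1 else 0)) →
      -(3 + 3 * ∑ i, l i ^ 4) + b * ∑ i, l i ^ 3 + c ≤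
        M * signMean n (fun x => if 0 ≤ quadForm A x then 1 else 0) := by
    intro b c d M h
    have := signMean_mono (n := n) (fun x => h (quadForm A x))
    rw [signMean_const_mul] at this
    refine le_trans ?_ this
    simp only [neg_eq_neg_one_mul (_ ^ 4 : ℝ), signMean_add, signMean_const_mul, m1, m2, m3]
    linarith
  rcases power_sums_dichotomy l (l2.trans h2) with h | ⟨t, ht, ht2, ht0, h, h3⟩
  · have := key 0 27 54 393 (fun y => by linarith [(quartic_le_indicator y).1])
    linarith
  · have u1 : 1.26 ≤ t := by nlinarith
    have u2 : t ≤ 1.4143 := by nlinarith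
    rcases le_total 0 (∑ i, l i ^ 3) with hp | hp
    · rw [abs_of_nonneg hp] at h3
      have := key 1.68 25.344 37.3248 424.5 (fun y => (quartic_le_indicator y).2.1)
      have : 15 ≤ 22.344 - 6 * t ^ 2 + 1.68 * (t ^ 3 - 0.64 * (2 - t ^ 2)) := by
        nlinarith [mul_nonneg (sub_nonneg.2 u1) (sub_nonneg.2 u2),
          mul_nonneg (mul_nonneg (sub_nonneg.2 u1) (sub_nonneg.2 u2)) ht0,
          mul_nonneg (sub_nonneg.2 u2) (sq_nonneg (t - 1.4142))]
      linarith
    · rw [abs_of_nonpos hp] at h3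
      have := key (-5) 25 125 388 (fun y => by linarith [(quartic_le_indicator y).2.2])
      have : 14 ≤ 22 - 6 * t ^ 2 + 5 * (t ^ 3 - 0.64 * (2 - t ^ 2)) := by
        nlinarith [mul_nonneg (sub_nonneg.2 u1) (sub_nonneg.2 u2), mul_le_mul_of_nonneg_right u1
          (sq_nonneg t)]
      linarith

theorem le_signMean_quadForm_nonneg {n : ℕ} {A : Fin n → Fin n → ℝ}
    (hs : ∀ i j, A i j = A j i) (h0 : ∀ i, A i i = 0) :
    0.0351 ≤ signMean n (fun x => if 0 ≤ quadForm A x then 1 else 0) := by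
  have hS : 0 ≤ ∑ i, ∑ j, A i j ^ 2 := by positivity
  rcases hS.eq_or_lt with h | h
  · have hA : ∀ i j, A i j = 0 := by
      intro i j
      rw [eq_comm, sum_eq_zero_iff_of_nonneg fun i _ => by positivity] at h
      have := h i (mem_univ i)
      rw [sum_eq_zero_iff_of_nonneg fun i _ => by positivity] at this
      exact pow_eq_zero_iff two_ne_zero |>.1 (this j (mem_univ j))
    simp only [quadForm, hA, zero_mul, sum_const_zero, zero_div, le_refl, if_true, signMean_const]
    norm_num
  · set S := ∑ i, ∑ j, A i j ^ 2 with hSdef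
    set r := Real.sqrt (2 / S)
    have hr : 0 < r := Real.sqrt_pos.2 (by positivity)
    have hr2 : r ^ 2 = 2 / S := Real.sq_sqrt (by positivity)
    have := le_signMean_quadForm_nonneg_of_normalized (A := fun i j => r * A i j)
      (fun i j => by rw [hs]) (fun i => by rw [h0, mul_zero])
      (by simp only [mul_pow, ← mul_sum, hr2, ← hSdef]; field_simp)
    have e : ∀ x, quadForm (fun i j => r * A i j) x = r * quadForm A x := fun x => by
      simp only [quadForm, mul_assoc, ← mul_sum, mul_div_assoc]
    simpa only [e, mul_nonneg_iff_of_pos_left hr] using this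

theorem norm_sum_smul_sq {E : Type*} [NormedAddCommGroup E] [InnerProductSpace ℝ E] {n : ℕ}
    (v : Fin n → E) (x : Fin n → ℝ) (hx : ∀ i, x i ^ 2 = 1) :
    ‖∑ i, x i • v i‖ ^ 2 = ∑ i, ‖v i‖ ^ 2 +
      quadForm (fun i j => if i = j then 0 else 2 * inner ℝ (v i) (v j)) x := by
  have e : ∀ i j, (if i = j then 0 else 2 * inner ℝ (v i) (v j)) * x i * x j =
      2 * (x i * (x j * inner ℝ (v i) (v j))) - if i = j then 2 * ‖v i‖ ^ 2 else 0 := by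
    intro i j
    split_ifs with h
    · subst h
      rw [real_inner_self_eq_norm_sq]
      linear_combination (-2 * ‖v i‖ ^ 2) * hx i
    · ring
  rw [← real_inner_self_eq_norm_sq]
  simp only [quadForm, e, sum_sub_distrib, sum_ite_eq, mem_univ, if_true, ← mul_sum, sum_inner,
    inner_sum, real_inner_smul_left, real_inner_smul_right]
  simp only [real_inner_comm]
  ring



/-- **Theorem (high-dimensional lower bound, upper tail).**
Let `d ≥ 1` and let `v_1, ..., v_n ∈ ℝ^d` with `Σ ‖v_i‖² = 1`. For the vector-valued
Rademacher sum `X = Σ v_i ε_i` (uniform measure on sign vectors `Fin n → Bool`),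
`Pr[‖X‖ ≥ 1] ≥ (1 - √(1 - 1/e²))/2`. -/
theorem vector_rademacher_norm_ge_one
    (d : ℕ) (hd : 1 ≤ d) (n : ℕ) (v : Fin n → EuclideanSpace ℝ (Fin d))
    (hv : ∑ i, ‖v i‖ ^ 2 = 1) :
    (1 - Real.sqrt (1 - 1 / Real.exp 1 ^ 2)) / 2 ≤
      ((Finset.univ.filter (fun ε : Fin n → Bool =>
          1 ≤ ‖∑ i, (if ε i then (1 : ℝ) else -1) • v i‖)).card : ℝ) / 2 ^ n := by
  set A : Fin n → Fin n → ℝ := fun i j => if i = j then 0 else 2 * inner ℝ (v i) (v j)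
  refine one_sub_sqrt_exp_le.trans ((le_signMean_quadForm_nonneg (A := A) (fun i j => ?_)
    fun i => ?_).trans_eq ?_)
  · simp only [A, eq_comm (a := i), real_inner_comm]
  · simp only [A, if_true]
  · rw [signMean, card_filter, Nat.cast_sum]
    congr 1
    refine sum_congr rfl fun ε _ => ?_
    have h := norm_sum_smul_sq v (fun i => if ε i then 1 else -1)
      (fun i => by split_ifs <;> norm_num)
    rw [hv] at h
    have hiff : 0 ≤ quadForm A (fun i => if ε i then 1 else -1) ↔
        1 ≤ ‖∑ i, (if ε i then (1 : ℝ) else -1) • v i‖ := by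
      rw [← one_le_sq_iff₀ (norm_nonneg _), h, le_add_iff_nonneg_right]
    simp only [hiff, Nat.cast_ite, Nat.cast_one, Nat.cast_zero]
end

section
/- Let d ≥ 1 and let v_1, ..., v_n ∈ ℝ^d be vectors with Σ_{i=1}^n ‖v_i‖_2^2 = 1. Let X = Σ_{i=1}^n v_i ε_i, where ε_1, ..., ε_n are independent random signs, each uniformly distributed on {-1, +1}. Then Pr[‖X‖_2 ≤ 1] ≥ (1 - √(1 - 1/e^2))/2. -/
open Finset

namespace Rademacher

/-- The sign `±1` encoded by a Boolean. -/
def sgn (b : Bool) : ℝ := if b then 1 else -1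

@[simp] lemma sgn_true : sgn true = 1 := rfl

@[simp] lemma sgn_false : sgn false = -1 := rfl

@[simp] lemma sgn_not (b : Bool) : sgn (!b) = -sgn b := by cases b <;> simp

/-- The mean of a function over the discrete cube. -/
noncomputable def avg {n : ℕ} (F : (Fin n → Bool) → ℝ) : ℝ := (∑ x, F x) / 2 ^ n

section avg

variable {n : ℕ}

lemma avg_add (F G : (Fin n → Bool) → ℝ) :
    avg (fun x => F x + G x) = avg F + avg G := by
  simp [avg, sum_add_distrib, add_div]

lemma avg_sub (F G : (Fin n → Bool) → ℝ) :
    avg (fun x => F x - G x) = avg F - avg G := by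
  simp [avg, sum_sub_distrib, sub_div]

lemma avg_const_mul (c : ℝ) (F : (Fin n → Bool) → ℝ) :
    avg (fun x => c * F x) = c * avg F := by
  simp [avg, ← mul_sum, mul_div_assoc]

@[simp] lemma avg_const (c : ℝ) : avg (fun _ : Fin n → Bool => c) = c := by
  simp [avg]

lemma avg_finset_sum {ι : Type*} (t : Finset ι) (F : ι → (Fin n → Bool) → ℝ) :
    avg (fun x => ∑ i ∈ t, F i x) = ∑ i ∈ t, avg (F i) := by
  simp only [avg]
  rw [sum_comm, sum_div]

lemma avg_mono {F G : (Fin n → Bool) → ℝ} (h : ∀ x, F x ≤ G x) : avg F ≤ avg G := by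
  unfold avg
  gcongr with x
  exact h x

lemma avg_nonneg {F : (Fin n → Bool) → ℝ} (h : ∀ x, 0 ≤ F x) : 0 ≤ avg F := by
  simpa using avg_mono (F := fun _ => 0) h

lemma avg_zero_dim (F : (Fin 0 → Bool) → ℝ) : avg F = F Fin.elim0 := by
  simp only [avg, univ_unique, sum_singleton, pow_zero, div_one]
  congr 1

lemma avg_succ (F : (Fin (n + 1) → Bool) → ℝ) :
    avg F = avg (fun x => (F (Fin.cons true x) + F (Fin.cons false x)) / 2) := by
  have h : ∑ x, F x = ∑ x : Fin n → Bool, (F (Fin.cons true x) + F (Fin.cons false x)) := by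
    rw [← (Fin.consEquiv (fun _ : Fin (n + 1) => Bool)).sum_comp, Fintype.sum_prod_type]
    simp [Fin.consEquiv, sum_add_distrib]
  simp only [avg, h, ← sum_div, pow_succ]
  field_simp

lemma avg_comp_not (F : (Fin n → Bool) → ℝ) : avg (fun x => F (fun i => !(x i))) = avg F := by
  unfold avg
  congr 1
  refine Fintype.sum_bijective (fun (x : Fin n → Bool) i => !(x i)) ?_ _ _ (fun _ => rfl)
  exact Function.Involutive.bijective fun x => by simp

lemma avg_mul_sq_le (F G : (Fin n → Bool) → ℝ) :
    avg (fun x => F x * G x) ^ 2 ≤ avg (fun x => F x ^ 2) * avg (fun x => G x ^ 2) := by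
  have h := sum_mul_sq_le_sq_mul_sq univ F G
  simp only [avg, div_pow, div_mul_div_comm, ← sq]
  gcongr

lemma exists_le_zero_of_avg_eq_zero {F : (Fin n → Bool) → ℝ} (h : avg F = 0) :
    ∃ x, F x ≤ 0 := by
  have h' : ∑ x, F x = 0 := by simpa [avg] using h
  obtain ⟨x, -, hx⟩ := exists_le_of_sum_le (s := univ) (f := F) (g := fun _ => 0)
    univ_nonempty (by simp [h'])
  exact ⟨x, hx⟩

end avg

section moments

variable {n : ℕ}

/-- A scalar Rademacher sum. -/
def lin (l : Fin n → ℝ) (x : Fin n → Bool) : ℝ := ∑ i, l i * sgn (x i)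

/-- A quadratic form evaluated at a sign vector. -/
def quad (a : Fin n → Fin n → ℝ) (x : Fin n → Bool) : ℝ :=
  ∑ i, ∑ j, a i j * (sgn (x i) * sgn (x j))

lemma lin_cons (l : Fin (n + 1) → ℝ) (b : Bool) (x : Fin n → Bool) :
    lin l (Fin.cons b x) = l 0 * sgn b + lin (fun i => l i.succ) x := by
  simp [lin, Fin.sum_univ_succ]

lemma quad_cons {a : Fin (n + 1) → Fin (n + 1) → ℝ} (hs : ∀ i j, a i j = a j i)
    (h0 : ∀ i, a i i = 0) (b : Bool) (x : Fin n → Bool) :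
    quad a (Fin.cons b x) = sgn b * lin (fun j => 2 * a 0 j.succ) x
      + quad (fun i j => a i.succ j.succ) x := by
  simp only [quad, lin, Fin.sum_univ_succ, Fin.cons_zero, Fin.cons_succ, h0, sum_add_distrib,
    zero_mul, zero_add, mul_sum, ← add_assoc]
  congr 1
  rw [← sum_add_distrib]
  refine sum_congr rfl fun i _ => ?_
  rw [hs i.succ 0]
  ring

lemma sum_sq_succ {a : Fin (n + 1) → Fin (n + 1) → ℝ} (hs : ∀ i j, a i j = a j i)
    (h0 : ∀ i, a i i = 0) :
    2 * ∑ i, ∑ j, a i j ^ 2 = ∑ j : Fin n, (2 * a 0 j.succ) ^ 2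
      + 2 * ∑ i : Fin n, ∑ j : Fin n, a i.succ j.succ ^ 2 := by
  simp only [Fin.sum_univ_succ, h0, sum_add_distrib, mul_pow, ← mul_sum]
  simp only [fun i : Fin n => hs i.succ 0]
  ring

lemma avg_lin_sq (l : Fin n → ℝ) : avg (fun x => lin l x ^ 2) = ∑ i, l i ^ 2 := by
  induction n with
  | zero => simp [avg_zero_dim, lin]
  | succ n ih =>
    rw [avg_succ, Fin.sum_univ_succ, ← ih fun i => l i.succ, ← avg_const (n := n) (l 0 ^ 2),
      ← avg_add]
    congr 1
    funext x
    simp only [lin_cons, sgn_true, sgn_false]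
    ring

lemma avg_lin_sq_mul_lin_sq_le (l m : Fin n → ℝ) :
    avg (fun x => lin l x ^ 2 * lin m x ^ 2) ≤ 3 * ((∑ i, l i ^ 2) * ∑ i, m i ^ 2) := by
  induction n with
  | zero => simp [avg_zero_dim, lin]
  | succ n ih =>
    set L := lin fun i => l i.succ
    set M := lin fun i => m i.succ
    have key : avg (fun x => lin l x ^ 2 * lin m x ^ 2) ≤
        avg (fun x => l 0 ^ 2 * m 0 ^ 2 + 3 * l 0 ^ 2 * M x ^ 2 + 3 * m 0 ^ 2 * L x ^ 2
          + L x ^ 2 * M x ^ 2) := by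
      rw [avg_succ]
      refine avg_mono fun x => ?_
      simp only [lin_cons, sgn_true, sgn_false]
      change ((l 0 * 1 + L x) ^ 2 * (m 0 * 1 + M x) ^ 2
        + (l 0 * -1 + L x) ^ 2 * (m 0 * -1 + M x) ^ 2) / 2 ≤ _
      nlinarith [sq_nonneg (l 0 * M x - m 0 * L x)]
    refine key.trans ?_
    simp only [avg_add, avg_const_mul, avg_const, Fin.sum_univ_succ]
    have h := ih (fun i => l i.succ) (fun i => m i.succ)
    rw [show avg (fun x => M x ^ 2) = _ from avg_lin_sq _,
      show avg (fun x => L x ^ 2) = _ from avg_lin_sq _]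
    nlinarith [mul_nonneg (sq_nonneg (l 0)) (sq_nonneg (m 0))]

lemma avg_quad {a : Fin n → Fin n → ℝ} (hs : ∀ i j, a i j = a j i)
    (h0 : ∀ i, a i i = 0) : avg (quad a) = 0 := by
  induction n with
  | zero => simp [avg_zero_dim, quad]
  | succ n ih =>
    rw [avg_succ, ← ih (a := fun i j => a i.succ j.succ) (fun _ _ => hs _ _) fun _ => h0 _]
    congr 1
    funext x
    simp only [quad_cons hs h0, sgn_true, sgn_false]
    ring

lemma avg_quad_sq {a : Fin n → Fin n → ℝ} (hs : ∀ i j, a i j = a j i)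
    (h0 : ∀ i, a i i = 0) : avg (fun x => quad a x ^ 2) = 2 * ∑ i, ∑ j, a i j ^ 2 := by
  induction n with
  | zero => simp [avg_zero_dim, quad]
  | succ n ih =>
    rw [avg_succ, sum_sq_succ hs h0,
      ← ih (a := fun i j => a i.succ j.succ) (fun _ _ => hs _ _) fun _ => h0 _,
      ← avg_lin_sq, ← avg_add]
    congr 1
    funext x
    simp only [quad_cons hs h0, sgn_true, sgn_false]
    ring

lemma avg_lin_sq_mul_quad_sq_le (l : Fin n → ℝ) {a : Fin n → Fin n → ℝ}
    (hs : ∀ i j, a i j = a j i) (h0 : ∀ i, a i i = 0) :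
    avg (fun x => lin l x ^ 2 * quad a x ^ 2) ≤
      6 * ((∑ i, l i ^ 2) * (2 * ∑ i, ∑ j, a i j ^ 2)) := by
  induction n with
  | zero => simp [avg_zero_dim, lin]
  | succ n ih =>
    set L := lin fun i => l i.succ
    set M := lin fun j => 2 * a 0 j.succ
    set H := quad fun i j => a i.succ j.succ
    have key : avg (fun x => lin l x ^ 2 * quad a x ^ 2) ≤
        avg (fun x => l 0 ^ 2 * M x ^ 2 + 5 * l 0 ^ 2 * H x ^ 2 + 2 * (L x ^ 2 * M x ^ 2)
          + L x ^ 2 * H x ^ 2) := by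
      rw [avg_succ]
      refine avg_mono fun x => ?_
      simp only [lin_cons, quad_cons hs h0, sgn_true, sgn_false]
      change ((l 0 * 1 + L x) ^ 2 * (1 * M x + H x) ^ 2
        + (l 0 * -1 + L x) ^ 2 * (-1 * M x + H x) ^ 2) / 2 ≤ _
      nlinarith [sq_nonneg (2 * l 0 * H x - L x * M x)]
    refine key.trans ?_
    simp only [avg_add, avg_const_mul]
    have h := ih (fun i => l i.succ) (a := fun i j => a i.succ j.succ) (fun _ _ => hs _ _)
      fun _ => h0 _
    have hLM : avg (fun x => L x ^ 2 * M x ^ 2) ≤ _ :=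
      avg_lin_sq_mul_lin_sq_le (fun i => l i.succ) fun j => 2 * a 0 j.succ
    rw [sum_sq_succ hs h0, Fin.sum_univ_succ (f := fun i => l i ^ 2),
      show avg (fun x => M x ^ 2) = _ from avg_lin_sq _,
      show avg (fun x => H x ^ 2) = _ from avg_quad_sq (fun _ _ => hs _ _) fun _ => h0 _]
    set p := ∑ i : Fin n, l i.succ ^ 2
    set q := ∑ j : Fin n, (2 * a 0 j.succ) ^ 2
    set r := 2 * ∑ i : Fin n, ∑ j : Fin n, a i.succ j.succ ^ 2
    have hq : 0 ≤ q := by positivity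
    have hr : 0 ≤ r := by positivity
    nlinarith [mul_nonneg (sq_nonneg (l 0)) hq, mul_nonneg (sq_nonneg (l 0)) hr]

lemma avg_quad_pow_four_le {a : Fin n → Fin n → ℝ}
    (hs : ∀ i j, a i j = a j i) (h0 : ∀ i, a i i = 0) :
    avg (fun x => quad a x ^ 4) ≤ 18 * (2 * ∑ i, ∑ j, a i j ^ 2) ^ 2 := by
  induction n with
  | zero => simp [avg_zero_dim, quad]
  | succ n ih =>
    set M := lin fun j => 2 * a 0 j.succ
    set H := quad fun i j => a i.succ j.succ
    have key : avg (fun x => quad a x ^ 4) =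
        avg (fun x => M x ^ 2 * M x ^ 2 + 6 * (M x ^ 2 * H x ^ 2) + H x ^ 4) := by
      rw [avg_succ]
      congr 1
      funext x
      simp only [quad_cons hs h0, sgn_true, sgn_false]
      change ((1 * M x + H x) ^ 4 + (-1 * M x + H x) ^ 4) / 2 = _
      ring
    rw [key, sum_sq_succ hs h0]
    simp only [avg_add, avg_const_mul]
    have hH : avg (fun x => H x ^ 4) ≤ _ :=
      ih (a := fun i j => a i.succ j.succ) (fun _ _ => hs _ _) fun _ => h0 _
    have hMM : avg (fun x => M x ^ 2 * M x ^ 2) ≤ _ :=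
      avg_lin_sq_mul_lin_sq_le (fun j => 2 * a 0 j.succ) fun j => 2 * a 0 j.succ
    have hMH : avg (fun x => M x ^ 2 * H x ^ 2) ≤ _ :=
      avg_lin_sq_mul_quad_sq_le (fun j => 2 * a 0 j.succ) (a := fun i j => a i.succ j.succ)
        (fun _ _ => hs _ _) fun _ => h0 _
    set q := ∑ j : Fin n, (2 * a 0 j.succ) ^ 2
    set r := 2 * ∑ i : Fin n, ∑ j : Fin n, a i.succ j.succ ^ 2
    nlinarith [sq_nonneg q]

end moments

section khintchine

variable {n : ℕ}

/-- Flip the `i`-th coordinate of a Boolean vector. -/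
def flip (i : Fin n) (x : Fin n → Bool) : Fin n → Bool := Function.update x i (!(x i))

lemma flip_zero_cons (b : Bool) (x : Fin n → Bool) :
    flip 0 (Fin.cons b x : Fin (n + 1) → Bool) = Fin.cons (!b) x := by
  simp [flip, Fin.update_cons_zero]

lemma flip_succ_cons (i : Fin n) (b : Bool) (x : Fin n → Bool) :
    flip i.succ (Fin.cons b x : Fin (n + 1) → Bool) = Fin.cons b (flip i x) := by
  simp [flip, Fin.cons_update]

/-- The Dirichlet form of the discrete cube. -/
noncomputable def energy (f : (Fin n → Bool) → ℝ) : ℝ :=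
  ∑ i, avg (fun x => f x * (f x - f (flip i x)) / 2)

lemma energy_succ (f : (Fin (n + 1) → Bool) → ℝ) :
    energy f = avg (fun x => ((f (Fin.cons true x) - f (Fin.cons false x)) / 2) ^ 2)
      + energy (fun x => (f (Fin.cons true x) + f (Fin.cons false x)) / 2)
      + energy (fun x => (f (Fin.cons true x) - f (Fin.cons false x)) / 2) := by
  simp only [energy, Fin.sum_univ_succ, avg_succ (n := n), flip_zero_cons, flip_succ_cons,
    add_assoc, ← sum_add_distrib, ← avg_add]
  congr 1
  · congr 1
    funext x
    simp only [Bool.not_true, Bool.not_false]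
    ring
  · refine sum_congr rfl fun i _ => ?_
    congr 1
    funext x
    ring

lemma avg_sq_succ (f : (Fin (n + 1) → Bool) → ℝ) :
    avg (fun x => f x ^ 2) =
      avg (fun x => ((f (Fin.cons true x) + f (Fin.cons false x)) / 2) ^ 2)
        + avg (fun x => ((f (Fin.cons true x) - f (Fin.cons false x)) / 2) ^ 2) := by
  rw [avg_succ, ← avg_add]
  congr 1
  funext x
  ring

lemma variance_le_energy (f : (Fin n → Bool) → ℝ) :
    avg (fun x => f x ^ 2) - avg f ^ 2 ≤ energy f := by
  induction n with
  | zero => simp [avg_zero_dim, energy]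
  | succ n ih =>
    have hu := ih fun x => (f (Fin.cons true x) + f (Fin.cons false x)) / 2
    have hw := ih fun x => (f (Fin.cons true x) - f (Fin.cons false x)) / 2
    have hw' := avg_mul_sq_le (fun x => (f (Fin.cons true x) - f (Fin.cons false x)) / 2)
      (fun _ => 1)
    simp only [mul_one, one_pow, avg_const] at hw'
    rw [energy_succ, avg_sq_succ, avg_succ f]
    linarith

lemma two_mul_variance_le_energy_add (f : (Fin n → Bool) → ℝ) :
    2 * (avg (fun x => f x ^ 2) - avg f ^ 2) ≤
      energy f + ∑ i, avg (fun x => sgn (x i) * f x) ^ 2 := by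
  induction n with
  | zero => simp [avg_zero_dim, energy]
  | succ n ih =>
    have hu := ih fun x => (f (Fin.cons true x) + f (Fin.cons false x)) / 2
    have hw := variance_le_energy fun x => (f (Fin.cons true x) - f (Fin.cons false x)) / 2
    have e0 : avg (fun x => sgn (x 0) * f x) =
        avg (fun x => (f (Fin.cons true x) - f (Fin.cons false x)) / 2) := by
      rw [avg_succ]
      congr 1
      funext x
      simp only [Fin.cons_zero, sgn_true, sgn_false]
      ring
    have e1 : ∀ i : Fin n, avg (fun x => sgn (x i.succ) * f x) =
        avg (fun x => sgn (x i) * ((f (Fin.cons true x) + f (Fin.cons false x)) / 2)) := by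
      intro i
      rw [avg_succ]
      congr 1
      funext x
      simp only [Fin.cons_succ]
      ring
    rw [energy_succ, avg_sq_succ, avg_succ f, Fin.sum_univ_succ, e0]
    simp only [e1]
    linarith

lemma two_mul_variance_le_energy_of_even {f : (Fin n → Bool) → ℝ}
    (hf : ∀ x, f (fun i => !(x i)) = f x) :
    2 * (avg (fun x => f x ^ 2) - avg f ^ 2) ≤ energy f := by
  refine (two_mul_variance_le_energy_add f).trans_eq ?_
  rw [sum_eq_zero, add_zero]
  intro i _
  have h := avg_comp_not fun x => sgn (x i) * f x
  simp only [hf, sgn_not] at h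
  have h2 : avg (fun x => -sgn (x i) * f x) = -1 * avg (fun x => sgn (x i) * f x) := by
    rw [← avg_const_mul]
    congr 1
    funext x
    ring
  rw [h2] at h
  rw [show avg (fun x => sgn (x i) * f x) = 0 by linarith]
  norm_num

variable {E : Type*} [NormedAddCommGroup E]

lemma sum_sgn_flip [NormedSpace ℝ E] (v : Fin n → E) (i : Fin n) (x : Fin n → Bool) :
    ∑ j, sgn (flip i x j) • v j = ∑ j, sgn (x j) • v j - (2 * sgn (x i)) • v i := by
  rw [eq_sub_iff_add_eq, ← add_sum_erase _ _ (mem_univ i),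
    ← add_sum_erase univ (fun j => sgn (x j) • v j) (mem_univ i)]
  have : ∑ j ∈ univ.erase i, sgn (flip i x j) • v j = ∑ j ∈ univ.erase i, sgn (x j) • v j := by
    refine sum_congr rfl fun j hj => ?_
    simp [flip, Function.update_of_ne (ne_of_mem_erase hj)]
  rw [this]
  simp only [flip, Function.update_self, sgn_not]
  module

lemma energy_norm_le [NormedSpace ℝ E] (v : Fin n → E) :
    energy (fun x => ‖∑ i, sgn (x i) • v i‖) ≤ avg (fun x => ‖∑ i, sgn (x i) • v i‖ ^ 2) := by
  rw [energy, ← avg_finset_sum]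
  refine avg_mono fun x => ?_
  set X := ∑ i, sgn (x i) • v i with hX
  have h : ((n : ℝ) - 2) * ‖X‖ ≤ ∑ i, ‖∑ j, sgn (flip i x j) • v j‖ := by
    calc ((n : ℝ) - 2) * ‖X‖ ≤ ‖((n : ℝ) - 2) • X‖ := by
          rw [norm_smul]
          gcongr
          exact le_abs_self _
      _ = ‖∑ i, ∑ j, sgn (flip i x j) • v j‖ := by
          simp only [sum_sgn_flip, sum_sub_distrib, mul_smul, ← smul_sum, ← hX]
          simp [sub_smul, Nat.cast_smul_eq_nsmul]
      _ ≤ _ := norm_sum_le _ _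
  simp only [← sum_div, ← mul_sum, sum_sub_distrib, sum_const, card_univ, Fintype.card_fin,
    nsmul_eq_mul]
  nlinarith [mul_le_mul_of_nonneg_left h (norm_nonneg X)]

lemma avg_norm_sq [InnerProductSpace ℝ E] (v : Fin n → E) :
    avg (fun x => ‖∑ i, sgn (x i) • v i‖ ^ 2) = ∑ i, ‖v i‖ ^ 2 := by
  induction n with
  | zero => simp [avg_zero_dim]
  | succ n ih =>
    rw [avg_succ, Fin.sum_univ_succ, ← ih fun i => v i.succ,
      ← avg_const (n := n) (‖v 0‖ ^ 2), ← avg_add]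
    congr 1
    funext x
    simp only [Fin.sum_univ_succ, Fin.cons_zero, Fin.cons_succ, sgn_true, sgn_false, one_smul,
      neg_smul]
    have h := parallelogram_law_with_norm ℝ (∑ i, sgn (x i) • v i.succ) (v 0)
    rw [add_comm (v 0), neg_add_eq_sub]
    linarith

/-- The Khintchine–Kahane inequality with the optimal constant, due to Latała and
Oleszkiewicz, for Hilbert space valued Rademacher sums. -/
lemma sum_norm_sq_le_two_mul_avg_norm_sq [InnerProductSpace ℝ E] (v : Fin n → E) :
    ∑ i, ‖v i‖ ^ 2 ≤ 2 * avg (fun x => ‖∑ i, sgn (x i) • v i‖) ^ 2 := by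
  have h1 := two_mul_variance_le_energy_of_even (f := fun x => ‖∑ i, sgn (x i) • v i‖)
    fun x => by simp
  have h2 := energy_norm_le v
  rw [avg_norm_sq] at h1 h2
  linarith

lemma sqrt_sum_norm_sq_le [InnerProductSpace ℝ E] (v : Fin n → E) :
    √(∑ i, ‖v i‖ ^ 2) ≤ √2 * avg (fun x => ‖∑ i, sgn (x i) • v i‖) := by
  have h0 : 0 ≤ avg (fun x => ‖∑ i, sgn (x i) • v i‖) := avg_nonneg fun _ => norm_nonneg _
  rw [Real.sqrt_le_left (by positivity), mul_pow, Real.sq_sqrt (by norm_num)]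
  exact sum_norm_sq_le_two_mul_avg_norm_sq v

lemma sqrt_sum_sq_le_decoupled (b : Fin n → Fin n → ℝ) :
    √(∑ i, ∑ j, b i j ^ 2) ≤
      2 * avg (fun y => avg fun x => |∑ i, ∑ j, b i j * (sgn (x i) * sgn (y j))|) := by
  have h1 := sqrt_sum_norm_sq_le fun j => (WithLp.toLp 2 fun i => b i j : EuclideanSpace ℝ (Fin n))
  have h2 : ∀ y : Fin n → Bool,
      ‖∑ j, sgn (y j) • (WithLp.toLp 2 fun i => b i j : EuclideanSpace ℝ (Fin n))‖ ≤
        √2 * avg fun x => |∑ i, ∑ j, b i j * (sgn (x i) * sgn (y j))| := by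
    intro y
    refine Eq.trans_le ?_ ((sqrt_sum_norm_sq_le fun i => ∑ j, b i j * sgn (y j)).trans_eq ?_)
    · rw [EuclideanSpace.norm_eq]
      congr 1
      refine sum_congr rfl fun i _ => ?_
      congr 2
      simp [mul_comm]
    · congr 2
      funext x
      rw [Real.norm_eq_abs]
      congr 1
      refine sum_congr rfl fun i _ => ?_
      rw [smul_eq_mul, mul_sum]
      exact sum_congr rfl fun j _ => by ring
  have h3 := avg_mono h2
  rw [avg_const_mul] at h3
  have h4 : ∑ i, ∑ j, b i j ^ 2 =
      ∑ j, ‖(WithLp.toLp 2 fun i => b i j : EuclideanSpace ℝ (Fin n))‖ ^ 2 := by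
    rw [sum_comm]
    simp [EuclideanSpace.norm_sq_eq]
  rw [h4]
  refine h1.trans ((mul_le_mul_of_nonneg_left h3 (Real.sqrt_nonneg 2)).trans_eq ?_)
  rw [← mul_assoc, Real.mul_self_sqrt (by norm_num)]

end khintchine

section decoupling

variable {n : ℕ}

/-- Take the coordinates selected by `z` from `x` and the others from `y`. -/
def mix (z x y : Fin n → Bool) : Fin n → Bool := fun i => if z i then x i else y i

lemma mix_cons (z : Fin (n + 1) → Bool) (b c : Bool) (x y : Fin n → Bool) :
    mix z (Fin.cons b x) (Fin.cons c y) =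
      Fin.cons (if z 0 then b else c) (mix (fun i => z i.succ) x y) := by
  funext i
  refine Fin.cases ?_ (fun i => ?_) i <;> simp [mix]

lemma avg_avg_mix (z : Fin n → Bool) (F : (Fin n → Bool) → ℝ) :
    avg (fun y => avg fun x => F (mix z x y)) = avg F := by
  induction n with
  | zero =>
    simp only [avg_zero_dim]
    congr 1
    exact Subsingleton.elim _ _
  | succ n ih =>
    rw [avg_succ F, ← ih fun i => z i.succ, avg_succ]
    congr 1
    funext y
    rw [avg_succ, avg_succ, ← avg_add, div_eq_inv_mul, ← avg_const_mul]
    congr 1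
    funext x
    simp only [mix_cons]
    cases z 0 <;> simp
    all_goals ring

lemma quad_mix_sub {a : Fin n → Fin n → ℝ} (hs : ∀ i j, a i j = a j i)
    (x y z : Fin n → Bool) :
    quad a (mix z x y) - quad a (mix z (fun i => !(x i)) y) =
      4 * ∑ i, ∑ j, (if z i ∧ ¬ z j then a i j else 0) * (sgn (x i) * sgn (y j)) := by
  set T := ∑ i, ∑ j, (if z i ∧ ¬ z j then a i j else 0) * (sgn (x i) * sgn (y j)) with hT
  have hT' : T = ∑ i, ∑ j, (if z j ∧ ¬ z i then a i j else 0) * (sgn (x j) * sgn (y i)) := by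
    rw [hT, sum_comm]
    refine sum_congr rfl fun i _ => sum_congr rfl fun j _ => ?_
    rw [hs j i]
  have : quad a (mix z x y) - quad a (mix z (fun i => !(x i)) y) = 2 * T + 2 * T := by
    nth_rewrite 2 [hT']
    rw [hT]
    simp only [quad, mul_sum, ← sum_sub_distrib, ← sum_add_distrib]
    refine sum_congr rfl fun i _ => sum_congr rfl fun j _ => ?_
    cases hi : z i <;> cases hj : z j <;> simp [mix, hi, hj] <;> ring
  rw [this]
  ring

lemma sqrt_sum_sq_cut_le {a : Fin n → Fin n → ℝ} (hs : ∀ i j, a i j = a j i)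
    (z : Fin n → Bool) :
    √(∑ i, ∑ j, (if z i ∧ ¬ z j then a i j else 0) ^ 2) ≤ avg fun x => |quad a x| := by
  refine (sqrt_sum_sq_le_decoupled fun i j => if z i ∧ ¬ z j then a i j else 0).trans ?_
  have h : avg (fun y => avg fun x => 4 * |∑ i, ∑ j, (if z i ∧ ¬ z j then a i j else 0)
      * (sgn (x i) * sgn (y j))|) ≤ avg (fun y => avg fun x =>
        |quad a (mix z x y)| + |quad a (mix z (fun i => !(x i)) y)|) := by
    refine avg_mono fun y => avg_mono fun x => ?_
    have := abs_sub (quad a (mix z x y)) (quad a (mix z (fun i => !(x i)) y))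
    rwa [quad_mix_sub hs, abs_mul, abs_of_pos (by norm_num : (0 : ℝ) < 4)] at this
  have hn : ∀ y, avg (fun x => |quad a (mix z (fun i => !(x i)) y)|) =
      avg (fun x => |quad a (mix z x y)|) :=
    fun y => avg_comp_not fun x => |quad a (mix z x y)|
  simp only [avg_add, avg_const_mul, hn, avg_avg_mix z fun x => |quad a x|] at h
  linarith

lemma exists_large_cut {a : Fin n → Fin n → ℝ} (hs : ∀ i j, a i j = a j i)
    (h0 : ∀ i, a i i = 0) :
    ∃ z : Fin n → Bool, (∑ i, ∑ j, a i j ^ 2) / 4 ≤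
      ∑ i, ∑ j, (if z i ∧ ¬ z j then a i j else 0) ^ 2 := by
  obtain ⟨z, hz⟩ := exists_le_zero_of_avg_eq_zero
    (avg_quad (a := fun i j => a i j ^ 2) (fun i j => by rw [hs]) fun i => by simp [h0])
  refine ⟨z, ?_⟩
  have hswap : ∑ i, ∑ j, a i j ^ 2 * sgn (z j) = ∑ i, ∑ j, a i j ^ 2 * sgn (z i) := by
    rw [sum_comm]
    exact sum_congr rfl fun i _ => sum_congr rfl fun j _ => by rw [hs]
  have : 4 * ∑ i, ∑ j, (if z i ∧ ¬ z j then a i j else 0) ^ 2 =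
      ∑ i, ∑ j, a i j ^ 2 + ∑ i, ∑ j, a i j ^ 2 * sgn (z i) - ∑ i, ∑ j, a i j ^ 2 * sgn (z j)
        - quad (fun i j => a i j ^ 2) z := by
    simp only [quad, mul_sum, ← sum_sub_distrib, ← sum_add_distrib]
    refine sum_congr rfl fun i _ => sum_congr rfl fun j _ => ?_
    cases hi : z i <;> cases hj : z j <;> simp
    all_goals ring
  linarith

lemma sqrt_sum_sq_le_avg_abs_quad {a : Fin n → Fin n → ℝ} (hs : ∀ i j, a i j = a j i)
    (h0 : ∀ i, a i i = 0) :
    √(∑ i, ∑ j, a i j ^ 2) ≤ 2 * avg fun x => |quad a x| := by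
  obtain ⟨z, hz⟩ := exists_large_cut hs h0
  have h := (Real.sqrt_le_sqrt hz).trans (sqrt_sum_sq_cut_le hs z)
  rw [Real.sqrt_div' _ (by norm_num), show (4 : ℝ) = 2 ^ 2 by norm_num,
    Real.sqrt_sq (by norm_num)] at h
  linarith

end decoupling

/-- A mean-zero function satisfies a Paley–Zygmund type bound for its negative part. -/
lemma avg_abs_pow_four_le {n : ℕ} {F : (Fin n → Bool) → ℝ} (hF : avg F = 0) :
    avg (fun x => |F x|) ^ 4 ≤
      16 * (avg (fun x => if F x ≤ 0 then 1 else 0) ^ 3 * avg (fun x => F x ^ 4)) := by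
  set I : (Fin n → Bool) → ℝ := fun x => if F x ≤ 0 then 1 else 0 with hI
  set N : (Fin n → Bool) → ℝ := fun x => (|F x| - F x) / 2 with hN
  have hI0 : 0 ≤ avg I := avg_nonneg fun x => by simp only [hI]; split_ifs <;> norm_num
  have hII : avg (fun x => I x ^ 2) = avg I := by
    congr 1; funext x; simp only [hI]; split_ifs <;> norm_num
  have hNI : ∀ x, N x * I x = N x := fun x => by
    simp only [hN, hI]
    split_ifs with h
    · simp
    · rw [abs_of_pos (not_le.1 h)]; simp
  have hNF : avg (fun x => (N x ^ 2) ^ 2) ≤ avg (fun x => F x ^ 4) := avg_mono fun x => by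
    simp only [hN]
    rcases abs_cases (F x) with ⟨h, -⟩ | ⟨h, -⟩ <;> rw [h]
    · norm_num
      positivity
    · exact le_of_eq (by ring)
  have hm : avg N = avg (fun x => |F x|) / 2 := by
    have : avg (fun x => (1 / 2 : ℝ) * (|F x| - F x)) = avg (fun x => |F x|) / 2 := by
      rw [avg_const_mul, avg_sub, hF]; ring
    rw [← this]
    congr 1; funext x; simp only [hN]; ring
  have c1 := avg_mul_sq_le N I
  have c2 := avg_mul_sq_le (fun x => N x ^ 2) I
  have hNI2 : ∀ x, N x ^ 2 * I x = N x ^ 2 := fun x => by rw [sq, mul_assoc, hNI]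
  simp only [hNI, hNI2, hII] at c1 c2
  have hkey : avg N ^ 4 ≤ avg I ^ 3 * avg (fun x => F x ^ 4) := by
    calc avg N ^ 4 = (avg N ^ 2) ^ 2 := by ring
      _ ≤ (avg (fun x => N x ^ 2) * avg I) ^ 2 := by gcongr
      _ = avg (fun x => N x ^ 2) ^ 2 * avg I ^ 2 := by ring
      _ ≤ (avg (fun x => (N x ^ 2) ^ 2) * avg I) * avg I ^ 2 := by gcongr
      _ ≤ (avg (fun x => F x ^ 4) * avg I) * avg I ^ 2 := by gcongr
      _ = _ := by ring
  rw [hm] at hkey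
  linarith [show (avg (fun x => |F x|) / 2) ^ 4 = avg (fun x => |F x|) ^ 4 / 16 by ring]

lemma one_le_avg_quad_nonpos {n : ℕ} {a : Fin n → Fin n → ℝ} (hs : ∀ i j, a i j = a j i)
    (h0 : ∀ i, a i i = 0) :
    1 ≤ 18432 * avg (fun x => if quad a x ≤ 0 then 1 else 0) ^ 3 := by
  rcases (show 0 ≤ ∑ i, ∑ j, a i j ^ 2 by positivity).eq_or_lt with h | h
  · have ha : ∀ i j, a i j = 0 := by
      intro i j
      have h1 := (sum_eq_zero_iff_of_nonneg fun i _ => sum_nonneg fun j _ => sq_nonneg (a i j)).1 h.symm i (mem_univ i)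
      have h2 := (sum_eq_zero_iff_of_nonneg fun j _ => sq_nonneg (a i j)).1 h1 j (mem_univ j)
      exact pow_eq_zero_iff (two_ne_zero) |>.1 h2
    simp only [quad, ha]
    norm_num
  · have h1 := avg_abs_pow_four_le (avg_quad hs h0)
    have h2 := avg_quad_pow_four_le hs h0
    have h3 := sqrt_sum_sq_le_avg_abs_quad hs h0
    have hp : 0 ≤ avg (fun x => if quad a x ≤ 0 then (1 : ℝ) else 0) :=
      avg_nonneg fun x => by split_ifs <;> norm_num
    set s := ∑ i, ∑ j, a i j ^ 2
    set p := avg (fun x => if quad a x ≤ 0 then (1 : ℝ) else 0)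
    have h4 : s ^ 2 ≤ 16 * avg (fun x => |quad a x|) ^ 4 := by
      calc s ^ 2 = (√s ^ 2) ^ 2 := by rw [Real.sq_sqrt h.le]
        _ = √s ^ 4 := by ring
        _ ≤ (2 * avg fun x => |quad a x|) ^ 4 := by gcongr
        _ = _ := by ring
    have h5 : p ^ 3 * avg (fun x => quad a x ^ 4) ≤ p ^ 3 * (18 * (2 * s) ^ 2) := by gcongr
    have h6 : 1 * s ^ 2 ≤ (18432 * p ^ 3) * s ^ 2 := by linarith
    exact le_of_mul_le_mul_right h6 (by positivity)

lemma norm_sq_eq_add_quad {n : ℕ} {E : Type*} [NormedAddCommGroup E] [InnerProductSpace ℝ E]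
    (v : Fin n → E) (x : Fin n → Bool) :
    ‖∑ i, sgn (x i) • v i‖ ^ 2 =
      ∑ i, ‖v i‖ ^ 2 + quad (fun i j => if i = j then 0 else inner ℝ (v i) (v j)) x := by
  have hd : ∑ i, ‖v i‖ ^ 2 = ∑ i, ∑ j, if i = j then ‖v i‖ ^ 2 else 0 := by simp
  rw [← real_inner_self_eq_norm_sq, hd]
  simp only [sum_inner, inner_sum, quad, ← sum_add_distrib, real_inner_smul_left,
    real_inner_smul_right]
  refine sum_congr rfl fun i _ => sum_congr rfl fun j _ => ?_
  split_ifs with h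
  · subst h
    rw [real_inner_self_eq_norm_sq]
    cases x i <;> simp
  · rw [real_inner_comm]
    ring

lemma constant_le : (1 - √(1 - 1 / Real.exp 1 ^ 2)) / 2 ≤ 0.0352 := by
  have he : (2.718 : ℝ) ≤ Real.exp 1 := by linarith [Real.exp_one_gt_d9]
  have h1 : 1 / Real.exp 1 ^ 2 ≤ 1 / 2.718 ^ 2 := by gcongr
  have h2 : (0.9296 : ℝ) ≤ √(1 - 1 / Real.exp 1 ^ 2) := by
    apply Real.le_sqrt_of_sq_le
    norm_num at h1 ⊢
    linarith
  linarith

end Rademacher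

/-- **Theorem (high-dimensional lower bound, lower tail).**
Let `d ≥ 1` and let `v_1, ..., v_n ∈ ℝ^d` with `Σ ‖v_i‖² = 1`. For the vector-valued
Rademacher sum `X = Σ v_i ε_i` (uniform measure on sign vectors `Fin n → Bool`),
`Pr[‖X‖ ≤ 1] ≥ (1 - √(1 - 1/e²))/2`. -/
theorem vector_rademacher_norm_le_one
    (d : ℕ) (hd : 1 ≤ d) (n : ℕ) (v : Fin n → EuclideanSpace ℝ (Fin d))
    (hv : ∑ i, ‖v i‖ ^ 2 = 1) :
    (1 - Real.sqrt (1 - 1 / Real.exp 1 ^ 2)) / 2 ≤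
      ((Finset.univ.filter (fun ε : Fin n → Bool =>
          ‖∑ i, (if ε i then (1 : ℝ) else -1) • v i‖ ≤ 1)).card : ℝ) / 2 ^ n := by
  set a : Fin n → Fin n → ℝ := fun i j => if i = j then 0 else inner ℝ (v i) (v j) with ha
  have hp := Rademacher.one_le_avg_quad_nonpos (a := a)
    (fun i j => by simp only [ha, eq_comm (a := i), real_inner_comm (v i)]) (fun i => by simp [ha])
  have hcard : ((Finset.univ.filter (fun ε : Fin n → Bool =>
      ‖∑ i, (if ε i then (1 : ℝ) else -1) • v i‖ ≤ 1)).card : ℝ) / 2 ^ n =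
        Rademacher.avg (fun x => if Rademacher.quad a x ≤ 0 then 1 else 0) := by
    rw [Rademacher.avg, Finset.sum_boole]
    congr 3
    ext ε
    have h := Rademacher.norm_sq_eq_add_quad v ε
    rw [hv] at h
    simp only [Finset.mem_filter, Finset.mem_univ, true_and]
    change ‖∑ i, Rademacher.sgn (ε i) • v i‖ ≤ 1 ↔ _
    rw [← sq_le_one_iff₀ (norm_nonneg _), h]
    constructor <;> intro h' <;> linarith
  rw [hcard]
  refine Rademacher.constant_le.trans ?_
  by_contra! hlt
  have h0 : 0 ≤ Rademacher.avg (fun x => if Rademacher.quad a x ≤ 0 then (1 : ℝ) else 0) :=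
    Rademacher.avg_nonneg fun x => by split_ifs <;> norm_num
  have h3 := pow_le_pow_left₀ h0 hlt.le 3
  norm_num at h3
  linarith
end

section
/- Let α > 0, let 0 < k ≤ t, and let b_1 ≥ b_2 ≥ ... ≥ b_t > 0 be real numbers such that b_{t-k+1} + b_{t-k+2} + ... + b_t ≥ α. Let f(k, t) denote the sum of the k largest binomial coefficients among C(t, 0), C(t, 1), ..., C(t, t). Then for every real number x and all real numbers b_{t+1}, ..., b_s, the Rademacher sum S = Σ_{i=1}^s b_i ε_i satisfies Pr[S ∈ (x - α, x + α)] ≤ f(k, t)/2^t. -/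
open Finset

/-- Shifting the entries of a decreasing list of naturals down by its `k`-th entry and truncating
at zero leaves exactly the excess of its first `k` entries. -/
theorem List.exists_sum_map_tsub_add_mul_eq_sum_take {l : List ℕ} (hl : l.Pairwise (· ≥ ·)) :
    ∀ {k : ℕ}, 0 < k → k ≤ l.length →
      ∃ θ ∈ l, (l.map (· - θ)).sum + k * θ = (l.take k).sum := by
  induction l with
  | nil => intro k hk hkl; simp at hkl; omega
  | cons a l ih =>
    rw [List.pairwise_cons] at hl
    intro k hk hkl
    obtain ⟨k, rfl⟩ := Nat.exists_eq_succ_of_ne_zero hk.ne'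
    rcases Nat.eq_zero_or_pos k with rfl | hk'
    · refine ⟨a, by simp, ?_⟩
      have : (l.map (· - a)).sum = 0 := by
        rw [List.sum_eq_zero_iff]
        intro y hy
        obtain ⟨z, hz, rfl⟩ := List.mem_map.1 hy
        exact Nat.sub_eq_zero_of_le (hl.1 z hz)
      simp [this]
    · obtain ⟨θ, hθ, h⟩ := ih hl.2 hk' (by simpa using hkl)
      refine ⟨θ, List.mem_cons_of_mem _ hθ, ?_⟩
      have := hl.1 θ hθ
      simp only [List.map_cons, List.sum_cons, List.take_succ_cons, ← h, Nat.succ_eq_add_one,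
        add_mul]
      omega

/-- A LYM inequality for families in which nested sets differ by fewer than `k` elements. -/
theorem Finset.sum_inv_choose_le_of_card_lt_card_add {α : Type*} [Fintype α] (k : ℕ)
    (F : Finset (Finset α)) (hF : ∀ A ∈ F, ∀ B ∈ F, A ⊆ B → #B < #A + k) :
    ∑ A ∈ F, ((Fintype.card α).choose #A : ℝ)⁻¹ ≤ k := by
  classical
  induction k generalizing F with
  | zero =>
    have : F = ∅ := eq_empty_of_forall_notMem fun A hA => by
      simpa using hF A hA A hA subset_rfl
    simp [this]
  | succ k ih =>
    rw [← sum_filter_add_sum_filter_not F (fun A => ∃ B ∈ F, B ⊂ A)]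
    push_cast
    refine add_le_add (ih _ ?_) (lubell_yamamoto_meshalkin_inequality_sum_inv_choose ?_)
    · intro A hA B hB hAB
      obtain ⟨-, C, hC, hCA⟩ := mem_filter.1 hA
      have := hF C hC B (mem_filter.1 hB).1 (hCA.subset.trans hAB)
      have := card_lt_card hCA
      omega
    · intro A hA B hB hne hAB
      rw [mem_coe, mem_filter] at hA hB
      exact hB.2 ⟨A, hA.1, hAB.ssubset_of_ne hne⟩

/-- Erdős' bound: a family of subsets of an `n`-element set in which nested sets differ by fewer
than `k` elements has size at most the sum of the `k` largest binomial coefficients `C(n, i)`. -/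
theorem Finset.card_le_sum_largest_choose {α : Type*} [Fintype α] {k : ℕ} (hk : 0 < k)
    (hkn : k ≤ Fintype.card α) (F : Finset (Finset α))
    (hF : ∀ A ∈ F, ∀ B ∈ F, A ⊆ B → #B < #A + k) :
    #F ≤ ((((Multiset.range (Fintype.card α + 1)).map
      (Fintype.card α).choose).sort (· ≤ ·)).reverse.take k).sum := by
  classical
  set n := Fintype.card α with hn
  set M := (Multiset.range (n + 1)).map n.choose with hM
  have hsort : (M.sort (· ≤ ·)).reverse.Pairwise (· ≥ ·) :=
    List.pairwise_reverse.2 (M.pairwise_sort (· ≤ ·))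
  obtain ⟨θ, -, hθ⟩ := List.exists_sum_map_tsub_add_mul_eq_sum_take hsort hk
    (by simp [hM]; omega)
  have hsum : ((M.sort (· ≤ ·)).reverse.map (· - θ)).sum =
      ∑ r ∈ range (n + 1), (n.choose r - θ) := by
    rw [← Multiset.sum_coe, ← Multiset.map_coe, Multiset.coe_reverse, Multiset.sort_eq, hM,
      Multiset.map_map]
    rfl
  rw [← hθ, hsum]
  have hpos (A : Finset α) : (0 : ℝ) < n.choose #A :=
    Nat.cast_pos.2 (Nat.choose_pos (card_le_univ A))
  have hall : ∑ A : Finset α, ((n.choose #A - θ : ℕ) : ℝ) * (n.choose #A : ℝ)⁻¹ =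
      ∑ r ∈ range (n + 1), ((n.choose r - θ : ℕ) : ℝ) := by
    rw [← powerset_univ, sum_powerset_apply_card
      (fun r => ((n.choose r - θ : ℕ) : ℝ) * (n.choose r : ℝ)⁻¹), card_univ, ← hn]
    refine sum_congr rfl fun r hr => ?_
    have : (n.choose r : ℝ) ≠ 0 :=
      Nat.cast_ne_zero.2 (Nat.choose_pos (by simpa [Nat.lt_succ_iff] using hr)).ne'
    rw [nsmul_eq_mul]
    field_simp
  have key : (#F : ℝ) ≤ ∑ r ∈ range (n + 1), ((n.choose r - θ : ℕ) : ℝ) + k * θ := by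
    calc (#F : ℝ) = ∑ A ∈ F, (n.choose #A : ℝ) * (n.choose #A : ℝ)⁻¹ := by
          simp [mul_inv_cancel₀ (hpos _).ne']
      _ ≤ ∑ A ∈ F, (((n.choose #A - θ : ℕ) : ℝ) * (n.choose #A : ℝ)⁻¹ +
            (n.choose #A : ℝ)⁻¹ * θ) := by
          refine sum_le_sum fun A _ => ?_
          rw [mul_comm _ (θ : ℝ), ← add_mul]
          refine mul_le_mul_of_nonneg_right ?_ (inv_nonneg.2 (hpos A).le)
          exact_mod_cast (le_tsub_add : n.choose #A ≤ n.choose #A - θ + θ)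
      _ ≤ _ := by
          rw [sum_add_distrib, ← sum_mul, ← hall]
          refine add_le_add (sum_le_sum_of_subset_of_nonneg (subset_univ F) fun A _ _ => ?_)
            (mul_le_mul_of_nonneg_right (sum_inv_choose_le_of_card_lt_card_add k F hF)
              (Nat.cast_nonneg θ))
          exact mul_nonneg (Nat.cast_nonneg _) (inv_nonneg.2 (hpos A).le)
  exact_mod_cast key

/-- For positive decreasing weights, any `k` or more weights sum to at least the last `k`. -/
theorem sum_last_le_sum_of_le_card {t k : ℕ} (hkt : k ≤ t) {b : Fin t → ℝ} (hk : 0 < k)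
    (hpos : ∀ i, 0 < b i) (hb : Antitone b) {D : Finset (Fin t)} (hD : k ≤ #D) :
    ∑ i ∈ univ.filter (fun i : Fin t => t - k ≤ (i : ℕ)), b i ≤ ∑ i ∈ D, b i := by
  set T : Finset (Fin t) := {i | t - k ≤ (i : ℕ)} with hT
  set p : Fin t := ⟨t - k, by omega⟩
  have hTcard : #T = k := by
    have : T = Ici p := by ext i; simp [hT, p, Fin.le_def]
    rw [this, Fin.card_Ici]
    simp only [p]
    omega
  have hcard : #(T \ D) ≤ #(D \ T) := card_sdiff_le_card_sdiff_iff.2 (hTcard.trans_le hD)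
  have h₁ : ∑ i ∈ T \ D, b i ≤ #(T \ D) • b p := sum_le_card_nsmul _ _ _ fun i hi =>
    hb (Fin.le_def.2 (mem_filter.1 (mem_sdiff.1 hi).1).2)
  have h₂ : #(D \ T) • b p ≤ ∑ i ∈ D \ T, b i := card_nsmul_le_sum _ _ _ fun i hi =>
    hb (Fin.le_def.2 (by
      have := (mem_sdiff.1 hi).2
      simp only [hT, mem_filter, mem_univ, true_and] at this
      simp only [p]
      omega))
  have h₃ := nsmul_le_nsmul_left (hpos p).le hcard
  rw [← sum_inter_add_sum_sdiff T D, ← sum_inter_add_sum_sdiff D T, inter_comm]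
  linarith

/-- The case without further weights, as a count of sign patterns. -/
theorem card_rademacher_mem_interval_le {t k : ℕ} (hk : 0 < k) (hkt : k ≤ t) {α : ℝ}
    {b : Fin t → ℝ} (hpos : ∀ i, 0 < b i) (hb : Antitone b)
    (hlast : α ≤ ∑ i ∈ univ.filter (fun i : Fin t => t - k ≤ (i : ℕ)), b i) (x : ℝ) :
    #{ε : Fin t → Bool | x - α < ∑ i, b i * (if ε i then (1 : ℝ) else -1) ∧
        ∑ i, b i * (if ε i then (1 : ℝ) else -1) < x + α} ≤
      ((((Multiset.range (t + 1)).map t.choose).sort (· ≤ ·)).reverse.take k).sum := by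
  set E : Finset (Fin t → Bool) := {ε | x - α < ∑ i, b i * (if ε i then (1 : ℝ) else -1) ∧
    ∑ i, b i * (if ε i then (1 : ℝ) else -1) < x + α} with hE
  let φ : (Fin t → Bool) → Finset (Fin t) := fun ε => {i | ε i}
  have hφ : Function.Injective φ := fun ε δ h => by
    ext i
    exact Bool.eq_iff_iff.2 (by simpa [φ] using Finset.ext_iff.1 h i)
  have hsum (ε : Fin t → Bool) :
      ∑ i, b i * (if ε i then (1 : ℝ) else -1) = 2 * ∑ i ∈ φ ε, b i - ∑ i, b i := by
    rw [sum_filter, mul_sum, ← sum_sub_distrib]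
    refine sum_congr rfl fun i _ => ?_
    split_ifs <;> ring
  have main := card_le_sum_largest_choose (α := Fin t) hk (by simpa using hkt) (E.image φ) (by
    intro A hA B hB hAB
    obtain ⟨ε, hε, rfl⟩ := mem_image.1 hA
    obtain ⟨δ, hδ, rfl⟩ := mem_image.1 hB
    by_contra! hcard
    have hε := (mem_filter.1 hε).2.1
    have hδ := (mem_filter.1 hδ).2.2
    rw [hsum] at hε hδ
    have := sum_last_le_sum_of_le_card hkt hk hpos hb (D := φ δ \ φ ε)
      (by rw [card_sdiff_of_subset hAB]; omega)
    have := sum_sdiff (f := b) hAB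
    linarith)
  rwa [card_image_of_injective _ hφ, Fintype.card_fin] at main

/-- **Observation (anti-concentration via Erdős' chain argument).**
Let `b_1 ≥ ... ≥ b_t > 0` (0-indexed: `b_0, ..., b_{t-1}`) satisfy
`b_{t-k+1} + ... + b_t ≥ α` for some `α > 0` and `0 < k ≤ t`. Then for any `x` and any
further weights `b_{t+1}, ..., b_s`, the Rademacher sum `S = Σ_{i=1}^s b_i ε_i` satisfies
`Pr[S ∈ (x - α, x + α)] ≤ f(k,t)/2^t`, where `f(k,t)` is the sum of the `k` largest
binomial coefficients `C(t,i)`, `0 ≤ i ≤ t` (here computed as the sum of the first `k`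
entries of the decreasingly sorted list of these coefficients). -/
theorem rademacher_interval_prob_le_sum_largest_binomials
    (t s k : ℕ) (hk0 : 0 < k) (hkt : k ≤ t) (hts : t ≤ s)
    (α : ℝ) (hα : 0 < α) (b : Fin s → ℝ)
    (hpos : ∀ i : Fin s, (i : ℕ) < t → 0 < b i)
    (hmono : ∀ i j : Fin s, i ≤ j → (j : ℕ) < t → b j ≤ b i)
    (hlast : α ≤ ∑ i ∈ Finset.univ.filter
        (fun i : Fin s => t - k ≤ (i : ℕ) ∧ (i : ℕ) < t), b i)
    (x : ℝ) :
    ((Finset.univ.filter (fun ε : Fin s → Bool =>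
        x - α < ∑ i, b i * (if ε i then (1 : ℝ) else -1) ∧
        ∑ i, b i * (if ε i then (1 : ℝ) else -1) < x + α)).card : ℝ) / 2 ^ s ≤
      ((((((Multiset.range (t + 1)).map t.choose).sort (· ≤ ·)).reverse.take k).sum : ℕ) : ℝ)
        / 2 ^ t := by
  obtain ⟨m, rfl⟩ := Nat.exists_eq_add_of_le hts
  set N := ((((Multiset.range (t + 1)).map t.choose).sort (· ≤ ·)).reverse.take k).sum
  have hcount : #{ε : Fin (t + m) → Bool | x - α < ∑ i, b i * (if ε i then (1 : ℝ) else -1) ∧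
      ∑ i, b i * (if ε i then (1 : ℝ) else -1) < x + α} ≤ N * 2 ^ m := by
    have hfiber := card_le_mul_card_image_of_maps_to
      (s := {ε : Fin (t + m) → Bool | x - α < ∑ i, b i * (if ε i then (1 : ℝ) else -1) ∧
        ∑ i, b i * (if ε i then (1 : ℝ) else -1) < x + α})
      (t := (univ : Finset (Fin m → Bool))) (f := fun ε j => ε (Fin.natAdd t j))
      (fun _ _ => mem_univ _) N ?_
    · simpa using hfiber
    · intro δ _
      have hc := card_rademacher_mem_interval_le (b := fun i => b (Fin.castAdd m i)) hk0 hkt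
        (fun i => hpos _ i.2) (fun i j hij => hmono _ _ hij j.2) (α := α) ?_
        (x - ∑ j, b (Fin.natAdd t j) * (if δ j then (1 : ℝ) else -1))
      · refine (card_le_card_of_injOn (fun ε i => ε (Fin.castAdd m i)) ?_ ?_).trans hc
        · intro ε hε
          simp only [coe_filter, mem_filter, mem_univ, true_and, Set.mem_ofPred_eq,
            Fin.sum_univ_add] at hε ⊢
          obtain ⟨⟨h₁, h₂⟩, rfl⟩ := hε
          constructor <;> linarith
        · intro ε hε ε' hε' h
          simp only [coe_filter, mem_filter, Set.mem_ofPred_eq] at hε hε'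
          funext i
          refine Fin.addCases (fun i => congrFun h i) (fun j => ?_) i
          exact congrFun (hε.2.trans hε'.2.symm) j
      · refine hlast.trans_eq ?_
        simp [sum_filter, Fin.sum_univ_add]
  rw [div_le_div_iff₀ (by positivity) (by positivity), pow_add, mul_comm ((2 : ℝ) ^ t), ← mul_assoc]
  exact mul_le_mul_of_nonneg_right (by exact_mod_cast hcount) (by positivity)
end

section
/- Let δ > 0 and let b_1, b_2 be real numbers with b_1 ≥ δ, b_2 ≥ δ and |b_1 - b_2| ≥ δ. Then for every real number x and all real numbers b_3, ..., b_l, the Rademacher sum S = Σ_{i=1}^l b_i ε_i satisfies Pr[S ∈ (x - δ, x + δ)] ≤ 1/4. -/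
open Finset

/-- Two weights at least `δ`, differing by at least `δ`, have at most one signed combination
in an open interval of length `2 * δ`. -/
theorem signs_eq_of_mem_interval {δ a c x s : ℝ} (ha : δ ≤ a) (hc : δ ≤ c)
    (hdiff : δ ≤ |a - c|) {p q p' q' : Bool}
    (h₁ : x - δ < a * (if p then (1 : ℝ) else -1) + (c * (if q then (1 : ℝ) else -1) + s))
    (h₂ : a * (if p then (1 : ℝ) else -1) + (c * (if q then (1 : ℝ) else -1) + s) < x + δ)
    (h₃ : x - δ < a * (if p' then (1 : ℝ) else -1) + (c * (if q' then (1 : ℝ) else -1) + s))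
    (h₄ : a * (if p' then (1 : ℝ) else -1) + (c * (if q' then (1 : ℝ) else -1) + s) < x + δ) :
    p = p' ∧ q = q' := by
  rcases le_abs.mp hdiff with hd | hd <;>
  cases p <;> cases q <;> cases p' <;> cases q' <;>
    simp only [if_true, if_false, Bool.false_eq_true, and_self, reduceCtorEq,
      and_true, and_false] at h₁ h₂ h₃ h₄ ⊢ <;> linarith

/-- **Observation (two separated large weights give anti-concentration 1/4).**
Fix `δ > 0` and `b_1, b_2 ≥ δ` with `|b_1 - b_2| ≥ δ`. Then for any `x` and any further
weights `b_3, ..., b_l`, the Rademacher sum `S = Σ_{i=1}^l b_i ε_i` satisfies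
`Pr[S ∈ (x - δ, x + δ)] ≤ 1/4`. (Indices are 0-based: `b_1, b_2` are `b ⟨0,_⟩, b ⟨1,_⟩`.) -/
theorem rademacher_interval_prob_le_quarter
    (l : ℕ) (hl : 2 ≤ l) (δ : ℝ) (hδ : 0 < δ) (b : Fin l → ℝ)
    (hb1 : δ ≤ b ⟨0, by omega⟩) (hb2 : δ ≤ b ⟨1, by omega⟩)
    (hdiff : δ ≤ |b ⟨0, by omega⟩ - b ⟨1, by omega⟩|)
    (x : ℝ) :
    ((Finset.univ.filter (fun ε : Fin l → Bool =>
        x - δ < ∑ i, b i * (if ε i then (1 : ℝ) else -1) ∧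
        ∑ i, b i * (if ε i then (1 : ℝ) else -1) < x + δ)).card : ℝ) / 2 ^ l ≤
      (1 : ℝ) / 4 := by
  obtain ⟨m, rfl⟩ : ∃ m, l = m + 2 := ⟨l - 2, by omega⟩
  have h_card : (Finset.univ.filter (fun ε : Fin (m + 2) → Bool =>
      x - δ < ∑ i, b i * (if ε i then (1 : ℝ) else -1) ∧
      ∑ i, b i * (if ε i then (1 : ℝ) else -1) < x + δ)).card ≤ 2 ^ m := by
    have h_univ : (Finset.univ : Finset (Fin m → Bool)).card = 2 ^ m := by simp
    rw [← h_univ]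
    refine Finset.card_le_card_of_injOn (fun ε i => ε i.succ.succ) (by simp) ?_
    intro ε hε η hη h_tail
    have h_eq : ∀ i : Fin m, ε i.succ.succ = η i.succ.succ := congrFun h_tail
    simp only [Finset.coe_filter, Finset.mem_univ, true_and, Set.mem_ofPred_eq,
      Fin.sum_univ_succ, h_eq] at hε hη
    obtain ⟨h₁, h₂⟩ := hε
    obtain ⟨h₃, h₄⟩ := hη
    change δ ≤ b 0 at hb1
    change δ ≤ b (Fin.succ 0) at hb2
    change δ ≤ |b 0 - b (Fin.succ 0)| at hdiff
    have h_head := signs_eq_of_mem_interval hb1 hb2 hdiff h₁ h₂ h₃ h₄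
    funext i
    exact Fin.cases h_head.1 (fun j => Fin.cases h_head.2 h_eq j) i
  rw [div_le_iff₀ (by positivity)]
  calc _ ≤ ((2 ^ m : ℕ) : ℝ) := by exact_mod_cast h_card
    _ = 1 / 4 * 2 ^ (m + 2) := by push_cast; ring
end

section
/- Let δ > 0 and let c_1 ≥ c_2 ≥ c_3 ≥ δ be real numbers such that c_1 - c_2 ≥ δ, c_2 - c_3 ≥ δ and |c_1 - c_2 - c_3| ≥ δ. Then for every real number x and all real numbers c_4, ..., c_m, the Rademacher sum S = Σ_{i=1}^m c_i ε_i satisfies Pr[S ∈ (x - δ, x + δ)] ≤ 1/8. -/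
open Finset

/-- **Observation (three separated large weights give anti-concentration 1/8).**
Fix `δ > 0` and `c_1 ≥ c_2 ≥ c_3 ≥ δ` with `c_1 - c_2 ≥ δ`, `c_2 - c_3 ≥ δ` and
`|c_1 - c_2 - c_3| ≥ δ`. Then for any `x` and any further weights `c_4, ..., c_m`, the
Rademacher sum `S = Σ_{i=1}^m c_i ε_i` satisfies `Pr[S ∈ (x - δ, x + δ)] ≤ 1/8`.
(Indices are 0-based: `c_1, c_2, c_3` are `c ⟨0,_⟩, c ⟨1,_⟩, c ⟨2,_⟩`.) -/
theorem rademacher_interval_prob_le_eighth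
    (m : ℕ) (hm : 3 ≤ m) (δ : ℝ) (hδ : 0 < δ) (c : Fin m → ℝ)
    (h3 : δ ≤ c ⟨2, by omega⟩)
    (h32 : c ⟨2, by omega⟩ ≤ c ⟨1, by omega⟩)
    (h21 : c ⟨1, by omega⟩ ≤ c ⟨0, by omega⟩)
    (hd12 : δ ≤ c ⟨0, by omega⟩ - c ⟨1, by omega⟩)
    (hd23 : δ ≤ c ⟨1, by omega⟩ - c ⟨2, by omega⟩)
    (hd123 : δ ≤ |c ⟨0, by omega⟩ - c ⟨1, by omega⟩ - c ⟨2, by omega⟩|)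
    (x : ℝ) :
    ((Finset.univ.filter (fun ε : Fin m → Bool =>
        x - δ < ∑ i, c i * (if ε i then (1 : ℝ) else -1) ∧
        ∑ i, c i * (if ε i then (1 : ℝ) else -1) < x + δ)).card : ℝ) / 2 ^ m ≤
      (1 : ℝ) / 8 := by
  obtain ⟨n, rfl⟩ := Nat.exists_eq_add_of_le' hm
  change δ ≤ c 2 at h3
  change c 2 ≤ c 1 at h32
  change c 1 ≤ c 0 at h21
  change δ ≤ c 0 - c 1 at hd12
  change δ ≤ c 1 - c 2 at hd23
  change δ ≤ |c 0 - c 1 - c 2| at hd123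
  have hsum : ∀ ε : Fin (n + 3) → Bool, ∑ i, c i * (if ε i then (1 : ℝ) else -1) =
      c 0 * (if ε 0 then (1 : ℝ) else -1) + c 1 * (if ε 1 then (1 : ℝ) else -1) +
        c 2 * (if ε 2 then (1 : ℝ) else -1) +
        ∑ i : Fin n, c i.succ.succ.succ * (if ε i.succ.succ.succ then (1 : ℝ) else -1) := by
    intro ε
    rw [Fin.sum_univ_succ, Fin.sum_univ_succ, Fin.sum_univ_succ, ← add_assoc, ← add_assoc]
    rfl
  have hcard : (univ.filter (fun ε : Fin (n + 3) → Bool =>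
      x - δ < ∑ i, c i * (if ε i then (1 : ℝ) else -1) ∧
      ∑ i, c i * (if ε i then (1 : ℝ) else -1) < x + δ)).card ≤ 2 ^ n := by
    have hn : (univ : Finset (Fin n → Bool)).card = 2 ^ n := by simp
    rw [← hn]
    refine card_le_card_of_injOn (fun ε i => ε i.succ.succ.succ) (fun _ _ => mem_univ _) ?_
    intro ε hε ε' hε' htail
    have htail' : ∀ i : Fin n, ε i.succ.succ.succ = ε' i.succ.succ.succ := congrFun htail
    simp only [coe_filter, mem_univ, true_and, Set.mem_ofPred_eq, hsum, htail'] at hε hε'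
    obtain ⟨hl, hu⟩ := hε
    obtain ⟨hl', hu'⟩ := hε'
    have hhead : ε 0 = ε' 0 ∧ ε 1 = ε' 1 ∧ ε 2 = ε' 2 := by
      generalize ∑ i : Fin n, c i.succ.succ.succ *
        (if ε' i.succ.succ.succ then (1 : ℝ) else -1) = t at *
      rcases le_abs.mp hd123 with h | h <;>
        cases h0 : ε 0 <;> cases h1 : ε 1 <;> cases h2 : ε 2 <;>
        cases h0' : ε' 0 <;> cases h1' : ε' 1 <;> cases h2' : ε' 2 <;>
        simp only [h0, h1, h2, h0', h1', h2', if_true, if_false, Bool.false_eq_true]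
          at hl hu hl' hu' <;>
        first
          | exact ⟨rfl, rfl, rfl⟩
          | (exfalso; linarith)
    funext i
    refine Fin.cases hhead.1 (fun i => ?_) i
    refine Fin.cases hhead.2.1 (fun i => ?_) i
    exact Fin.cases hhead.2.2 htail' i
  rw [div_le_iff₀ (by positivity), pow_add]
  have hcard' := (Nat.cast_le (α := ℝ)).mpr hcard
  push_cast at hcard'
  linarith
end

section
/- Let α > 0 and c > 1 be real numbers, and let b_1, ..., b_k be positive reals with Σ_{i=1}^k b_i^2 ≥ c α^2. Let ε_1, ..., ε_k be independent random signs, each uniform on {-1, +1}, and define the stopped random walk W_0 = 0 and, for 0 ≤ j < k, W_{j+1} = W_j if |W_j| ≥ α, and W_{j+1} = W_j + b_{j+1} ε_{j+1} otherwise. Then Pr[|W_k| ≥ α] ≥ (c - 1)/(c + 3). -/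
open Finset

/-- The potential of a walk at position `x` with accumulated variance `T`; it vanishes once the walk
has left `(-α, α)`. -/
noncomputable def walkPotential (α T x : ℝ) : ℝ :=
  if α ≤ |x| then 0 else T + 4 * α ^ 2 - x ^ 2

lemma walkPotential_of_le {α x : ℝ} (T : ℝ) (h : α ≤ |x|) : walkPotential α T x = 0 :=
  if_pos h

lemma walkPotential_of_lt {α x : ℝ} (T : ℝ) (h : |x| < α) :
    walkPotential α T x = T + 4 * α ^ 2 - x ^ 2 :=
  if_neg (not_le.2 h)

lemma two_mul_mul_add_sq_le {α b w : ℝ} (hb : 0 < b) (hw : |w| < α) (h : |w - b| < α) :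
    2 * w * b + w ^ 2 ≤ 5 * α ^ 2 ∧ 2 * w * b - w ^ 2 ≤ 3 * α ^ 2 ∧
      (b ≤ α → 2 * w * b + w ^ 2 ≤ 3 * α ^ 2) := by
  rw [abs_lt] at hw h
  have hsq : w ^ 2 ≤ α ^ 2 := by nlinarith
  rcases le_total w 0 with h0 | h0
  · have : w * b ≤ 0 := mul_nonpos_of_nonpos_of_nonneg h0 hb.le
    refine ⟨?_, ?_, fun _ => ?_⟩ <;> nlinarith [sq_nonneg w]
  · have h1 : w * b ≤ w * (α + w) := mul_le_mul_of_nonneg_left (by linarith) h0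
    have h2 : w * α ≤ α * α := mul_le_mul_of_nonneg_right hw.2.le (by linarith)
    refine ⟨by nlinarith, by nlinarith, fun hbα => ?_⟩
    have : w * b ≤ w * α := mul_le_mul_of_nonneg_left hbα h0
    nlinarith

lemma walkPotential_add_le_two_mul {α T b w : ℝ} (hT : 0 ≤ T) (hb : 0 < b) (hw : |w| < α)
    (h : α ^ 2 ≤ T ∨ b ≤ α) :
    walkPotential α (T + b ^ 2) (w + b) + walkPotential α (T + b ^ 2) (w - b) ≤
      2 * walkPotential α T w := by
  have hsq : w ^ 2 ≤ α ^ 2 := sq_le_sq' (abs_lt.1 hw).1.le (abs_lt.1 hw).2.le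
  have key : ∀ v : ℝ, |v| < α → |v - b| < α → 2 * v * b + v ^ 2 ≤ T + 4 * α ^ 2 := by
    intro v hv hvb
    obtain ⟨h5, -, h3⟩ := two_mul_mul_add_sq_le hb hv hvb
    rcases h with h | h
    · linarith
    · nlinarith [h3 h, sq_nonneg α]
  rw [walkPotential_of_lt T hw]
  rcases le_or_gt α |w + b| with hp | hp <;> rcases le_or_gt α |w - b| with hm | hm
  · rw [walkPotential_of_le _ hp, walkPotential_of_le _ hm]
    nlinarith [sq_nonneg α]
  · rw [walkPotential_of_le _ hp, walkPotential_of_lt _ hm]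
    linarith [key w hw hm]
  · rw [walkPotential_of_lt _ hp, walkPotential_of_le _ hm]
    have := key (-w) (by rwa [abs_neg]) (by rwa [← abs_neg, neg_sub, sub_neg_eq_add, add_comm])
    linarith
  · rw [walkPotential_of_lt _ hp, walkPotential_of_lt _ hm]
    linarith

lemma walkPotential_add_le_eight_mul {α T b w : ℝ} (hT : T ≤ α ^ 2) (hb : α < b)
    (hw : |w| < α) :
    walkPotential α (T + b ^ 2) (w + b) + walkPotential α (T + b ^ 2) (w - b) ≤ 8 * α ^ 2 := by
  have hb0 : 0 < b := (abs_nonneg w).trans_lt (hw.trans hb)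
  rcases le_or_gt α |w + b| with hp | hp <;> rcases le_or_gt α |w - b| with hm | hm
  · rw [walkPotential_of_le _ hp, walkPotential_of_le _ hm]
    nlinarith [sq_nonneg α]
  · rw [walkPotential_of_le _ hp, walkPotential_of_lt _ hm]
    linarith [(two_mul_mul_add_sq_le hb0 hw hm).2.1]
  · rw [walkPotential_of_lt _ hp, walkPotential_of_le _ hm]
    have := (two_mul_mul_add_sq_le hb0 (w := -w) (by rwa [abs_neg])
      (by rwa [← abs_neg, neg_sub, sub_neg_eq_add, add_comm])).2.1
    linarith
  · rw [abs_lt] at hp hm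
    linarith

lemma stoppedWalk_congr {k : ℕ} {α : ℝ} {b : Fin k → ℝ} {W : (Fin k → Bool) → ℕ → ℝ}
    (hW0 : ∀ ε, W ε 0 = 0)
    (hWs : ∀ ε, ∀ j : Fin k, W ε ((j : ℕ) + 1) =
      if α ≤ |W ε (j : ℕ)| then W ε (j : ℕ)
      else W ε (j : ℕ) + b j * (if ε j then (1 : ℝ) else -1))
    {ε ε' : Fin k → Bool} {n : ℕ} (hn : n ≤ k) (h : ∀ i : Fin k, (i : ℕ) < n → ε i = ε' i) :
    W ε n = W ε' n := by
  induction n with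
  | zero => rw [hW0, hW0]
  | succ n ih =>
    have hp := ih (by omega) fun i hi => h i (by omega)
    have e := hWs ε ⟨n, hn⟩
    have e' := hWs ε' ⟨n, hn⟩
    rw [h ⟨n, hn⟩ (Nat.lt_succ_self n)] at e
    simp only at e e'
    rw [e, e', hp]

/-- Sums over sign vectors can be compared on pairs of vectors differing in one coordinate. -/
lemma sum_le_sum_of_flip {k : ℕ} (j : Fin k) (F G : (Fin k → Bool) → ℝ)
    (h : ∀ ε, F ε + F (Function.update ε j (!ε j)) ≤ 2 * G ε) : ∑ ε, F ε ≤ ∑ ε, G ε := by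
  have hinv : Function.Involutive fun ε : Fin k → Bool => Function.update ε j (!ε j) := by
    intro ε
    simp
  have hflip : ∑ ε, F (Function.update ε j (!ε j)) = ∑ ε, F ε :=
    Equiv.sum_comp hinv.toPerm F
  have := Finset.sum_le_sum fun ε (_ : ε ∈ Finset.univ) => h ε
  rw [Finset.sum_add_distrib, hflip, ← Finset.mul_sum] at this
  linarith

lemma stoppedWalk_flip_potential {k : ℕ} {α : ℝ} {b : Fin k → ℝ} {W : (Fin k → Bool) → ℕ → ℝ}
    (hW0 : ∀ ε, W ε 0 = 0)
    (hWs : ∀ ε, ∀ j : Fin k, W ε ((j : ℕ) + 1) =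
      if α ≤ |W ε (j : ℕ)| then W ε (j : ℕ)
      else W ε (j : ℕ) + b j * (if ε j then (1 : ℝ) else -1))
    (T : ℝ) (j : Fin k) (ε : Fin k → Bool) :
    walkPotential α T (W ε (j + 1)) +
        walkPotential α T (W (Function.update ε j (!ε j)) (j + 1)) =
      if α ≤ |W ε j| then 0
      else walkPotential α T (W ε j + b j) + walkPotential α T (W ε j - b j) := by
  have hc : W (Function.update ε j (!ε j)) j = W ε j :=
    stoppedWalk_congr hW0 hWs j.2.le fun i hi => by
      rw [Function.update_of_ne (Fin.ne_of_lt hi)]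
  rw [hWs, hWs, hc, Function.update_self]
  by_cases h : α ≤ |W ε j|
  · simp only [if_pos h, walkPotential_of_le _ h, add_zero]
  · simp only [if_neg h]
    cases ε j <;> simp [← sub_eq_add_neg, add_comm]

lemma sum_walkPotential_le {k : ℕ} {α : ℝ} {b : Fin k → ℝ} (hb : ∀ i, 0 < b i)
    {W : (Fin k → Bool) → ℕ → ℝ} (hα : 0 < α)
    (hW0 : ∀ ε, W ε 0 = 0)
    (hWs : ∀ ε, ∀ j : Fin k, W ε ((j : ℕ) + 1) =
      if α ≤ |W ε (j : ℕ)| then W ε (j : ℕ)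
      else W ε (j : ℕ) + b j * (if ε j then (1 : ℝ) else -1))
    {T : ℕ → ℝ} (hT0 : T 0 = 0) (hTs : ∀ j : Fin k, T (j + 1) = T j + b j ^ 2)
    {n : ℕ} (hn : n ≤ k) :
    0 ≤ T n ∧ ∑ ε, walkPotential α (T n) (W ε n) ≤ ∑ _ε : Fin k → Bool, 4 * α ^ 2 := by
  induction n with
  | zero =>
    refine ⟨hT0.ge, Finset.sum_le_sum fun ε _ => ?_⟩
    rw [walkPotential_of_lt _ (by rwa [hW0, abs_zero]), hT0, hW0]
    simp
  | succ n ih =>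
    obtain ⟨hT, hS⟩ := ih (by omega)
    obtain ⟨j, rfl⟩ : ∃ j : Fin k, (j : ℕ) = n := ⟨⟨n, hn⟩, rfl⟩
    rw [hTs]
    refine ⟨by positivity, ?_⟩
    have hflip := stoppedWalk_flip_potential hW0 hWs (T j + b j ^ 2) j
    by_cases h : α ^ 2 ≤ T j ∨ b j ≤ α
    · refine le_trans (sum_le_sum_of_flip j _ _ fun ε => ?_) hS
      rw [hflip]
      split_ifs with hs
      · rw [walkPotential_of_le _ hs, mul_zero]
      · exact walkPotential_add_le_two_mul hT (hb j) (not_le.1 hs) h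
    · push Not at h
      refine sum_le_sum_of_flip j _ _ fun ε => ?_
      rw [hflip]
      split_ifs with hs
      · positivity
      · linarith [walkPotential_add_le_eight_mul h.1.le h.2 (not_le.1 hs)]

/-- **Lemma (success probability of a stopped random walk).**
Let `α > 0`, `c > 1`, and let `b_1, ..., b_k > 0` satisfy `Σ b_i² ≥ c α²`. For each sign
vector `ε ∈ {-1,1}^k` (modelled as `Fin k → Bool`), define the stopped random walk by
`W_0 = 0` and `W_{j+1} = W_j` if `|W_j| ≥ α`, and `W_{j+1} = W_j + b_{j+1} ε_{j+1}`
otherwise. Then `Pr[|W_k| ≥ α] ≥ (c - 1)/(c + 3)` (uniform measure on sign vectors). -/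
theorem stopped_walk_success_prob
    (k : ℕ) (α c : ℝ) (hα : 0 < α) (hc : 1 < c)
    (b : Fin k → ℝ) (hb : ∀ i, 0 < b i)
    (hsum : c * α ^ 2 ≤ ∑ i, b i ^ 2)
    (W : (Fin k → Bool) → ℕ → ℝ)
    (hW0 : ∀ ε, W ε 0 = 0)
    (hWs : ∀ ε, ∀ j : Fin k, W ε ((j : ℕ) + 1) =
      if α ≤ |W ε (j : ℕ)| then W ε (j : ℕ)
      else W ε (j : ℕ) + b j * (if ε j then (1 : ℝ) else -1)) :
    (c - 1) / (c + 3) ≤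
      ((Finset.univ.filter (fun ε : Fin k → Bool => α ≤ |W ε k|)).card : ℝ) / 2 ^ k := by
  let T : ℕ → ℝ := fun n => ∑ i ∈ Finset.range n, if h : i < k then b ⟨i, h⟩ ^ 2 else 0
  have hTs : ∀ j : Fin k, T (j + 1) = T j + b j ^ 2 := fun j => by
    simp [T, Finset.sum_range_succ]
  have hTk : T k = ∑ i, b i ^ 2 := by
    simp [T, Finset.sum_range]
  have hS := (sum_walkPotential_le hb hα hW0 hWs (T := T) (by simp [T]) hTs le_rfl).2
  rw [hTk] at hS
  set p := (Finset.univ.filter fun ε : Fin k → Bool => α ≤ |W ε k|).card with hp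
  have hlow : ∑ ε : Fin k → Bool, (if α ≤ |W ε k| then 0 else (c + 3) * α ^ 2) ≤
      ∑ ε, walkPotential α (∑ i, b i ^ 2) (W ε k) := by
    refine Finset.sum_le_sum fun ε _ => ?_
    split_ifs with h
    · rw [walkPotential_of_le _ h]
    · rw [not_le] at h
      rw [walkPotential_of_lt _ h]
      have := sq_le_sq' (abs_lt.1 h).1.le (abs_lt.1 h).2.le
      linarith
  have hcard : (p : ℝ) + (Finset.univ.filter fun ε : Fin k → Bool => ¬ α ≤ |W ε k|).card =
      2 ^ k := by
    rw [hp]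
    exact_mod_cast (Finset.card_filter_add_card_filter_not _).trans (by simp)
  have h := hlow.trans hS
  rw [Finset.sum_ite, Finset.sum_const_zero, zero_add, Finset.sum_const, Finset.sum_const,
    nsmul_eq_mul, nsmul_eq_mul, eq_sub_iff_add_eq'.2 hcard] at h
  simp only [Finset.card_univ, Fintype.card_fun, Fintype.card_bool, Fintype.card_fin,
    Nat.cast_pow, Nat.cast_ofNat] at h
  have hα2 : 0 < α ^ 2 := by positivity
  have h' : (2 ^ k - (p : ℝ)) * (c + 3) ≤ 2 ^ k * 4 :=
    le_of_mul_le_mul_right (by linarith) hα2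
  rw [div_le_div_iff₀ (by linarith) (by positivity)]
  linarith
end

section
/- Let n ≥ 4 and let a_1 ≥ a_2 ≥ ... ≥ a_n > 0 be reals with Σ_{i=1}^n a_i^2 = 1, a_1 + a_2 + a_3 ≤ 1 and a_3 ≥ 0.325. Let Y = Σ_{i=4}^n a_i ε_i with ε_4, ..., ε_n independent uniform random signs, and set q_1 = Pr[|Y| ≥ 1 - a_1 - a_2 - a_3], q_2 = Pr[|Y| ≥ 1 - a_1 - a_2 + a_3], q_3 = Pr[|Y| ≥ 1 - a_1 + a_2 - a_3]. Then at least one of the following holds: (i) a_4 ≤ 7/40; (ii) q_1 ≥ 793/1024; (iii) both q_2 ≥ 37/128 and q_3 ≥ 37/128. -/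
open Finset

/-- The average of `g (x + ∑ ± aᵢ)` over all choices of signs, for `a` running over a list. -/
noncomputable def signAvg : List ℝ → (ℝ → ℝ) → ℝ → ℝ
  | [], g, x => g x
  | a :: L, g, x => (signAvg L g (x + a) + signAvg L g (x - a)) / 2

lemma signAvg_append (L₁ L₂ : List ℝ) (g : ℝ → ℝ) (x : ℝ) :
    signAvg (L₁ ++ L₂) g x = signAvg L₁ (signAvg L₂ g) x := by
  induction L₁ generalizing x with
  | nil => rfl
  | cons a L ih => simp [signAvg, ih]

lemma signAvg_perm {L₁ L₂ : List ℝ} (h : L₁.Perm L₂) (g : ℝ → ℝ) (x : ℝ) :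
    signAvg L₁ g x = signAvg L₂ g x := by
  induction h generalizing x with
  | nil => rfl
  | cons a _ ih => simp [signAvg, ih]
  | swap a b L =>
    simp only [signAvg]
    rw [show x + b + a = x + a + b by ring, show x + b - a = x - a + b by ring,
      show x - b + a = x + a - b by ring, show x - b - a = x - a - b by ring]
    ring
  | trans _ _ ih₁ ih₂ => rw [ih₁, ih₂]

lemma signAvg_mono (L : List ℝ) {g h : ℝ → ℝ} (hgh : ∀ y, g y ≤ h y) (x : ℝ) :
    signAvg L g x ≤ signAvg L h x := by
  induction L generalizing x with
  | nil => exact hgh x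
  | cons a L ih => simp only [signAvg]; linarith [ih (x + a), ih (x - a)]

lemma signAvg_affine (L : List ℝ) (g : ℝ → ℝ) (α β x : ℝ) :
    signAvg L (fun y => α + β * g y) x = α + β * signAvg L g x := by
  induction L generalizing x with
  | nil => rfl
  | cons a L ih => simp only [signAvg, ih]; ring

lemma signAvg_add (L : List ℝ) (g h : ℝ → ℝ) (x : ℝ) :
    signAvg L (fun y => g y + h y) x = signAvg L g x + signAvg L h x := by
  induction L generalizing x with
  | nil => rfl
  | cons a L ih => simp only [signAvg, ih]; ring

lemma signAvg_comp_neg (L : List ℝ) (g : ℝ → ℝ) (x : ℝ) :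
    signAvg L (fun y => g (-y)) x = signAvg L g (-x) := by
  induction L generalizing x with
  | nil => rfl
  | cons a L ih =>
    simp only [signAvg, ih]
    rw [show -(x + a) = -x - a by ring, show -(x - a) = -x + a by ring]
    ring

lemma signAvg_le_const (L : List ℝ) {g : ℝ → ℝ} {C : ℝ} (h : ∀ y, g y ≤ C) (x : ℝ) :
    signAvg L g x ≤ C := by
  induction L generalizing x with
  | nil => exact h x
  | cons a L ih => simp only [signAvg]; linarith [ih (x + a), ih (x - a)]

lemma signAvg_nonneg (L : List ℝ) {g : ℝ → ℝ} (h : ∀ y, 0 ≤ g y) (x : ℝ) :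
    0 ≤ signAvg L g x := by
  induction L generalizing x with
  | nil => exact h x
  | cons a L ih => simp only [signAvg]; linarith [ih (x + a), ih (x - a)]

lemma signAvg_sq (L : List ℝ) (x : ℝ) :
    signAvg L (fun y => y ^ 2) x = x ^ 2 + (L.map (· ^ 2)).sum := by
  induction L generalizing x with
  | nil => simp [signAvg]
  | cons a L ih => simp only [signAvg, ih, List.map_cons, List.sum_cons]; ring

lemma signAvg_append_le_of_le_quadratic {S B : List ℝ} {g : ℝ → ℝ} {α β : ℝ}
    (h : ∀ z, signAvg B g z ≤ α + β * z ^ 2) :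
    signAvg (S ++ B) g 0 ≤ α + β * (S.map (· ^ 2)).sum := by
  rw [signAvg_append]
  refine (signAvg_mono S h 0).trans ?_
  rw [signAvg_affine, signAvg_sq]
  simp

lemma le_signAvg_append_of_quadratic_le {S B : List ℝ} {g : ℝ → ℝ} {α β : ℝ}
    (h : ∀ z, α + β * z ^ 2 ≤ signAvg B g z) :
    α + β * (S.map (· ^ 2)).sum ≤ signAvg (S ++ B) g 0 := by
  rw [signAvg_append]
  refine le_trans ?_ (signAvg_mono S h 0)
  rw [signAvg_affine, signAvg_sq]
  simp

/-- Indicator of the open interval `(-t, t)`. -/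
noncomputable def near (t x : ℝ) : ℝ := if |x| < t then 1 else 0

/-- Indicator of `t ≤ |x|`. -/
noncomputable def far (t x : ℝ) : ℝ := if t ≤ |x| then 1 else 0

/-- Indicator of `[y, ∞)`. -/
noncomputable def above (y x : ℝ) : ℝ := if y ≤ x then 1 else 0

lemma near_nonneg (t x : ℝ) : 0 ≤ near t x := by unfold near; split_ifs <;> norm_num

lemma near_le_one (t x : ℝ) : near t x ≤ 1 := by unfold near; split_ifs <;> norm_num

lemma above_nonneg (t x : ℝ) : 0 ≤ above t x := by unfold above; split_ifs <;> norm_num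

lemma far_eq_one_sub_near (t x : ℝ) : far t x = 1 + (-1) * near t x := by
  unfold far near
  split_ifs <;> linarith

lemma far_eq_above {t : ℝ} (ht : 0 < t) (x : ℝ) : far t x = above t x + above t (-x) := by
  unfold far above
  rcases le_total 0 x with h | h
  · rw [abs_of_nonneg h, if_neg (by linarith : ¬ t ≤ -x), add_zero]
  · rw [abs_of_nonpos h, if_neg (by linarith : ¬ t ≤ x), zero_add]

lemma signAvg_far (L : List ℝ) (t x : ℝ) :
    signAvg L (far t) x = 1 - signAvg L (near t) x := by
  rw [show far t = fun y => 1 + (-1) * near t y from funext (far_eq_one_sub_near t),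
    signAvg_affine]
  ring

lemma signAvg_far_eq_above (L : List ℝ) {t : ℝ} (ht : 0 < t) (x : ℝ) :
    signAvg L (far t) x = signAvg L (above t) x + signAvg L (above t) (-x) := by
  rw [show far t = fun y => above t y + above t (-y) from funext (far_eq_above ht),
    signAvg_add, signAvg_comp_neg]

lemma signAvg_far_neg (L : List ℝ) (t x : ℝ) :
    signAvg L (far t) (-x) = signAvg L (far t) x := by
  rw [← signAvg_comp_neg]
  exact congrArg (fun g => signAvg L g x) (funext fun y => by simp [far])

/-! ### Anticoncentration -/

/-- The sum of the `r` largest binomial coefficients `m.choose j`. -/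
def middleSum : ℕ → ℕ → ℕ
  | 0, r => min r 1
  | _ + 1, 0 => 0
  | m + 1, r + 1 => middleSum m (r + 2) + middleSum m r

lemma sum_near_le {t : ℝ} (l : List ℝ)
    (hl : l.Pairwise (fun x y => x + 2 * t ≤ y)) :
    (l.map (near t)).sum ≤ (min l.length 1 : ℕ) := by
  induction l with
  | nil => simp
  | cons c l ih =>
    rw [List.pairwise_cons] at hl
    have hone : min (c :: l).length 1 = 1 := by simp
    rw [hone, List.map_cons, List.sum_cons]
    have ih' := (ih hl.2).trans (by exact_mod_cast min_le_right _ _ :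
      ((min l.length 1 : ℕ) : ℝ) ≤ ((1 : ℕ) : ℝ))
    by_cases hc : |c| < t
    · have hz : (l.map (near t)).sum = 0 := by
        apply List.sum_eq_zero
        intro v hv
        obtain ⟨y, hy, rfl⟩ := List.mem_map.1 hv
        have h1 := hl.1 y hy
        have h2 := (abs_lt.1 hc).1
        exact if_neg (fun h => by linarith [(abs_lt.1 h).2])
      rw [hz, add_zero]
      exact_mod_cast near_le_one t c
    · rw [near, if_neg hc, zero_add]
      exact ih'

/-- A form of the Littlewood–Offord–Erdős inequality for several separated windows. -/
lemma sum_signAvg_near_le {t : ℝ} (ht : 0 < t) (B : List ℝ) (hB : ∀ b ∈ B, t ≤ b) (l : List ℝ)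
    (hl : l.Pairwise (fun x y => x + 2 * t ≤ y)) :
    (l.map (signAvg B (near t))).sum ≤ middleSum B.length l.length / 2 ^ B.length := by
  induction B generalizing l with
  | nil =>
    have := sum_near_le l hl
    simpa [middleSum, signAvg, Function.comp_def] using this
  | cons b B ih =>
    have hb : t ≤ b := hB b (by simp)
    have ih := ih (fun b' h => hB b' (by simp [h]))
    cases l with
    | nil => simp [middleSum]
    | cons c l =>
      rw [List.pairwise_cons] at hl
      have up := ih ((c - b) :: (c + b) :: l.map (· + b)) (by
        simp only [List.pairwise_cons, List.mem_cons, List.mem_map, List.pairwise_map]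
        refine ⟨?_, ?_, hl.2.imp (by intros; linarith)⟩
        · rintro y (rfl | ⟨y, hy, rfl⟩)
          · linarith
          · have := hl.1 y hy
            linarith
        · rintro y ⟨y, hy, rfl⟩
          linarith [hl.1 y hy])
      have down := ih (l.map (· - b)) (by
        rw [List.pairwise_map]
        exact hl.2.imp (by intros; linarith))
      have key : ((c :: l).map (signAvg (b :: B) (near t))).sum =
          ((((c - b) :: (c + b) :: l.map (· + b)).map (signAvg B (near t))).sum +
            ((l.map (· - b)).map (signAvg B (near t))).sum) / 2 := by
        have h : ∀ l : List ℝ, (l.map (signAvg (b :: B) (near t))).sum =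
            (((l.map (· + b)).map (signAvg B (near t))).sum +
              ((l.map (· - b)).map (signAvg B (near t))).sum) / 2 := by
          intro l
          induction l with
          | nil => simp
          | cons y l ih => 
            rw [List.map_cons, List.sum_cons, ih]
            simp only [List.map_cons, List.sum_cons, signAvg]
            ring
        rw [List.map_cons, List.sum_cons, h]
        simp only [List.map_cons, List.sum_cons, signAvg]
        ring
      rw [key]
      simp only [List.length_cons, List.length_map] at up down ⊢
      rw [middleSum, pow_succ]
      push_cast
      have e : ((middleSum B.length (l.length + 2) : ℝ) + middleSum B.length l.length) /
          (2 ^ B.length * 2) = (middleSum B.length (l.length + 1 + 1) / 2 ^ B.length +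
            middleSum B.length l.length / 2 ^ B.length) / 2 := by
        field_simp
      rw [e]
      linarith

lemma signAvg_near_le {t : ℝ} (ht : 0 < t) (B : List ℝ) (hB : ∀ b ∈ B, t ≤ b) (x : ℝ) :
    signAvg B (near t) x ≤ middleSum B.length 1 / 2 ^ B.length := by
  simpa using sum_signAvg_near_le ht B hB [x] (by simp)

lemma signAvg_near_le_of_le_length {t : ℝ} (ht : 0 < t) (B : List ℝ) (hB : ∀ b ∈ B, t ≤ b) {m : ℕ}
    (hm : m ≤ B.length) (x : ℝ) :
    signAvg B (near t) x ≤ middleSum m 1 / 2 ^ m := by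
  rw [signAvg_perm (L₂ := B.drop m ++ B.take m)
    (by conv_lhs => rw [← List.take_append_drop m B]
        exact List.perm_append_comm), signAvg_append]
  refine signAvg_le_const _ (fun y => ?_) x
  have := signAvg_near_le ht (B.take m) (fun b hb => hB b (List.mem_of_mem_take hb)) y
  rwa [List.length_take, min_eq_left hm] at this

/-- Anticoncentration when two of the weights differ by at least `t`. -/
lemma signAvg_near_le_of_pair {t b b' : ℝ} (ht : 0 < t) (V : List ℝ) (hV : ∀ v ∈ V, t ≤ v) (hb' : t ≤ b')
    (hbb' : t ≤ b - b') (x : ℝ) :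
    signAvg (b :: b' :: V) (near t) x ≤
      middleSum V.length 4 / 2 ^ V.length / 4 := by
  have h := sum_signAvg_near_le ht V hV [x - b - b', x - b + b', x + b - b', x + b + b'] (by
    simp only [List.pairwise_cons, List.mem_cons, List.not_mem_nil, or_false, forall_eq_or_imp,
      forall_eq, false_imp_iff, implies_true, List.Pairwise.nil, and_true]
    refine ⟨⟨?_, ?_, ?_⟩, ⟨?_, ?_⟩, ?_⟩ <;> linarith)
  simp only [List.map_cons, List.map_nil, List.sum_cons, List.sum_nil, List.length_cons,
    List.length_nil] at h
  simp only [signAvg]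
  norm_num at h
  linarith

/-- Anticoncentration when two disjoint pairs of weights differ by at least `t`. -/
lemma signAvg_near_le_of_two_pairs {t b b' c c' : ℝ} (ht : 0 < t) (V : List ℝ)
    (hV : ∀ v ∈ V, t ≤ v) (hb' : t ≤ b') (hbb' : t ≤ b - b') (hc' : t ≤ c') (hcc' : t ≤ c - c') (x : ℝ) :
    signAvg (b :: b' :: c :: c' :: V) (near t) x ≤
      (middleSum V.length 7 + middleSum V.length 5 + middleSum V.length 3 +
        middleSum V.length 1) / 2 ^ V.length / 16 := by
  have h₁ := sum_signAvg_near_le ht V hV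
    [x - b - b' - c - c', x - b - b' - c + c', x - b - b' + c - c', x - b - b' + c + c',
      x - b + b' + c + c', x + b - b' + c + c', x + b + b' + c + c'] (by
    simp only [List.pairwise_cons, List.mem_cons, List.not_mem_nil, or_false, forall_eq_or_imp,
      forall_eq, false_imp_iff, implies_true, List.Pairwise.nil, and_true]
    refine ⟨⟨?_, ?_, ?_, ?_, ?_, ?_⟩, ⟨?_, ?_, ?_, ?_, ?_⟩, ⟨?_, ?_, ?_, ?_⟩, ⟨?_, ?_, ?_⟩,
      ⟨?_, ?_⟩, ?_⟩ <;> linarith)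
  have h₂ := sum_signAvg_near_le ht V hV
    [x - b + b' - c - c', x - b + b' - c + c', x - b + b' + c - c', x + b - b' + c - c',
      x + b + b' + c - c'] (by
    simp only [List.pairwise_cons, List.mem_cons, List.not_mem_nil, or_false, forall_eq_or_imp,
      forall_eq, false_imp_iff, implies_true, List.Pairwise.nil, and_true]
    refine ⟨⟨?_, ?_, ?_, ?_⟩, ⟨?_, ?_, ?_⟩, ⟨?_, ?_⟩, ?_⟩ <;> linarith)
  have h₃ := sum_signAvg_near_le ht V hV
    [x + b - b' - c - c', x + b - b' - c + c', x + b + b' - c + c'] (by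
    simp only [List.pairwise_cons, List.mem_cons, List.not_mem_nil, or_false, forall_eq_or_imp,
      forall_eq, false_imp_iff, implies_true, List.Pairwise.nil, and_true]
    refine ⟨⟨?_, ?_⟩, ?_⟩ <;> linarith)
  have h₄ := signAvg_near_le ht V hV (x + b + b' - c - c')
  simp only [List.map_cons, List.map_nil, List.sum_cons, List.sum_nil, List.length_cons,
    List.length_nil] at h₁ h₂ h₃
  simp only [signAvg, add_div]
  norm_num at h₁ h₂ h₃
  linarith

/-- Anticoncentration when one weight is smaller than all others by at least `t`. -/
lemma signAvg_near_le_of_gap {t b : ℝ} (ht : 0 < t) (V : List ℝ) (hb : t ≤ b) (hV : ∀ v ∈ V, b + t ≤ v)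
    (x : ℝ) :
    signAvg (b :: V) (near t) x ≤ middleSum V.length 1 / 2 ^ V.length / 2 := by
  rw [signAvg_perm (L₂ := V ++ [b]) (List.perm_append_singleton b V).symm, signAvg_append]
  have h : ∀ y, signAvg [b] (near t) y ≤ 0 + 1 / 2 * near (b + t) y := by
    intro y
    simp only [signAvg]
    by_cases hy : |y| < b + t
    · have hne : ¬ (|y + b| < t ∧ |y - b| < t) := by
        rintro ⟨h₁, h₂⟩
        linarith [(abs_lt.1 h₁).2, (abs_lt.1 h₂).1]
      rw [near, near, near, if_pos hy]
      split_ifs with h₁ h₂ <;> first | exact absurd ⟨‹_›, ‹_›⟩ hne | norm_num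
    · rw [near, near, near, if_neg hy]
      have h₁ : ¬ |y + b| < t := fun h => hy (by
        rw [abs_lt] at h ⊢; constructor <;> linarith)
      have h₂ : ¬ |y - b| < t := fun h => hy (by
        rw [abs_lt] at h ⊢; constructor <;> linarith)
      rw [if_neg h₁, if_neg h₂]; norm_num
  refine (signAvg_mono V h x).trans ?_
  rw [signAvg_affine]
  linarith [signAvg_near_le (by linarith : 0 < b + t) V hV x]

/-! ### Many small weights -/

lemma signAvg_near_le_geometric {t : ℝ} (ht : 0 < t) (B : List ℝ) (hB : ∀ b ∈ B, t ≤ b) (x : ℝ) :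
    signAvg B (near t) x ≤ 1 / 5 + 83 / 100 * (3 / 4) ^ B.length := by
  by_cases h : 16 ≤ B.length
  · refine (signAvg_near_le_of_le_length ht B hB h x).trans ?_
    have : (0 : ℝ) ≤ (3 / 4) ^ B.length := by positivity
    have e : middleSum 16 1 = 12870 := by decide
    rw [e]
    norm_num
    linarith
  · refine (signAvg_near_le ht B hB x).trans ?_
    push Not at h
    generalize B.length = m at h
    interval_cases m <;> norm_num [middleSum]

lemma signAvg_cons_comm (a : ℝ) (L : List ℝ) (g : ℝ → ℝ) (x : ℝ) :
    signAvg (a :: L) g x = signAvg L (signAvg [a] g) x := by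
  rw [← signAvg_append]
  exact signAvg_perm (List.perm_append_singleton a L).symm g x

lemma signAvg_near_le_of_small {t : ℝ} (ht : 0 < t) (S : List ℝ)
    (hS : ∀ a ∈ S, 0 ≤ a ∧ a < t) (B : List ℝ) (hB : ∀ b ∈ B, t ≤ b) (w : ℝ) (hw : 0 ≤ w)
    (hwt : w < t) (x : ℝ) :
    signAvg (w :: S) (signAvg B (near t)) x ≤ 1 / 5 + 83 / 100 * (3 / 4) ^ B.length *
      (16 / 15 * ((1 - (w / t) ^ 2 / 16) * (S.map (fun a => 1 - (a / t) ^ 2 / 16)).prod)) := by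
  induction S generalizing B w x with
  | nil =>
    refine (signAvg_le_const _ (signAvg_near_le_geometric ht B hB) x).trans ?_
    have h₁ : (w / t) ^ 2 ≤ 1 := by
      rw [sq_le_one_iff₀ (by positivity), div_le_one ht]; exact hwt.le
    have h₂ : (0 : ℝ) ≤ 83 / 100 * (3 / 4) ^ B.length := by positivity
    simp only [List.map_nil, List.prod_nil, mul_one]
    have := le_mul_of_one_le_right h₂ (show 1 ≤ 16 / 15 * (1 - (w / t) ^ 2 / 16) by linarith)
    linarith
  | cons a S ih =>
    obtain ⟨ha, hat⟩ := hS a (by simp)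
    have hS' : ∀ a ∈ S, 0 ≤ a ∧ a < t := fun a h => hS a (by simp [h])
    have ih := ih hS'
    have split : signAvg (w :: a :: S) (signAvg B (near t)) x =
        (signAvg ((w + a) :: S) (signAvg B (near t)) x +
          signAvg (|w - a| :: S) (signAvg B (near t)) x) / 2 := by
      have habs : signAvg (|w - a| :: S) (signAvg B (near t)) x =
          signAvg ((w - a) :: S) (signAvg B (near t)) x := by
        rcases abs_choice (w - a) with h | h <;> rw [h]
        simp only [signAvg, sub_neg_eq_add, ← sub_eq_add_neg]
        ring
      rw [habs]
      simp only [signAvg]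
      rw [show x + (w - a) = x + w - a by ring, show x - (w - a) = x - w + a by ring,
        show x + (w + a) = x + w + a by ring, show x - (w + a) = x - w - a by ring]
      ring
    have hP : 0 ≤ (S.map (fun a => 1 - (a / t) ^ 2 / 16)).prod := by
      apply List.prod_nonneg
      intro v hv
      obtain ⟨y, hy, rfl⟩ := List.mem_map.1 hv
      have : (y / t) ^ 2 ≤ 1 := by
        rw [sq_le_one_iff₀ (div_nonneg (hS' y hy).1 ht.le), div_le_one ht]
        exact (hS' y hy).2.le
      linarith
    set P := (S.map (fun a => 1 - (a / t) ^ 2 / 16)).prod with hPdef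
    have hK : 0 ≤ 83 / 100 * (3 / 4 : ℝ) ^ B.length * (16 / 15 * P) := by positivity
    set K := 83 / 100 * (3 / 4 : ℝ) ^ B.length * (16 / 15 * P) with hKdef
    have diff := ih B hB |w - a| (abs_nonneg _) (abs_lt.2 ⟨by linarith, by linarith⟩) x
    rw [div_pow |w - a|, sq_abs, ← div_pow] at diff
    have sum : signAvg ((w + a) :: S) (signAvg B (near t)) x ≤
        1 / 5 + K * (1 - ((w + a) / t) ^ 2 / 16) := by
      by_cases h : w + a < t
      · refine (ih B hB (w + a) (by linarith) h x).trans (le_of_eq ?_)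
        rw [hKdef]; ring
      · have h1 := ih ((w + a) :: B) (by
          intro b hb
          rcases List.mem_cons.1 hb with rfl | hb
          · linarith
          · exact hB b hb) 0 le_rfl ht x
        have h2 : signAvg ((w + a) :: S) (signAvg B (near t)) x =
            signAvg (0 :: S) (signAvg ((w + a) :: B) (near t)) x := by
          rw [signAvg_cons_comm]
          simp [signAvg]
        rw [h2]
        refine h1.trans ?_
        have h3 : ((w + a) / t) ^ 2 ≤ 4 := by
          have : (w + a) / t ≤ 2 := by rw [div_le_iff₀ ht]; linarith
          have h0 : 0 ≤ (w + a) / t := by positivity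
          nlinarith
        have h4 := mul_le_mul_of_nonneg_left
          (show (3 / 4 : ℝ) ≤ 1 - ((w + a) / t) ^ 2 / 16 by linarith) hK
        refine le_trans (le_of_eq ?_) (add_le_add_right h4 (1 / 5))
        rw [hKdef, List.length_cons, pow_succ]
        ring
    have e : 1 / 5 + 83 / 100 * (3 / 4 : ℝ) ^ B.length * (16 / 15 * ((1 - (w / t) ^ 2 / 16) *
        ((a :: S).map (fun a => 1 - (a / t) ^ 2 / 16)).prod)) =
        1 / 5 + K * ((1 - (w / t) ^ 2 / 16) * (1 - (a / t) ^ 2 / 16)) := by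
      rw [List.map_cons, List.prod_cons, ← hPdef, hKdef]; ring
    have e' : 1 / 5 + 83 / 100 * (3 / 4 : ℝ) ^ B.length * (16 / 15 * ((1 - ((w - a) / t) ^ 2 / 16)
        * P)) = 1 / 5 + K * (1 - ((w - a) / t) ^ 2 / 16) := by
      rw [hKdef]; ring
    rw [split, e]
    rw [e'] at diff
    have h5 : (1 - ((w + a) / t) ^ 2 / 16 + (1 - ((w - a) / t) ^ 2 / 16)) / 2 ≤
        (1 - (w / t) ^ 2 / 16) * (1 - (a / t) ^ 2 / 16) := by
      have : 0 ≤ (w / t) ^ 2 * (a / t) ^ 2 := by positivity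
      rw [add_div w, sub_div w]
      linarith
    have h6 := mul_le_mul_of_nonneg_left h5 hK
    linarith

lemma signAvg_near_le_exp {t : ℝ} (ht : 0 < t) (S : List ℝ)
    (hS : ∀ a ∈ S, 0 ≤ a ∧ a < t) (B : List ℝ) (hB : ∀ b ∈ B, t ≤ b) {k : ℕ}
    (hk : k ≤ B.length) {ρ : ℝ} (hρ : ρ * t ^ 2 ≤ (S.map (· ^ 2)).sum) :
    signAvg (S ++ B) (near t) 0 ≤
      1 / 5 + 83 / 100 * (3 / 4) ^ k * (16 / 15 * Real.exp (-(ρ / 16))) := by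
  have h := signAvg_near_le_of_small ht S hS B hB 0 le_rfl ht 0
  rw [signAvg_append]
  have h0 : signAvg (0 :: S) (signAvg B (near t)) 0 = signAvg S (signAvg B (near t)) 0 := by
    simp [signAvg]
  rw [h0] at h
  refine h.trans ?_
  have hprod : (S.map (fun a => 1 - (a / t) ^ 2 / 16)).prod ≤
      Real.exp (-((S.map (· ^ 2)).sum / t ^ 2 / 16)) := by
    clear h h0 hρ
    induction S with
    | nil => simp
    | cons a S ih =>
      have ih := ih (fun a h => hS a (by simp [h]))
      rw [List.map_cons, List.map_cons, List.prod_cons, List.sum_cons]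
      have e : -((a ^ 2 + (S.map (· ^ 2)).sum) / t ^ 2 / 16) =
        -((a / t) ^ 2 / 16) + -((S.map (· ^ 2)).sum / t ^ 2 / 16) := by
        rw [div_pow]; ring
      rw [e, Real.exp_add]
      have ha := hS a (by simp)
      have h1 : (a / t) ^ 2 ≤ 1 := by
        rw [sq_le_one_iff₀ (div_nonneg ha.1 ht.le), div_le_one ht]
        exact ha.2.le
      have h2 := Real.add_one_le_exp (-((a / t) ^ 2 / 16))
      calc _ ≤ (1 - (a / t) ^ 2 / 16) * Real.exp (-((S.map (· ^ 2)).sum / t ^ 2 / 16)) :=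
            mul_le_mul_of_nonneg_left ih (by linarith)
        _ ≤ _ := mul_le_mul_of_nonneg_right (by linarith) (Real.exp_pos _).le
  have hexp : Real.exp (-((S.map (· ^ 2)).sum / t ^ 2 / 16)) ≤ Real.exp (-(ρ / 16)) := by
    apply Real.exp_le_exp.2
    have : ρ ≤ (S.map (· ^ 2)).sum / t ^ 2 := by rw [le_div_iff₀ (by positivity)]; exact hρ
    linarith
  have hpow : (3 / 4 : ℝ) ^ B.length ≤ (3 / 4) ^ k :=
    pow_le_pow_of_le_one (by norm_num) (by norm_num) hk
  have hnonneg : 0 ≤ (1 - ((0 : ℝ) / t) ^ 2 / 16) *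
      (S.map (fun a => 1 - (a / t) ^ 2 / 16)).prod := by
    refine mul_nonneg (by norm_num) (List.prod_nonneg fun v hv => ?_)
    obtain ⟨y, hy, rfl⟩ := List.mem_map.1 hv
    have : (y / t) ^ 2 ≤ 1 := by
      rw [sq_le_one_iff₀ (div_nonneg (hS y hy).1 ht.le), div_le_one ht]
      exact (hS y hy).2.le
    linarith
  have hfin : (1 - ((0 : ℝ) / t) ^ 2 / 16) * (S.map (fun a => 1 - (a / t) ^ 2 / 16)).prod ≤
      Real.exp (-(ρ / 16)) := by
    rw [zero_div]; norm_num; linarith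
  have h₁ := mul_le_mul hpow (mul_le_mul_of_nonneg_left hfin (by norm_num : (0 : ℝ) ≤ 16 / 15))
    (mul_nonneg (by norm_num) hnonneg) (by positivity)
  linarith

/-! ### Nearly equal weights -/

/-- The sum of the binomial coefficients `n.choose j` with `j ≤ i`. -/
def lowerSum : ℕ → ℕ → ℕ
  | 0, _ => 1
  | _ + 1, 0 => 1
  | n + 1, i + 1 => lowerSum n (i + 1) + lowerSum n i

lemma lowerSum_zero (n : ℕ) : lowerSum n 0 = 1 := by cases n <;> rfl

lemma le_signAvg_above {m M : ℝ} (hm : 0 ≤ m) (hM : 0 ≤ M) (B : List ℝ)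
    (hB : ∀ b ∈ B, m ≤ b ∧ b ≤ M) (i : ℕ) {x y : ℝ}
    (h : y ≤ x + (B.length - i) * m - i * M) :
    (lowerSum B.length i : ℝ) / 2 ^ B.length ≤ signAvg B (above y) x := by
  induction B generalizing i x with
  | nil =>
    have hi : (0 : ℝ) ≤ i := i.cast_nonneg
    have : y ≤ x := by
      simp only [List.length_nil, Nat.cast_zero] at h
      nlinarith [mul_nonneg hi hm, mul_nonneg hi hM]
    simp [signAvg, lowerSum, above, this]
  | cons b B ih =>
    obtain ⟨hb, hb'⟩ := hB b (by simp)
    have ih := ih (fun b h => hB b (by simp [h]))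
    simp only [List.length_cons, Nat.cast_add, Nat.cast_one] at h ⊢
    have plus := ih i (x := x + b) (by linarith)
    simp only [signAvg]
    rw [pow_succ]
    cases i with
    | zero =>
      rw [lowerSum_zero] at plus ⊢
      have := signAvg_nonneg B (above_nonneg y) (x - b)
      rw [← div_div]
      linarith
    | succ i =>
      have minus := ih i (x := x - b) (by push_cast at h; linarith)
      rw [lowerSum, ← div_div]
      push_cast
      rw [add_div]
      linarith

lemma signAvg_near_eq_above {t : ℝ} (ht : 0 < t) (L : List ℝ) (x : ℝ) :
    signAvg L (near t) x = 1 - signAvg L (above t) x - signAvg L (above t) (-x) := by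
  have h₁ := signAvg_far L t x
  have h₂ := signAvg_far_eq_above L ht x
  linarith

lemma sum_sq_le {M : ℝ} (B : List ℝ) (hB : ∀ b ∈ B, 0 ≤ b ∧ b ≤ M) :
    (B.map (· ^ 2)).sum ≤ B.length * M ^ 2 := by
  induction B with
  | nil => simp
  | cons b B ih =>
    have ih := ih (fun b h => hB b (by simp [h]))
    have hb := hB b (by simp)
    simp only [List.map_cons, List.sum_cons, List.length_cons]
    push_cast
    nlinarith [pow_le_pow_left₀ hb.1 hb.2 2]

/-! ### Structure forced by concentration -/

lemma signAvg_near_le_of_half {t u C : ℝ} (ht : 0 < t) (hu : 0 < u) (B : List ℝ)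
    (hC : ∀ z, signAvg B (near t) z ≤ C)
    (h : ∀ z, |z| ≤ u → 1 / 2 ≤ signAvg B (above t) z) (z : ℝ) :
    signAvg B (near t) z ≤ 0 + C / u ^ 2 * z ^ 2 := by
  have hC0 : 0 ≤ C := (signAvg_nonneg B (near_nonneg t) 0).trans (hC 0)
  rw [zero_add, div_mul_eq_mul_div]
  by_cases hz : |z| ≤ u
  · have h₁ := h z hz
    have h₂ := h (-z) (by rwa [abs_neg])
    rw [signAvg_near_eq_above ht]
    have : 0 ≤ C * z ^ 2 / u ^ 2 := by positivity
    linarith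
  · refine (hC z).trans ?_
    rw [le_div_iff₀ (by positivity)]
    push Not at hz
    have : u ^ 2 ≤ z ^ 2 := by
      rw [← sq_abs z]; exact pow_le_pow_left₀ hu.le hz.le 2
    exact mul_le_mul_of_nonneg_left this hC0

lemma near_le_of_large_variance {t : ℝ} (ht : 0 < t) (S : List ℝ)
    (hS : ∀ a ∈ S, 0 ≤ a ∧ a < t) (B : List ℝ) (hB : ∀ b ∈ B, t ≤ b)
    (hσ : 64 * t ^ 2 ≤ (S.map (· ^ 2)).sum) :
    signAvg (S ++ B) (near t) 0 ≤ 231 / 1024 := by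
  refine (signAvg_near_le_exp ht S hS B hB (Nat.zero_le _) hσ).trans ?_
  have h := Real.sum_le_exp_of_nonneg (show (0 : ℝ) ≤ 64 / 16 by norm_num) 8
  norm_num [Finset.sum_range_succ, Nat.factorial] at h
  have h' : Real.exp (-(64 / 16)) ≤ 1 / 50 := by
    rw [Real.exp_neg]
    norm_num
    refine (inv_anti₀ (by norm_num) (show (50 : ℝ) ≤ _ by linarith)).trans (by norm_num)
  linarith

lemma near_le_of_seven {t : ℝ} (ht : 0 < t) (S : List ℝ)
    (hS : ∀ a ∈ S, 0 ≤ a ∧ a < t) (B : List ℝ) (hB : ∀ b ∈ B, t ≤ b) (hk : 7 ≤ B.length)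
    (hσ : 25 * t ^ 2 ≤ (S.map (· ^ 2)).sum) :
    signAvg (S ++ B) (near t) 0 ≤ 231 / 1024 := by
  refine (signAvg_near_le_exp ht S hS B hB hk hσ).trans ?_
  have h := Real.sum_le_exp_of_nonneg (show (0 : ℝ) ≤ 25 / 16 by norm_num) 7
  norm_num [Finset.sum_range_succ, Nat.factorial] at h
  have h' : Real.exp (-(25 / 16)) ≤ 10 / 47 := by
    rw [Real.exp_neg]
    refine (inv_anti₀ (by norm_num) (show (47 / 10 : ℝ) ≤ _ by linarith)).trans (by norm_num)
  linarith

lemma near_le_of_nine {t : ℝ} (ht : 0 < t) (S : List ℝ)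
    (hS : ∀ a ∈ S, 0 ≤ a ∧ a < t) (B : List ℝ) (hB : ∀ b ∈ B, t ≤ b) (hk : 9 ≤ B.length)
    (hσ : 16 * t ^ 2 ≤ (S.map (· ^ 2)).sum) :
    signAvg (S ++ B) (near t) 0 ≤ 231 / 1024 := by
  refine (signAvg_near_le_exp ht S hS B hB hk hσ).trans ?_
  have h := Real.sum_le_exp_of_nonneg (show (0 : ℝ) ≤ 16 / 16 by norm_num) 5
  norm_num [Finset.sum_range_succ, Nat.factorial] at h
  have h' : Real.exp (-(16 / 16)) ≤ 10 / 27 := by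
    rw [Real.exp_neg]
    norm_num
    refine (inv_anti₀ (by norm_num) (show (27 / 10 : ℝ) ≤ _ by linarith)).trans (by norm_num)
  linarith

lemma near_le_of_ten {t : ℝ} (ht : 0 < t) (S : List ℝ)
    (hS : ∀ a ∈ S, 0 ≤ a ∧ a < t) (B : List ℝ) (hB : ∀ b ∈ B, t ≤ b) (hk : 10 ≤ B.length)
    (hσ : 12 * t ^ 2 ≤ (S.map (· ^ 2)).sum) :
    signAvg (S ++ B) (near t) 0 ≤ 231 / 1024 := by
  refine (signAvg_near_le_exp ht S hS B hB hk hσ).trans ?_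
  have h := Real.sum_le_exp_of_nonneg (show (0 : ℝ) ≤ 12 / 16 by norm_num) 3
  norm_num [Finset.sum_range_succ, Nat.factorial] at h
  have h' : Real.exp (-(12 / 16)) ≤ 1 / 2 := by
    rw [Real.exp_neg]
    norm_num
    refine (inv_anti₀ (by norm_num) (show (2 : ℝ) ≤ _ by linarith)).trans (by norm_num)
  linarith

lemma near_le_of_eleven {t : ℝ} (ht : 0 < t) (S B : List ℝ) (hB : ∀ b ∈ B, t ≤ b)
    (hk : 11 ≤ B.length) : signAvg (S ++ B) (near t) 0 ≤ 231 / 1024 := by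
  rw [signAvg_append]
  refine signAvg_le_const _ (fun y => ?_) 0
  refine (signAvg_near_le_of_le_length ht B hB hk y).trans ?_
  norm_num [middleSum]

/-- Concentration forces eight to ten large weights to be nearly equal. -/
lemma exists_interval_of_concentrated {t : ℝ} (ht : 0 < t) (S B : List ℝ) (hB : ∀ b ∈ B, t ≤ b)
    (hk : 8 ≤ B.length) (hk' : B.length ≤ 10)
    (h : 231 / 1024 < signAvg (S ++ B) (near t) 0) :
    ∃ m, t ≤ m ∧ ∀ b ∈ B, m ≤ b ∧ b ≤ m + t := by
  obtain ⟨m, hm, hmin⟩ := B.toFinset.exists_min_image id (by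
    rw [List.toFinset_nonempty_iff]; rintro rfl; simp at hk)
  rw [List.mem_toFinset] at hm
  refine ⟨m, hB m hm, fun b hb => ⟨hmin b (List.mem_toFinset.2 hb), ?_⟩⟩
  by_contra hbm
  push Not at hbm
  have hmb : m ∈ B.erase b := (List.mem_erase_of_ne (by linarith)).2 hm
  have hperm : B.Perm (b :: m :: (B.erase b).erase m) :=
    (List.perm_cons_erase hb).trans ((List.perm_cons_erase hmb).cons b)
  have hlen := hperm.length_eq
  have hV : ∀ v ∈ (B.erase b).erase m, t ≤ v := fun v hv =>
    hB v (List.mem_of_mem_erase (List.mem_of_mem_erase hv))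
  refine absurd h (not_lt.2 ?_)
  rw [signAvg_append]
  refine signAvg_le_const _ (fun y => ?_) 0
  rw [signAvg_perm hperm]
  refine (signAvg_near_le_of_pair ht _ hV (hB m hm) (by linarith) y).trans ?_
  generalize (B.erase b).erase m = V at hlen
  simp only [List.length_cons] at hlen
  obtain h | h | h : V.length = 6 ∨ V.length = 7 ∨ V.length = 8 := by omega
  all_goals rw [h]; norm_num [middleSum]

/-- Nine nearly equal large weights cannot be concentrated around zero. -/
lemma near_le_of_nine_equal {t m : ℝ} (ht : 0 < t) (ht' : t ≤ 1 / 40) (S B : List ℝ)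
    (hk : B.length = 9) (hm : t ≤ m) (hB : ∀ b ∈ B, m ≤ b ∧ b ≤ m + t)
    (hσ : (S.map (· ^ 2)).sum ≤ 16 * t ^ 2)
    (hvar : 0.66625 ≤ (B.map (· ^ 2)).sum + (S.map (· ^ 2)).sum) :
    signAvg (S ++ B) (near t) 0 ≤ 231 / 1024 := by
  have hsq := sum_sq_le (M := m + t) B (fun b hb => ⟨by linarith [(hB b hb).1], (hB b hb).2⟩)
  rw [hk] at hsq
  have hm' : 0.24 ≤ m := by
    by_contra hlt
    push Not at hlt
    push_cast at hsq
    nlinarith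
  have hu : 0 < m - 5 * t := by linarith
  have key := signAvg_near_le_of_half (t := t) (u := m - 5 * t) (C := 126 / 512) ht hu B (fun z => by
      have := signAvg_near_le ht B (fun b hb => hm.trans (hB b hb).1) z
      rw [hk] at this
      norm_num [middleSum] at this ⊢
      exact this) (fun z hz => by
      have := le_signAvg_above (m := m) (M := m + t) (by linarith) (by linarith) B hB 4
        (x := z) (y := t) (by rw [hk]; push_cast; linarith [(abs_le.1 hz).1])
      rw [hk] at this
      norm_num [lowerSum] at this ⊢
      exact this)
  refine (signAvg_append_le_of_le_quadratic key).trans ?_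
  rw [zero_add, div_mul_eq_mul_div, div_le_iff₀ (by positivity)]
  nlinarith

/-- Six nearly equal weights and a further comparable one cannot be concentrated around zero. -/
lemma near_le_of_six_equal {t m b u : ℝ} (ht : 0 < t) (S V : List ℝ)
    (hk : V.length = 6) (hm : t ≤ m) (hV : ∀ v ∈ V, m ≤ v ∧ v ≤ m + t) (hb : t ≤ b)
    (hu : 0 < u) (hσ : (S.map (· ^ 2)).sum ≤ 25 * t ^ 2)
    (h₁ : u ≤ b - 4 * t) (h₂ : u ≤ 2 * m - 3 * t - b) (htu : 5.53 * t ≤ u) :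
    signAvg (S ++ b :: V) (near t) 0 ≤ 231 / 1024 := by
  have key := signAvg_near_le_of_half (t := t) (C := 35 / 128) ht hu (b :: V) (fun z => by
      have := signAvg_near_le ht (b :: V) (fun v hv => by
        rcases List.mem_cons.1 hv with rfl | hv
        · exact hb
        · exact hm.trans (hV v hv).1) z
      rw [List.length_cons, hk] at this
      norm_num [middleSum] at this ⊢
      exact this) (fun z hz => by
      have hz := (abs_le.1 hz).1
      have plus := le_signAvg_above (m := m) (M := m + t) (by linarith) (by linarith) V hV 3
        (x := z + b) (y := t) (by rw [hk]; push_cast; linarith)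
      have minus := le_signAvg_above (m := m) (M := m + t) (by linarith) (by linarith) V hV 2
        (x := z - b) (y := t) (by rw [hk]; push_cast; linarith)
      rw [hk] at plus minus
      norm_num [lowerSum] at plus minus
      simp only [signAvg]
      linarith)
  refine (signAvg_append_le_of_le_quadratic key).trans ?_
  rw [zero_add, div_mul_eq_mul_div, div_le_iff₀ (by positivity)]
  nlinarith

/-- Seven large weights cannot be concentrated around zero. -/
lemma near_le_of_seven_large {t : ℝ} (ht : 0 < t) (ht' : t ≤ 1 / 40) (S B : List ℝ)
    (hk : B.length = 7) (hB : ∀ b ∈ B, t ≤ b ∧ b ≤ (1 - t) / 3)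
    (hsort : B.Pairwise (fun x y => y ≤ x))
    (hσ : (S.map (· ^ 2)).sum ≤ 25 * t ^ 2)
    (hvar : 0.66625 ≤ (B.map (· ^ 2)).sum + (S.map (· ^ 2)).sum) :
    signAvg (S ++ B) (near t) 0 ≤ 231 / 1024 := by
  obtain ⟨b₁, b₂, b₃, b₄, b₅, b₆, b₇, rfl⟩ :
      ∃ b₁ b₂ b₃ b₄ b₅ b₆ b₇, B = [b₁, b₂, b₃, b₄, b₅, b₆, b₇] := by
    match B, hk with
    | [b₁, b₂, b₃, b₄, b₅, b₆, b₇], _ => exact ⟨_, _, _, _, _, _, _, rfl⟩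
  simp only [List.pairwise_cons, List.mem_cons, List.not_mem_nil, or_false, forall_eq_or_imp,
    forall_eq, false_imp_iff, implies_true, List.Pairwise.nil, and_true] at hB hsort
  obtain ⟨⟨h12, -⟩, ⟨h23, -⟩, ⟨h34, -⟩, ⟨h45, -⟩, ⟨h56, -⟩, h67⟩ := hsort
  obtain ⟨⟨ht1, hb1⟩, ⟨ht2, -⟩, ⟨ht3, -⟩, ⟨ht4, -⟩, ⟨ht5, -⟩, ⟨ht6, -⟩, ht7, -⟩ := hB
  simp only [List.map_cons, List.map_nil, List.sum_cons, List.sum_nil, add_zero] at hvar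
  have last_first : [b₁, b₂, b₃, b₄, b₅, b₆, b₇].Perm (b₇ :: [b₁, b₂, b₃, b₄, b₅, b₆]) :=
    List.perm_append_singleton b₇ [b₁, b₂, b₃, b₄, b₅, b₆]
  by_cases hgap : t ≤ b₆ - b₇
  · rw [signAvg_append]
    refine signAvg_le_const _ (fun y => ?_) 0
    rw [signAvg_perm last_first]
    refine (signAvg_near_le_of_gap ht _ ht7 (fun v hv => ?_) y).trans ?_
    · simp only [List.mem_cons, List.not_mem_nil, or_false] at hv
      rcases hv with rfl | rfl | rfl | rfl | rfl | rfl <;> linarith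
    · norm_num [middleSum]
  push Not at hgap
  have ht2' : t ^ 2 ≤ (1 / 40) ^ 2 := pow_le_pow_left₀ ht.le ht' 2
  by_cases hA : b₂ - b₇ < t
  · have hm : 0.27 ≤ b₇ := by
      by_contra hlt
      push Not at hlt
      have e : ∀ x, 0 ≤ x → x ≤ b₇ + t → x ^ 2 ≤ 0.295 ^ 2 := fun x h0 h =>
        pow_le_pow_left₀ h0 (by linarith) 2
      have := e b₂ (by linarith) (by linarith)
      have := e b₃ (by linarith) (by linarith)
      have := e b₄ (by linarith) (by linarith)
      have := e b₅ (by linarith) (by linarith)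
      have := e b₆ (by linarith) (by linarith)
      have := e b₇ (by linarith) (by linarith)
      have : b₁ ^ 2 ≤ (1 / 3) ^ 2 := pow_le_pow_left₀ (by linarith) (by linarith) 2
      linarith
    refine near_le_of_six_equal (m := b₇) (u := 5.53 * t) ht S [b₂, b₃, b₄, b₅, b₆, b₇] rfl ht7
      (fun v hv => ?_) ht1 (by linarith) hσ (by linarith) (by linarith) le_rfl
    simp only [List.mem_cons, List.not_mem_nil, or_false] at hv
    rcases hv with rfl | rfl | rfl | rfl | rfl | rfl <;> constructor <;> linarith
  push Not at hA
  by_cases hC : b₁ - b₆ < t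
  · have hm : 0.27 ≤ b₆ := by
      by_contra hlt
      push Not at hlt
      have e : ∀ x, 0 ≤ x → x ≤ b₆ + t → x ^ 2 ≤ 0.295 ^ 2 := fun x h0 h =>
        pow_le_pow_left₀ h0 (by linarith) 2
      have := e b₁ (by linarith) (by linarith)
      have := e b₂ (by linarith) (by linarith)
      have := e b₃ (by linarith) (by linarith)
      have := e b₄ (by linarith) (by linarith)
      have := e b₅ (by linarith) (by linarith)
      have := e b₆ (by linarith) (by linarith)
      have := e b₇ (by linarith) (by linarith)
      linarith
    rw [signAvg_perm (last_first.append_left S)]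
    refine near_le_of_six_equal (m := b₆) (u := 5.53 * t) ht S _ rfl ht6
      (fun v hv => ?_) ht7 (by linarith) hσ (by linarith) (by linarith) le_rfl
    simp only [List.mem_cons, List.not_mem_nil, or_false] at hv
    rcases hv with rfl | rfl | rfl | rfl | rfl | rfl <;> constructor <;> linarith
  push Not at hC
  rw [signAvg_append]
  refine signAvg_le_const _ (fun y => ?_) 0
  have hperm : [b₁, b₂, b₃, b₄, b₅, b₆, b₇].Perm (b₁ :: b₆ :: b₂ :: b₇ :: [b₃, b₄, b₅]) := by
    refine List.Perm.cons _ ?_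
    calc [b₂, b₃, b₄, b₅, b₆, b₇].Perm ([b₆, b₇] ++ [b₂, b₃, b₄, b₅]) :=
          List.perm_append_comm (l₁ := [b₂, b₃, b₄, b₅]) (l₂ := [b₆, b₇])
      List.Perm _ (b₆ :: b₂ :: b₇ :: [b₃, b₄, b₅]) := (List.Perm.swap _ _ _).cons _
  rw [signAvg_perm hperm]
  refine (signAvg_near_le_of_two_pairs ht _ (fun v hv => ?_) ht6 hC ht7 hA y).trans ?_
  · simp only [List.mem_cons, List.not_mem_nil, or_false] at hv
    rcases hv with rfl | rfl | rfl <;> linarith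
  · norm_num [middleSum]

/-- Tail bound for eight nearly equal weights. -/
lemma far_ge_of_eight_equal {t m T : ℝ} (ht : 0 < t) (ht' : t ≤ 1 / 40) (S B : List ℝ)
    (hk : B.length = 8) (hm : t ≤ m) (hB : ∀ b ∈ B, m ≤ b ∧ b ≤ m + t)
    (hσ : (S.map (· ^ 2)).sum ≤ 25 * t ^ 2)
    (hvar : 0.66625 ≤ (B.map (· ^ 2)).sum + (S.map (· ^ 2)).sum)
    (hT : 0 < T) (hT' : T ≤ 0.675) :
    37 / 128 ≤ signAvg (S ++ B) (far T) 0 := by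
  have hsq := sum_sq_le (M := m + t) B (fun b hb => ⟨by linarith [(hB b hb).1], (hB b hb).2⟩)
  rw [hk] at hsq
  have hm' : 0.25 ≤ m := by
    by_contra hlt
    push Not at hlt
    push_cast at hsq
    nlinarith
  have key : ∀ z, 0 ≤ z → 37 / 128 ≤ signAvg B (far T) z := by
    intro z hz
    have tail := fun i x h => le_signAvg_above (m := m) (M := m + t) (by linarith) (by linarith)
      B hB i (x := x) (y := T) h
    simp only [hk] at tail
    rw [signAvg_far_eq_above B hT]
    by_cases h : z ≤ 4 * m - 2 * t - T
    · have h₁ := tail 2 z (by push_cast; linarith)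
      have h₂ := tail 2 (-z) (by push_cast; linarith)
      norm_num [lowerSum] at h₁ h₂
      linarith
    · have h₁ := tail 3 z (by push_cast; linarith)
      have h₂ := signAvg_nonneg B (above_nonneg T) (-z)
      norm_num [lowerSum] at h₁
      linarith
  have := le_signAvg_append_of_quadratic_le (S := S) (B := B) (g := far T) (α := 37 / 128)
    (β := 0) (fun z => by
      rw [zero_mul, add_zero]
      rcases le_total 0 z with h | h
      · exact key z h
      · rw [← signAvg_far_neg]; exact key (-z) (by linarith))
  linarith

/-- Tail bound for ten nearly equal weights. -/
lemma far_ge_of_ten_equal {t m T : ℝ} (ht : 0 < t) (ht' : t ≤ 1 / 40) (S B : List ℝ)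
    (hk : B.length = 10) (hm : t ≤ m) (hB : ∀ b ∈ B, m ≤ b ∧ b ≤ m + t)
    (hσ : (S.map (· ^ 2)).sum ≤ 12 * t ^ 2)
    (hvar : 0.66625 ≤ (B.map (· ^ 2)).sum + (S.map (· ^ 2)).sum)
    (hT : 0 < T) (hT' : T ≤ 0.675) :
    37 / 128 ≤ signAvg (S ++ B) (far T) 0 := by
  have hsq := sum_sq_le (M := m + t) B (fun b hb => ⟨by linarith [(hB b hb).1], (hB b hb).2⟩)
  rw [hk] at hsq
  have hm' : 0.23 ≤ m := by
    by_contra hlt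
    push Not at hlt
    push_cast at hsq
    nlinarith
  have hu : 0.17 ≤ 4 * m - 3 * t - T := by linarith
  have key : ∀ z, 0 ≤ z → 352 / 1024 + (-(176 / 1024 / 0.17 ^ 2)) * z ^ 2 ≤
      signAvg B (far T) z := by
    intro z hz
    have tail := fun x h => le_signAvg_above (m := m) (M := m + t) (by linarith) (by linarith)
      B hB 3 (x := x) (y := T) h
    simp only [hk] at tail
    rw [signAvg_far_eq_above B hT]
    have h₁ := tail z (by push_cast; linarith)
    norm_num [lowerSum] at h₁
    by_cases h : z ≤ 0.17
    · have h₂ := tail (-z) (by push_cast; linarith)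
      norm_num [lowerSum] at h₂
      nlinarith [sq_nonneg z]
    · have h₂ := signAvg_nonneg B (above_nonneg T) (-z)
      push Not at h
      nlinarith
  have := le_signAvg_append_of_quadratic_le (S := S) (B := B) (g := far T) (fun z => by
      rcases le_total 0 z with h | h
      · exact key z h
      · rw [← signAvg_far_neg, ← neg_sq z]; exact key (-z) (by linarith))
  refine le_trans ?_ this
  nlinarith

lemma far_or_far_of_sorted {a₁ a₂ a₃ : ℝ} (L : List ℝ) (hsort : L.Pairwise (fun x y => y ≤ x))
    (hL : ∀ b ∈ L, 0 < b ∧ b ≤ a₃) (h12 : a₂ ≤ a₁) (h23 : a₃ ≤ a₂) (h3 : 0.325 ≤ a₃)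
    (h123 : a₁ + a₂ + a₃ ≤ 1)
    (hsum : a₁ ^ 2 + a₂ ^ 2 + a₃ ^ 2 + (L.map (· ^ 2)).sum = 1) :
    793 / 1024 ≤ signAvg L (far (1 - a₁ - a₂ - a₃)) 0 ∨
      (37 / 128 ≤ signAvg L (far (1 - a₁ - a₂ + a₃)) 0 ∧
        37 / 128 ≤ signAvg L (far (1 - a₁ + a₂ - a₃)) 0) := by
  obtain ⟨t, htdef⟩ : ∃ t, t = 1 - a₁ - a₂ - a₃ := ⟨_, rfl⟩
  rw [← htdef]
  rcases (show 0 ≤ t by linarith).eq_or_lt with rfl | ht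
  · left
    rw [show far 0 = fun y => 1 + 0 * far 0 y by funext y; simp [far], signAvg_affine]
    norm_num
  have ht' : t ≤ 1 / 40 := by linarith
  obtain ⟨S, B, hperm, hS, hB, hBsort⟩ : ∃ S B : List ℝ, L.Perm (S ++ B) ∧
      (∀ a ∈ S, 0 ≤ a ∧ a < t) ∧ (∀ b ∈ B, t ≤ b ∧ b ≤ a₃) ∧ B.Pairwise (fun x y => y ≤ x) := by
    classical
    refine ⟨L.filter (fun a => !decide (t ≤ a)), L.filter (fun a => decide (t ≤ a)),
      ((List.filter_append_perm (fun a => decide (t ≤ a)) L).symm.trans List.perm_append_comm),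
      fun a ha => ?_, fun b hb => ?_, hsort.filter _⟩
    · simp only [List.mem_filter, Bool.not_eq_true', decide_eq_false_iff_not, not_le] at ha
      exact ⟨(hL a ha.1).1.le, ha.2⟩
    · simp only [List.mem_filter, decide_eq_true_eq] at hb
      exact ⟨hb.2, (hL b hb.1).2⟩
  have hmapsum : (L.map (· ^ 2)).sum = (B.map (· ^ 2)).sum + (S.map (· ^ 2)).sum := by
    rw [(hperm.map (· ^ 2)).sum_eq, List.map_append, List.sum_append, add_comm]
  simp only [signAvg_perm hperm]
  rw [hmapsum] at hsum
  have hBt : ∀ b ∈ B, t ≤ b := fun b hb => (hB b hb).1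
  by_cases hN : signAvg (S ++ B) (near t) 0 ≤ 231 / 1024
  · left
    rw [signAvg_far]
    linarith
  right
  have hvar : 0.66625 ≤ (B.map (· ^ 2)).sum + (S.map (· ^ 2)).sum := by
    nlinarith
  have hk11 : B.length < 11 := by
    by_contra h
    exact hN (near_le_of_eleven ht S B hBt (by omega))
  have hk7 : 7 ≤ B.length := by
    by_contra h
    refine hN (near_le_of_large_variance ht S hS B hBt ?_)
    have hsq := sum_sq_le (M := a₃) B (fun b hb => ⟨by linarith [(hB b hb).1], (hB b hb).2⟩)
    have hk : (B.length : ℝ) ≤ 6 := by exact_mod_cast (by omega : B.length ≤ 6)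
    have : (B.length : ℝ) * a₃ ^ 2 ≤ 6 * a₃ ^ 2 := by gcongr
    subst htdef
    nlinarith
  have hσ : (S.map (· ^ 2)).sum ≤ 25 * t ^ 2 := by
    by_contra h
    exact hN (near_le_of_seven ht S hS B hBt hk7 (by linarith))
  rcases hk7.eq_or_lt with hk | hk8
  · refine absurd (near_le_of_seven_large ht ht' S B hk.symm (fun b hb => ⟨hBt b hb, ?_⟩) hBsort hσ
      hvar) hN
    linarith [(hB b hb).2]
  obtain ⟨m, hm, hBm⟩ := exists_interval_of_concentrated ht S B hBt hk8 (by omega) (not_le.1 hN)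
  obtain hk | hk | hk : B.length = 8 ∨ B.length = 9 ∨ B.length = 10 := by omega
  · constructor <;> apply far_ge_of_eight_equal ht ht' S B hk hm hBm hσ hvar <;> linarith
  · have hσ' : (S.map (· ^ 2)).sum ≤ 16 * t ^ 2 := by
      by_contra h
      exact hN (near_le_of_nine ht S hS B hBt hk.ge (by linarith))
    exact absurd (near_le_of_nine_equal ht ht' S B hk hm hBm hσ' hvar) hN
  · have hσ' : (S.map (· ^ 2)).sum ≤ 12 * t ^ 2 := by
      by_contra h
      exact hN (near_le_of_ten ht S hS B hBt hk.ge (by linarith))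
    constructor <;> apply far_ge_of_ten_equal ht ht' S B hk hm hBm hσ' hvar <;> linarith

/-! ### Counting sign vectors -/

lemma sum_sign_eq_signAvg (n : ℕ) (a : Fin n → ℝ) (g : ℝ → ℝ) (x : ℝ) :
    (∑ ε : Fin n → Bool, g (x + ∑ i, a i * (if ε i then (1 : ℝ) else -1))) / 2 ^ n =
      signAvg (List.ofFn a) g x := by
  induction n generalizing x with
  | zero => simp [signAvg]
  | succ n ih =>
    rw [List.ofFn_succ, signAvg, ← ih, ← ih, ← (Fin.consEquiv (fun _ => Bool)).sum_comp,
      Fintype.sum_prod_type, Fintype.sum_bool]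
    simp only [Fin.consEquiv_apply, Fin.sum_univ_succ, Fin.cons_zero, Fin.cons_succ]
    simp only [if_true, Bool.false_eq_true, if_false, mul_one, mul_neg, ← add_assoc,
      ← sub_eq_add_neg]
    rw [pow_succ]
    field_simp

lemma card_filter_far (n : ℕ) (a : Fin (n + 3) → ℝ) (c : ℝ) :
    ((Finset.univ.filter (fun ε : Fin (n + 3) → Bool =>
      c ≤ |∑ i ∈ Finset.univ.filter (fun i : Fin (n + 3) => 3 ≤ (i : ℕ)),
        a i * (if ε i then (1 : ℝ) else -1)|)).card : ℝ) / 2 ^ (n + 3) =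
      signAvg (List.ofFn fun i : Fin n => a i.succ.succ.succ) (far c) 0 := by
  have h := sum_sign_eq_signAvg (n + 3) (fun i => if 3 ≤ (i : ℕ) then a i else 0) (far c) 0
  have hL : signAvg (List.ofFn fun i : Fin (n + 3) => if 3 ≤ (i : ℕ) then a i else 0) (far c) 0 =
      signAvg (List.ofFn fun i : Fin n => a i.succ.succ.succ) (far c) 0 := by
    simp [List.ofFn_succ, signAvg]
  rw [← hL, ← h, Finset.card_filter]
  push_cast
  congr 1
  refine Finset.sum_congr rfl fun ε _ => ?_
  rw [far, zero_add, Finset.sum_filter]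
  simp only [ite_mul, zero_mul]

/-- **Lemma (three classes for the case `a_3 ≥ 0.325`).**
Let `n ≥ 4`, `a_1 ≥ ... ≥ a_n > 0` (0-indexed below) with `Σ a_i² = 1`,
`a_1 + a_2 + a_3 ≤ 1` and `a_3 ≥ 0.325`. Let `Y = Σ_{i=4}^n a_i ε_i` (uniform measure on
sign vectors `Fin n → Bool`; `Y` depends only on the coordinates `ε_4, ..., ε_n`), and
set `q_1 = Pr[|Y| ≥ 1 - a_1 - a_2 - a_3]`, `q_2 = Pr[|Y| ≥ 1 - a_1 - a_2 + a_3]`,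
`q_3 = Pr[|Y| ≥ 1 - a_1 + a_2 - a_3]`. Then either `a_4 ≤ 7/40`, or `q_1 ≥ 793/1024`,
or both `q_2 ≥ 37/128` and `q_3 ≥ 37/128`. -/
theorem three_classes_for_a3_large
    (n : ℕ) (hn : 4 ≤ n) (a : Fin n → ℝ)
    (hpos : ∀ i, 0 < a i)
    (hmono : ∀ i j : Fin n, i ≤ j → a j ≤ a i)
    (hsum : ∑ i, a i ^ 2 = 1)
    (h123 : a ⟨0, by omega⟩ + a ⟨1, by omega⟩ + a ⟨2, by omega⟩ ≤ 1)
    (h3 : (0.325 : ℝ) ≤ a ⟨2, by omega⟩) :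
    a ⟨3, by omega⟩ ≤ 7 / 40 ∨
    (793 : ℝ) / 1024 ≤
      ((Finset.univ.filter (fun ε : Fin n → Bool =>
          1 - a ⟨0, by omega⟩ - a ⟨1, by omega⟩ - a ⟨2, by omega⟩ ≤
            |∑ i ∈ Finset.univ.filter (fun i : Fin n => 3 ≤ (i : ℕ)),
              a i * (if ε i then (1 : ℝ) else -1)|)).card : ℝ) / 2 ^ n ∨
    ((37 : ℝ) / 128 ≤
      ((Finset.univ.filter (fun ε : Fin n → Bool =>
          1 - a ⟨0, by omega⟩ - a ⟨1, by omega⟩ + a ⟨2, by omega⟩ ≤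
            |∑ i ∈ Finset.univ.filter (fun i : Fin n => 3 ≤ (i : ℕ)),
              a i * (if ε i then (1 : ℝ) else -1)|)).card : ℝ) / 2 ^ n ∧
     (37 : ℝ) / 128 ≤
      ((Finset.univ.filter (fun ε : Fin n → Bool =>
          1 - a ⟨0, by omega⟩ + a ⟨1, by omega⟩ - a ⟨2, by omega⟩ ≤
            |∑ i ∈ Finset.univ.filter (fun i : Fin n => 3 ≤ (i : ℕ)),
              a i * (if ε i then (1 : ℝ) else -1)|)).card : ℝ) / 2 ^ n) := by
  obtain ⟨n, rfl⟩ : ∃ m, n = m + 3 := ⟨n - 3, by omega⟩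
  right
  simp only [card_filter_far]
  refine far_or_far_of_sorted _ ?_ ?_ (hmono _ _ (Fin.mk_le_mk.2 (by norm_num)))
    (hmono _ _ (Fin.mk_le_mk.2 (by norm_num))) h3 h123 ?_
  · rw [List.pairwise_ofFn]
    intro i j hij
    exact hmono _ _ (by simpa using hij.le)
  · intro b hb
    obtain ⟨i, rfl⟩ := (List.mem_ofFn' _ _).1 hb
    exact ⟨hpos _, hmono _ _ (by simp [Fin.le_def])⟩
  · rw [List.map_ofFn, List.sum_ofFn, ← hsum, Fin.sum_univ_succ, Fin.sum_univ_succ,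
      Fin.sum_univ_succ]
    simp only [Function.comp_apply, ← add_assoc]
    rfl
end

section
/- Let n ≥ 4 and let a_1 ≥ a_2 ≥ ... ≥ a_n > 0 be reals with Σ_{i=1}^n a_i^2 = 1, a_1 + a_2 + a_3 < 1, and a_3 = 1/3 - δ where 0 < δ ≤ 1/120. Assume a_4 ≥ 21δ. Let k be the smallest index with a_k < 1 - a_1 - a_2 - a_3 (with k = n + 1 if no such index exists), and suppose Σ_{i=k}^n a_i^2 ≥ 450 δ^2. Let Y = Σ_{i=4}^n a_i ε_i with ε_4, ..., ε_n independent uniform random signs. Then Pr[|Y| ≥ 1 - a_1 - a_2 - a_3] ≥ 793/1024. -/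
open Finset

/-- The signed sum `∑ i ∈ S, ± b i`, with the signs read off from `ε`. -/
def signSum {ι : Type*} (b : ι → ℝ) (S : Finset ι) (ε : ι → Bool) : ℝ :=
  ∑ i ∈ S, b i * (if ε i then (1 : ℝ) else -1)

/-- Averaging over the sign of a new summand. -/
lemma sum_signSum_insert {ι : Type*} [Fintype ι] [DecidableEq ι] (b : ι → ℝ) (S : Finset ι)
    (j : ι) (hj : j ∉ S) (f : ℝ → ℝ) :
    ∑ ε : ι → Bool, f (signSum b (insert j S) ε) =
      ∑ ε : ι → Bool, (f (signSum b S ε + b j) + f (signSum b S ε - b j)) / 2 := by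
  let flip : (ι → Bool) → (ι → Bool) := fun ε => Function.update ε j (!ε j)
  have hflip : Function.Involutive flip := by
    intro ε
    funext i
    by_cases h : i = j
    · subst h; simp [flip]
    · simp [flip, h]
  have hS : ∀ ε, signSum b S (flip ε) = signSum b S ε := by
    intro ε
    refine Finset.sum_congr rfl fun i hi => ?_
    have : i ≠ j := fun h => hj (h ▸ hi)
    simp [flip, this]
  have hins : ∀ ε, signSum b (insert j S) ε =
      b j * (if ε j then (1 : ℝ) else -1) + signSum b S ε :=
    fun ε => Finset.sum_insert hj
  have h1 : ∑ ε : ι → Bool, f (signSum b (insert j S) (flip ε)) =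
      ∑ ε : ι → Bool, f (signSum b (insert j S) ε) :=
    Equiv.sum_comp hflip.toPerm (fun ε => f (signSum b (insert j S) ε))
  have h2 : ∑ ε : ι → Bool, (f (signSum b (insert j S) ε) +
        f (signSum b (insert j S) (flip ε))) =
      ∑ ε : ι → Bool, (f (signSum b S ε + b j) + f (signSum b S ε - b j)) := by
    refine Finset.sum_congr rfl fun ε _ => ?_
    rw [hins, hins, hS]
    have hj' : flip ε j = !ε j := by simp [flip]
    rw [hj']
    cases ε j
    · simp only [Bool.false_eq_true, if_false, Bool.not_false, if_true]
      rw [add_comm]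
      congr 2 <;> ring
    · simp only [Bool.not_true, Bool.false_eq_true, if_false, if_true]
      congr 2 <;> ring
  rw [Finset.sum_add_distrib, h1] at h2
  rw [← Finset.sum_div, ← h2]
  ring

/-- Adding further signed summands preserves a bound that is uniform in the shift. -/
lemma sum_signSum_le_of_subset {ι : Type*} [Fintype ι] [DecidableEq ι] (b : ι → ℝ)
    (S R : Finset ι) (hSR : Disjoint S R) (f : ℝ → ℝ) (C : ℝ)
    (hC : ∀ x, ∑ ε : ι → Bool, f (x + signSum b S ε) ≤ C) :
    ∀ x, ∑ ε : ι → Bool, f (x + signSum b (R ∪ S) ε) ≤ C := by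
  induction R using Finset.induction_on with
  | empty => simpa using hC
  | insert j R hj ih =>
    rw [Finset.disjoint_insert_right] at hSR
    intro x
    rw [Finset.insert_union, sum_signSum_insert b (R ∪ S) j (by simp [hj, hSR.1])
      (fun y => f (x + y)), ← Finset.sum_div, Finset.sum_add_distrib]
    have h1 := ih hSR.2 (x + b j)
    have h2 := ih hSR.2 (x - b j)
    have e1 : ∑ ε : ι → Bool, f (x + (signSum b (R ∪ S) ε + b j)) =
        ∑ ε : ι → Bool, f (x + b j + signSum b (R ∪ S) ε) :=
      Finset.sum_congr rfl fun ε _ => by congr 1; ring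
    have e2 : ∑ ε : ι → Bool, f (x + (signSum b (R ∪ S) ε - b j)) =
        ∑ ε : ι → Bool, f (x - b j + signSum b (R ∪ S) ε) :=
      Finset.sum_congr rfl fun ε _ => by congr 1; ring
    rw [e1, e2]
    linarith

/-- Averaging a Gaussian over two opposite shifts. -/
lemma gaussian_average_le (w x h : ℝ) (hw : 0 < w) :
    (Real.exp (-(x + h) ^ 2 / (2 * w)) + Real.exp (-(x - h) ^ 2 / (2 * w))) / 2 ≤
      Real.exp (-h ^ 2 / (2 * w)) * Real.exp (-x ^ 2 * (w - h ^ 2) / (2 * w ^ 2)) := by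
  have e1 : -(x + h) ^ 2 / (2 * w) = -(x ^ 2 + h ^ 2) / (2 * w) + -(x * h / w) := by
    field_simp; ring
  have e2 : -(x - h) ^ 2 / (2 * w) = -(x ^ 2 + h ^ 2) / (2 * w) + x * h / w := by
    field_simp; ring
  have e3 : -h ^ 2 / (2 * w) + -x ^ 2 * (w - h ^ 2) / (2 * w ^ 2) =
      -(x ^ 2 + h ^ 2) / (2 * w) + (x * h / w) ^ 2 / 2 := by
    field_simp; ring
  have hcosh := Real.cosh_le_exp_half_sq (x * h / w)
  rw [Real.cosh_eq] at hcosh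
  rw [← Real.exp_add, e3, e1, e2, Real.exp_add, Real.exp_add, Real.exp_add]
  have := mul_le_mul_of_nonneg_left hcosh (Real.exp_pos (-(x ^ 2 + h ^ 2) / (2 * w))).le
  linarith

lemma exp_neg_add_sq_le_one_sub (p : ℝ) (h0 : 0 ≤ p) (h1 : p ≤ 1 / 2) :
    Real.exp (-(p + p ^ 2)) ≤ 1 - p := by
  have hq := Real.quadratic_le_exp_of_nonneg (x := p + p ^ 2) (by positivity)
  rw [Real.exp_neg, inv_le_comm₀ (Real.exp_pos _) (by linarith)]
  refine le_trans ?_ hq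
  rw [inv_le_iff_one_le_mul₀ (by linarith)]
  have h2 : 0 ≤ (1 - p) * (1 + p) ^ 2 / 2 - p := by
    nlinarith [mul_nonneg h0 (sub_nonneg.2 h1), mul_nonneg (mul_nonneg h0 h0) (sub_nonneg.2 h1)]
  nlinarith [mul_nonneg (sq_nonneg p) h2]

/-- A Rademacher sum with weights at most `1` smooths the Gaussian of variance `2` at least as
fast as a Gaussian of almost the same variance would. -/
lemma sum_exp_signSum_le {ι : Type*} [Fintype ι] [DecidableEq ι] (b : ι → ℝ) (S : Finset ι)
    (hb : ∀ i ∈ S, b i ^ 2 ≤ 1) :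
    ∃ w c : ℝ, 2 + ∑ i ∈ S, b i ^ 2 ≤ w ∧ 0 ≤ c ∧
      c ^ 2 ≤ 2 / w * Real.exp (1 / 2 - 1 / w) ∧
      ∀ x, ∑ ε : ι → Bool, Real.exp (-(x + signSum b S ε) ^ 2 / 4) ≤
        Fintype.card (ι → Bool) * (c * Real.exp (-x ^ 2 / (2 * w))) := by
  induction S using Finset.induction_on with
  | empty =>
    refine ⟨2, 1, by simp, by norm_num, by norm_num, fun x => ?_⟩
    simp only [signSum, Finset.sum_empty, add_zero, Finset.sum_const, nsmul_eq_mul, one_mul,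
      Finset.card_univ]
    norm_num
  | insert j S hj ih =>
    obtain ⟨w, c, hw, hc, hc2, h⟩ := ih fun i hi => hb i (Finset.mem_insert_of_mem hi)
    have hu : b j ^ 2 ≤ 1 := hb j (Finset.mem_insert_self j S)
    have hu0 : 0 ≤ b j ^ 2 := sq_nonneg _
    have hv0 : 0 ≤ ∑ i ∈ S, b i ^ 2 := Finset.sum_nonneg fun i _ => sq_nonneg _
    have hw2 : 2 ≤ w := by linarith
    have hw0 : 0 < w := by linarith
    have hwu : 0 < w - b j ^ 2 := by linarith
    refine ⟨w ^ 2 / (w - b j ^ 2), c * Real.exp (-b j ^ 2 / (2 * w)), ?_, by positivity, ?_, ?_⟩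
    · rw [Finset.sum_insert hj, le_div_iff₀ hwu]
      nlinarith [mul_nonneg hu0 hu0, mul_le_mul_of_nonneg_right hw hwu.le]
    · set p := b j ^ 2 / w with hp
      have hp0 : 0 ≤ p := by positivity
      have hp1 : p ≤ 1 / w := by rw [hp]; gcongr
      have hw12 : 1 / w ≤ 1 / 2 := by gcongr
      have e1 : 2 / (w ^ 2 / (w - b j ^ 2)) = 2 / w * (1 - p) := by
        rw [hp]; field_simp
      have e2 : 1 / (w ^ 2 / (w - b j ^ 2)) = 1 / w - p * (1 / w) := by
        rw [hp]; field_simp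
      have e3 : Real.exp (-b j ^ 2 / (2 * w)) ^ 2 = Real.exp (-p) := by
        rw [← Real.exp_nat_mul]; congr 1; rw [hp]; push_cast; field_simp
      have hkey : Real.exp (-p) ≤ (1 - p) * Real.exp (p * (1 / w)) := by
        have h1 := exp_neg_add_sq_le_one_sub p hp0 (by linarith)
        calc Real.exp (-p) = Real.exp (-(p + p ^ 2)) * Real.exp (p ^ 2) := by
              rw [← Real.exp_add]; congr 1; ring
          _ ≤ (1 - p) * Real.exp (p * (1 / w)) := by
              gcongr
              · linarith
              · nlinarith
      rw [e1, e2, mul_pow, e3]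
      calc c ^ 2 * Real.exp (-p)
          ≤ (2 / w * Real.exp (1 / 2 - 1 / w)) * ((1 - p) * Real.exp (p * (1 / w))) := by
            gcongr
        _ = 2 / w * (1 - p) * (Real.exp (1 / 2 - 1 / w) * Real.exp (p * (1 / w))) := by ring
        _ = _ := by rw [← Real.exp_add]; congr 2; ring
    · intro x
      rw [sum_signSum_insert b S j hj (fun y => Real.exp (-(x + y) ^ 2 / 4)), ← Finset.sum_div,
        Finset.sum_add_distrib]
      have e1 : ∑ ε : ι → Bool, Real.exp (-(x + (signSum b S ε + b j)) ^ 2 / 4) =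
          ∑ ε : ι → Bool, Real.exp (-(x + b j + signSum b S ε) ^ 2 / 4) :=
        Finset.sum_congr rfl fun ε _ => by ring_nf
      have e2 : ∑ ε : ι → Bool, Real.exp (-(x + (signSum b S ε - b j)) ^ 2 / 4) =
          ∑ ε : ι → Bool, Real.exp (-(x - b j + signSum b S ε) ^ 2 / 4) :=
        Finset.sum_congr rfl fun ε _ => by ring_nf
      have e3 : -x ^ 2 / (2 * (w ^ 2 / (w - b j ^ 2))) =
          -x ^ 2 * (w - b j ^ 2) / (2 * w ^ 2) := by field_simp
      rw [e1, e2, e3]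
      have h1 := h (x + b j)
      have h2 := h (x - b j)
      have h3 := mul_le_mul_of_nonneg_left (gaussian_average_le w x (b j) hw0)
        (mul_nonneg (Nat.cast_nonneg (α := ℝ) (Fintype.card (ι → Bool))) hc)
      linarith

/-- Averaging a Gaussian over two shifts that are at least `2 * h` apart. -/
lemma gaussian_average_le_of_le (w x h d : ℝ) (hw : h ^ 2 ≤ w) (hh : 0 < h) (hd : h ≤ d) :
    (Real.exp (-(x + d) ^ 2 / (2 * w)) + Real.exp (-(x - d) ^ 2 / (2 * w))) / 2 ≤
      Real.exp (-h ^ 2 / (2 * w)) := by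
  have hw0 : 0 < w := lt_of_lt_of_le (by positivity) hw
  wlog hx : 0 ≤ x generalizing x
  · have := this (-x) (by linarith)
    rw [show -(-x + d) ^ 2 = -(x - d) ^ 2 by ring, show -(-x - d) ^ 2 = -(x + d) ^ 2 by ring]
      at this
    linarith
  have h1 := gaussian_average_le w (x - (d - h)) h hw0
  have h2 : Real.exp (-(x - (d - h)) ^ 2 * (w - h ^ 2) / (2 * w ^ 2)) ≤ 1 := by
    rw [Real.exp_le_one_iff]
    apply div_nonpos_of_nonpos_of_nonneg _ (by positivity)
    nlinarith [mul_nonneg (sq_nonneg (x - (d - h))) (sub_nonneg.2 hw)]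
  have h3 : Real.exp (-(x + d) ^ 2 / (2 * w)) ≤
      Real.exp (-(x - (d - h) + h) ^ 2 / (2 * w)) := by
    gcongr Real.exp (?_ / _)
    nlinarith [mul_nonneg (sub_nonneg.2 hd) (add_nonneg hx hh.le)]
  have h4 : x - (d - h) - h = x - d := by ring
  rw [h4] at h1
  have h5 := mul_le_mul_of_nonneg_left h2 (Real.exp_pos (-h ^ 2 / (2 * w))).le
  linarith

/-- A Rademacher sum containing weights in `[-1, 1]` of total square at least `50` and a weight at
least `7` lies in `(-1, 1)` with probability at most `1 / 5`. -/
lemma card_abs_signSum_lt_one_le {ι : Type*} [Fintype ι] [DecidableEq ι] (b : ι → ℝ)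
    (S R : Finset ι) (j : ι) (hj : j ∉ S) (hSR : Disjoint (insert j S) R)
    (hb : ∀ i ∈ S, b i ^ 2 ≤ 1) (hS : 50 ≤ ∑ i ∈ S, b i ^ 2) (hbj : 7 ≤ b j) :
    (#{ε : ι → Bool | |signSum b (R ∪ insert j S) ε| < 1} : ℝ) ≤
      Fintype.card (ι → Bool) * (1 / 5) := by
  obtain ⟨w, c, hw, hc, hc2, h⟩ := sum_exp_signSum_le b S hb
  have hw0 : 0 < w := by linarith
  set N : ℝ := ((Fintype.card (ι → Bool) : ℕ) : ℝ)
  have hN0 : 0 ≤ N := Nat.cast_nonneg _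
  have hstep : ∀ x, ∑ ε : ι → Bool, Real.exp (-(x + signSum b (insert j S) ε) ^ 2 / 4) ≤
      N * (c * Real.exp (-7 ^ 2 / (2 * w))) := by
    intro x
    rw [sum_signSum_insert b S j hj (fun y => Real.exp (-(x + y) ^ 2 / 4)), ← Finset.sum_div,
      Finset.sum_add_distrib]
    have e1 : ∑ ε : ι → Bool, Real.exp (-(x + (signSum b S ε + b j)) ^ 2 / 4) =
        ∑ ε : ι → Bool, Real.exp (-(x + b j + signSum b S ε) ^ 2 / 4) :=
      Finset.sum_congr rfl fun ε _ => by ring_nf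
    have e2 : ∑ ε : ι → Bool, Real.exp (-(x + (signSum b S ε - b j)) ^ 2 / 4) =
        ∑ ε : ι → Bool, Real.exp (-(x - b j + signSum b S ε) ^ 2 / 4) :=
      Finset.sum_congr rfl fun ε _ => by ring_nf
    rw [e1, e2]
    have h3 := mul_le_mul_of_nonneg_left
      (gaussian_average_le_of_le w x 7 (b j) (by linarith) (by norm_num) hbj)
      (mul_nonneg hN0 hc)
    linarith [h (x + b j), h (x - b j)]
  have hall := sum_signSum_le_of_subset b (insert j S) R hSR (fun y => Real.exp (-y ^ 2 / 4)) _
    hstep 0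
  simp only [zero_add] at hall
  have hcount : (#{ε : ι → Bool | |signSum b (R ∪ insert j S) ε| < 1} : ℝ) ≤
      Real.exp (1 / 4) *
        ∑ ε : ι → Bool, Real.exp (-signSum b (R ∪ insert j S) ε ^ 2 / 4) := by
    rw [Finset.card_filter, Nat.cast_sum, Finset.mul_sum]
    refine Finset.sum_le_sum fun ε _ => ?_
    rw [← Real.exp_add]
    split_ifs with hlt
    · have := (sq_lt_one_iff_abs_lt_one _).2 hlt
      rw [Nat.cast_one]
      apply Real.one_le_exp
      linarith
    · rw [Nat.cast_zero]
      exact (Real.exp_pos _).le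
  have hconst : Real.exp (1 / 4) * (c * Real.exp (-7 ^ 2 / (2 * w))) ≤ 1 / 5 := by
    refine (pow_le_pow_iff_left₀ (by positivity) (by norm_num) two_ne_zero).1 ?_
    have e1 : Real.exp (1 / 4) ^ 2 = Real.exp (1 / 2) := by
      rw [← Real.exp_nat_mul]; norm_num
    have e2 : Real.exp (-7 ^ 2 / (2 * w)) ^ 2 = Real.exp (-49 / w) := by
      rw [← Real.exp_nat_mul]; congr 1; push_cast; field_simp; norm_num
    have hy := Real.add_one_le_exp (50 / w - 1)
    have hy' : 50 / w * Real.exp (1 - 50 / w) ≤ 1 := by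
      calc 50 / w * Real.exp (1 - 50 / w)
          ≤ Real.exp (50 / w - 1) * Real.exp (1 - 50 / w) := by
            gcongr; linarith
        _ = 1 := by rw [← Real.exp_add]; simp
    rw [mul_pow, mul_pow, e1, e2]
    calc Real.exp (1 / 2) * (c ^ 2 * Real.exp (-49 / w))
        ≤ Real.exp (1 / 2) * (2 / w * Real.exp (1 / 2 - 1 / w) * Real.exp (-49 / w)) := by
          gcongr
      _ = 2 / w * (Real.exp (1 / 2) * Real.exp (1 / 2 - 1 / w) * Real.exp (-49 / w)) := by ring
      _ = 2 / w * Real.exp (1 - 50 / w) := by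
          rw [← Real.exp_add, ← Real.exp_add]; congr 2; ring
      _ = 1 / 25 * (50 / w * Real.exp (1 - 50 / w)) := by ring
      _ ≤ (1 / 5) ^ 2 := by linarith
  calc _ ≤ _ := hcount
    _ ≤ Real.exp (1 / 4) * (N * (c * Real.exp (-7 ^ 2 / (2 * w)))) := by gcongr
    _ = N * (Real.exp (1 / 4) * (c * Real.exp (-7 ^ 2 / (2 * w)))) := by ring
    _ ≤ N * (1 / 5) := by gcongr

/-- **Claim (large small-weight mass forces `q_1 ≥ 793/1024`).**
Let `n ≥ 4`, `a_1 ≥ ... ≥ a_n > 0` (0-indexed below) with `Σ a_i² = 1`,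
`a_1 + a_2 + a_3 < 1`, `a_3 = 1/3 - δ` with `0 < δ ≤ 1/120`, and `a_4 ≥ 21δ`.
Let `k` (1-based) be the smallest index with `a_k < 1 - a_1 - a_2 - a_3`
(`k = n + 1` if there is none), and suppose `Σ_{i=k}^n a_i² ≥ 450 δ²`.
Then for `Y = Σ_{i=4}^n a_i ε_i` (uniform measure on sign vectors `Fin n → Bool`),
`Pr[|Y| ≥ 1 - a_1 - a_2 - a_3] ≥ 793/1024`. -/
theorem tail_mass_large_implies_q1_large
    (n : ℕ) (hn : 4 ≤ n) (δ : ℝ) (hδ0 : 0 < δ) (hδ : δ ≤ 1 / 120)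
    (a : Fin n → ℝ)
    (hpos : ∀ i, 0 < a i)
    (hmono : ∀ i j : Fin n, i ≤ j → a j ≤ a i)
    (hsum : ∑ i, a i ^ 2 = 1)
    (h123 : a ⟨0, by omega⟩ + a ⟨1, by omega⟩ + a ⟨2, by omega⟩ < 1)
    (h3 : a ⟨2, by omega⟩ = 1 / 3 - δ)
    (h4 : 21 * δ ≤ a ⟨3, by omega⟩)
    (k : ℕ) (hkn : k ≤ n + 1)
    (hklt : ∀ i : Fin n, (i : ℕ) + 1 < k →
      1 - a ⟨0, by omega⟩ - a ⟨1, by omega⟩ - a ⟨2, by omega⟩ ≤ a i)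
    (hkge : ∀ i : Fin n, k ≤ (i : ℕ) + 1 →
      a i < 1 - a ⟨0, by omega⟩ - a ⟨1, by omega⟩ - a ⟨2, by omega⟩)
    (htail : 450 * δ ^ 2 ≤
      ∑ i ∈ Finset.univ.filter (fun i : Fin n => k ≤ (i : ℕ) + 1), a i ^ 2) :
    (793 : ℝ) / 1024 ≤
      ((Finset.univ.filter (fun ε : Fin n → Bool =>
          1 - a ⟨0, by omega⟩ - a ⟨1, by omega⟩ - a ⟨2, by omega⟩ ≤
            |∑ i ∈ Finset.univ.filter (fun i : Fin n => 3 ≤ (i : ℕ)),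
              a i * (if ε i then (1 : ℝ) else -1)|)).card : ℝ) / 2 ^ n := by
  set t : ℝ := 1 - a ⟨0, by omega⟩ - a ⟨1, by omega⟩ - a ⟨2, by omega⟩ with ht
  have h02 := hmono ⟨0, by omega⟩ ⟨2, by omega⟩ (by simp [Fin.le_def])
  have h12 := hmono ⟨1, by omega⟩ ⟨2, by omega⟩ (by simp [Fin.le_def])
  have ht0 : 0 < t := by rw [ht]; linarith
  have ht3 : t ≤ 3 * δ := by rw [ht]; linarith
  have hlarge : ∀ i : Fin n, (i : ℕ) ≤ 3 → ¬ k ≤ (i : ℕ) + 1 := by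
    intro i hi hki
    have h1 := hkge i hki
    have h2 := hmono i ⟨3, by omega⟩ (by simpa [Fin.le_def] using hi)
    linarith
  set S : Finset (Fin n) := {i : Fin n | k ≤ (i : ℕ) + 1} with hS
  set j : Fin n := ⟨3, by omega⟩ with hjdef
  set U : Finset (Fin n) := {i : Fin n | 3 ≤ (i : ℕ)} with hU
  have hjS : j ∉ S := by
    simpa [hS] using hlarge j le_rfl
  have hsub : insert j S ⊆ U := by
    intro i hi
    rw [Finset.mem_insert] at hi
    rcases hi with rfl | hi
    · simp [hU, hjdef]
    · simp only [hU, Finset.mem_filter, Finset.mem_univ, true_and]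
      by_contra hlt
      exact hlarge i (by omega) (by simpa [hS] using hi)
  have hprob := card_abs_signSum_lt_one_le (fun i => a i / t) S (U \ insert j S) j hjS
    Finset.disjoint_sdiff
    (by
      intro i hi
      have hlt := hkge i (by simpa [hS] using hi)
      rw [sq_le_one_iff₀ (div_nonneg (hpos i).le ht0.le), div_le_one ht0]
      exact hlt.le)
    (by
      simp only [div_pow]
      rw [← Finset.sum_div, le_div_iff₀ (by positivity)]
      nlinarith)
    (by
      rw [le_div_iff₀ ht0]
      linarith)
  rw [Finset.sdiff_union_of_subset hsub] at hprob
  have hscale : ∀ ε : Fin n → Bool, |signSum (fun i => a i / t) U ε| < 1 ↔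
      ¬ t ≤ |∑ i ∈ U, a i * (if ε i then (1 : ℝ) else -1)| := by
    intro ε
    have : signSum (fun i => a i / t) U ε =
        (∑ i ∈ U, a i * (if ε i then (1 : ℝ) else -1)) / t := by
      rw [signSum, Finset.sum_div]
      exact Finset.sum_congr rfl fun i _ => by ring
    rw [this, abs_div, abs_of_pos ht0, div_lt_one ht0, not_le]
  simp only [hscale] at hprob
  have hcompl := Finset.card_filter_add_card_filter_not (s := (Finset.univ : Finset (Fin n → Bool)))
    (fun ε : Fin n → Bool => t ≤ |∑ i ∈ U, a i * (if ε i then (1 : ℝ) else -1)|)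
  have hcard : Fintype.card (Fin n → Bool) = 2 ^ n := by simp
  rw [Finset.card_univ, hcard] at hcompl
  rw [hcard] at hprob
  have hcompl' := congrArg (Nat.cast (R := ℝ)) hcompl
  push_cast at hcompl' hprob
  have h2n : (0 : ℝ) < 2 ^ n := by positivity
  rw [le_div_iff₀ h2n]
  linarith
end
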